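/- Let F be a field with char F ≠ 2 and let n ≥ 1. For any positive integers α_1, α_2, β with α_1 + α_2 ≤ n and β ≤ n, the set of G-orbits on the triple flag variety M_{(α_1, α_2)} × M_{(β)} × M_{(n)} under the diagonal action of G = O_{2n+1}(F) is finite. -/

import Mathlib

open Module

/-- The symmetric bilinear form on `F^N` given by `(e_i, e_j) = δ_{i, N+1-j}`
(in 1-indexed notation), i.e. `(u, v) = ∑ i, u i * v (rev i)`. -/
def bform (F : Type*) [Field F] (N : ℕ) (u v : Fin N → F) : F :=
  ∑ i, u i * v i.rev

/-- `g` belongs to the split orthogonal group `O_N(F)`. -/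
def IsOrthMap (F : Type*) [Field F] (N : ℕ)
    (g : (Fin N → F) ≃ₗ[F] (Fin N → F)) : Prop :=
  ∀ u v, bform F N (g u) (g v) = bform F N u v

/-- A subspace `V` is isotropic if `(V, V) = {0}`. -/
def IsIsotropic (F : Type*) [Field F] (N : ℕ) (V : Submodule F (Fin N → F)) : Prop :=
  ∀ u ∈ V, ∀ v ∈ V, bform F N u v = 0

/-- A flag of type `a = (a 0, …, a (p-1))` in `F^{2n+1}` : an increasing chain of
subspaces `V 0 ⊆ ⋯ ⊆ V (p-1)` with `dim (V i) = a 0 + ⋯ + a i` which is isotropic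
(equivalently, by monotonicity, whose top member is isotropic). -/
def IsFlag (F : Type*) [Field F] (n p : ℕ) (a : Fin p → ℕ)
    (V : Fin p → Submodule F (Fin (2*n+1) → F)) : Prop :=
  Monotone V ∧ (∀ i : Fin p, finrank F (V i) = ∑ j ∈ Finset.Iic i, a j) ∧
    ∀ i : Fin p, IsIsotropic F (2*n+1) (V i)

/-- The flag variety `M_a`. -/
def FlagVar (F : Type*) [Field F] (n p : ℕ) (a : Fin p → ℕ) :=
  { V : Fin p → Submodule F (Fin (2*n+1) → F) // IsFlag F n p a V }

/-- The orbit relation of the diagonal action of `O_{2n+1}(F)` on the triple flag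
variety `M_a × M_b × M_c`. -/
def TripleRel (F : Type*) [Field F] (n p q r : ℕ)
    (a : Fin p → ℕ) (b : Fin q → ℕ) (c : Fin r → ℕ)
    (x y : FlagVar F n p a × FlagVar F n q b × FlagVar F n r c) : Prop :=
  ∃ g : (Fin (2*n+1) → F) ≃ₗ[F] (Fin (2*n+1) → F), IsOrthMap F (2*n+1) g ∧
    (∀ i, Submodule.map g.toLinearMap (x.1.1 i) = y.1.1 i) ∧
    (∀ i, Submodule.map g.toLinearMap (x.2.1.1 i) = y.2.1.1 i) ∧
    (∀ i, Submodule.map g.toLinearMap (x.2.2.1 i) = y.2.2.1 i)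

/-- A linear relation that is single-valued on `0` extends to a linear functional. -/
theorem exists_dual_of_graph {F V : Type*} [Field F] [AddCommGroup V] [Module F V]
    (H : Submodule F (V × F)) (hH : ∀ s, ((0 : V), s) ∈ H → s = 0) :
    ∃ g : Dual F V, ∀ x s, (x, s) ∈ H → g x = s := by
  have h1 : ((0 : V), (1 : F)) ∉ H := fun h => one_ne_zero (hH 1 h)
  obtain ⟨f, hf, hle⟩ := Submodule.exists_le_ker_of_notMem h1
  refine ⟨-(f (0, 1))⁻¹ • f.comp (LinearMap.inl F V F), fun x s hx => ?_⟩
  have h2 : f (x, s) = 0 := hle hx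
  have h3 : f (x, s) = f (x, 0) + s * f (0, 1) := by
    have : ((x, s) : V × F) = (x, 0) + s • (0, 1) := by simp
    rw [this, map_add, map_smul, smul_eq_mul]
  simp only [LinearMap.smul_apply, LinearMap.comp_apply, LinearMap.inl_apply, smul_eq_mul]
  field_simp
  linear_combination -h2 + h3

/-- A functional vanishing on `A` and agreeing with `f` on `B`. -/
theorem exists_dual_eq {F V : Type*} [Field F] [AddCommGroup V] [Module F V]
    (A B : Submodule F V) (f : Dual F V) (h : ∀ x ∈ A, x ∈ B → f x = 0) :
    ∃ g : Dual F V, (∀ x ∈ A, g x = 0) ∧ ∀ x ∈ B, g x = f x := by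
  obtain ⟨g, hg⟩ := exists_dual_of_graph
    (A.map (LinearMap.inl F V F) ⊔ B.map (LinearMap.prod LinearMap.id f)) (by
      intro s hs
      obtain ⟨_, ⟨a, ha, rfl⟩, _, ⟨b, hb, rfl⟩, hab⟩ := Submodule.mem_sup.1 hs
      have h1 : a + b = 0 := by simpa using congrArg Prod.fst hab
      have h2 : f b = s := by simpa using congrArg Prod.snd hab
      rw [← h2]
      refine h b ?_ hb
      rw [← neg_eq_of_add_eq_zero_right h1]
      exact A.neg_mem ha)
  refine ⟨g, fun x hx => hg x 0 (Submodule.mem_sup_left ⟨x, hx, rfl⟩),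
    fun x hx => hg x (f x) (Submodule.mem_sup_right ⟨x, hx, rfl⟩)⟩

/-- A functional vanishing on `A` and equal to `1` at a vector outside `A`. -/
theorem exists_dual_one {F V : Type*} [Field F] [AddCommGroup V] [Module F V]
    (A : Submodule F V) {v : V} (h : v ∉ A) :
    ∃ g : Dual F V, (∀ x ∈ A, g x = 0) ∧ g v = 1 := by
  obtain ⟨f, hf, hle⟩ := Submodule.exists_le_ker_of_notMem h
  refine ⟨(f v)⁻¹ • f, fun x hx => ?_, by simp [hf]⟩
  have : f x = 0 := hle hx
  simp [this]

/-- A functional on `C` that kills the left kernel of a pairing `C × N` is represented by `N`. -/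
theorem exists_mem_pairing_eq {F V W : Type*} [Field F] [AddCommGroup V] [Module F V]
    [AddCommGroup W] [Module F W] [FiniteDimensional F V]
    (B : V →ₗ[F] W →ₗ[F] F) (C : Submodule F V) (N : Submodule F W) (g : Dual F V)
    (h : ∀ c ∈ C, (∀ y ∈ N, B c y = 0) → g c = 0) :
    ∃ y ∈ N, ∀ c ∈ C, B c y = g c := by
  by_contra hcon
  push Not at hcon
  let R : Submodule F (Dual F C) := N.map ((Submodule.dualRestrict C).comp B.flip)
  have hg : Submodule.dualRestrict C g ∉ R := by
    rintro ⟨y, hy, hyg⟩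
    obtain ⟨c, hc, hne⟩ := hcon y hy
    exact hne (LinearMap.congr_fun hyg ⟨c, hc⟩)
  obtain ⟨Φ, hΦ, hle⟩ := Submodule.exists_le_ker_of_notMem hg
  obtain ⟨c, rfl⟩ := (evalEquiv F C).surjective Φ
  apply hΦ
  refine h c c.2 fun y hy => ?_
  have : (evalEquiv F C c) ((Submodule.dualRestrict C).comp B.flip y) = 0 := hle ⟨y, hy, rfl⟩
  simpa using this

/-- The scalars allowed as structure constants. -/
def smallScalars (F : Type*) [Field F] : Set F := {0, 1, -1, 2⁻¹, -2⁻¹}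

/-- Linear algebra data on a vector space: six subspaces, a pairing and a functional. -/
structure VD (F V : Type*) [Field F] [AddCommGroup V] [Module F V] where
  V1 : Submodule F V
  P : Submodule F V
  Q : Submodule F V
  C : Submodule F V
  T : Submodule F V
  D : Submodule F V
  γ : V →ₗ[F] V →ₗ[F] F
  lam : Dual F V

namespace VD

variable {F V : Type*} [Field F] [AddCommGroup V] [Module F V]

/-- The compatibility conditions between the constituents of a `VD`. -/
structure Ax (d : VD F V) : Prop where
  PC : d.P ≤ d.C
  QC : d.Q ≤ d.C
  CD : d.C ≤ d.D
  TD : d.T ≤ d.D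
  QT : d.Q ≤ d.T
  gP : ∀ x ∈ d.P, ∀ y ∈ d.D, d.γ x y = 0
  gQ : ∀ x ∈ d.Q, ∀ y ∈ d.D, d.γ x y = 0
  gCP : ∀ x ∈ d.C, ∀ y ∈ d.P, d.γ x y = 0
  gCT : ∀ x ∈ d.C, ∀ y ∈ d.T, d.γ x y = 0
  sym : ∀ x ∈ d.C, ∀ y ∈ d.C, d.γ x y + d.γ y x = -(d.lam x * d.lam y)

/-- The subspaces other than `V1`. -/
def subs (d : VD F V) : Set (Submodule F V) := {d.P, d.Q, d.C, d.T, d.D}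

/-- `b` is a basis in which the data is described by small scalars. -/
structure Good (d : VD F V) {ι : Type*} (b : Basis ι F V) : Prop where
  subs : ∀ S ∈ d.subs, ∀ i, b i ∈ S ∨ ∀ x ∈ S, b.repr x i = 0
  V1 : d.V1 ≤ Submodule.span F {x | x ∈ d.V1 ∧ ∀ i, b.repr x i ∈ smallScalars F}
  γ : ∀ i j, b i ∈ d.C → b j ∈ d.D → d.γ (b i) (b j) ∈ smallScalars F
  lam : ∀ i, b i ∈ d.C → d.lam (b i) ∈ ({0, 1, -1} : Set F)

/-- The data has a good basis. -/
def Kr (d : VD F V) : Prop :=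
  ∃ (ι : Type) (_ : Fintype ι) (b : Basis ι F V), d.Good b

/-- Restriction of the data to a subspace. -/
def restrict (d : VD F V) (Y : Submodule F V) : VD F Y where
  V1 := d.V1.comap Y.subtype
  P := d.P.comap Y.subtype
  Q := d.Q.comap Y.subtype
  C := d.C.comap Y.subtype
  T := d.T.comap Y.subtype
  D := d.D.comap Y.subtype
  γ := d.γ.domRestrict₁₂ Y Y
  lam := d.lam.comp Y.subtype

theorem Ax.restrict {d : VD F V} (h : d.Ax) (Y : Submodule F V) : (d.restrict Y).Ax where
  PC _ hx := h.PC hx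
  QC _ hx := h.QC hx
  CD _ hx := h.CD hx
  TD _ hx := h.TD hx
  QT _ hx := h.QT hx
  gP x hx y hy := h.gP x hx y hy
  gQ x hx y hy := h.gQ x hx y hy
  gCP x hx y hy := h.gCP x hx y hy
  gCT x hx y hy := h.gCT x hx y hy
  sym x hx y hy := h.sym x hx y hy

/-- A minimal counterexample to the existence of good bases. -/
structure Irr (d : VD F V) : Prop where
  two : (2 : F) ≠ 0
  ax : d.Ax
  nk : ¬ d.Kr
  ih : ∀ Y : Submodule F V, Y ≠ ⊤ → (d.restrict Y).Kr

section split

variable {κ : Type} [Fintype κ] [DecidableEq κ]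

/-- The decomposition of `V` given by a finite dual system. -/
def splitEquiv (e : κ → V) (ξ : κ → Dual F V)
    (hδ : ∀ i j, ξ i (e j) = if i = j then 1 else 0) :
    V ≃ₗ[F] (LinearMap.ker (LinearMap.pi ξ)) × (κ → F) :=
  LinearEquiv.ofLinearMap
    (LinearMap.prod
      (LinearMap.codRestrict _ (LinearMap.id - ∑ i, (ξ i).smulRight (e i)) (by
        intro x
        rw [LinearMap.mem_ker]
        ext j
        simp [LinearMap.sum_apply, hδ]))
      (LinearMap.pi ξ))
    (LinearMap.coprod (Submodule.subtype _) (Fintype.linearCombination F e))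
    (by
      apply LinearMap.ext
      rintro ⟨⟨y, hy⟩, f⟩
      have hy' : ∀ i, ξ i y = 0 := fun i => congrFun (LinearMap.mem_ker.1 hy) i
      have hf : ∀ i, ξ i (y + ∑ j, f j • e j) = f i := by
        intro i
        simp [hy', hδ]
      apply Prod.ext
      · apply Subtype.ext
        simp [Fintype.linearCombination_apply, LinearMap.sum_apply, hy', hδ]
      · ext i
        simpa [Fintype.linearCombination_apply] using hf i)
    (by
      apply LinearMap.ext
      intro x
      simp [Fintype.linearCombination_apply, LinearMap.sum_apply])

theorem Kr.of_split {d : VD F V} (e : κ → V) (ξ : κ → Dual F V)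
    (hδ : ∀ i j, ξ i (e j) = if i = j then 1 else 0)
    (ih : (d.restrict (LinearMap.ker (LinearMap.pi ξ))).Kr)
    (hS : ∀ S ∈ d.subs, ∀ i, e i ∈ S ∨ ∀ x ∈ S, ξ i x = 0)
    (hV1 : ∀ s ∈ d.V1, ∑ i, ξ i s • e i ∈ Submodule.span F
      {x | x ∈ d.V1 ∧ ∃ k : κ → F, (∀ i, k i ∈ smallScalars F) ∧ x = ∑ i, k i • e i})
    (hl : ∀ i, e i ∈ d.C → ∀ x ∈ d.D, (∀ j, ξ j x = 0) → d.γ (e i) x = 0)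
    (hr : ∀ j, e j ∈ d.D → ∃ k ∈ ({0, 1, -1} : Set F), ∀ c ∈ d.C, (∀ i, ξ i c = 0) →
      d.γ c (e j) = k * d.lam c)
    (ht : ∀ i j, e i ∈ d.C → e j ∈ d.D → d.γ (e i) (e j) ∈ smallScalars F)
    (hlam : ∀ i, e i ∈ d.C → d.lam (e i) ∈ ({0, 1, -1} : Set F)) : d.Kr := by
  obtain ⟨ι, _, b, hb⟩ := ih
  let E := splitEquiv e ξ hδ
  let B : Basis (ι ⊕ κ) F V := (b.prod (Pi.basisFun F κ)).map E.symm
  have hBl : ∀ i, B (Sum.inl i) = b i := fun i => by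
    simp [B, E, splitEquiv]
  have hBr : ∀ i, B (Sum.inr i) = e i := fun i => by
    simp [B, E, splitEquiv, Fintype.linearCombination_apply, Pi.single_apply]
  have hrr : ∀ x i, B.repr x (Sum.inr i) = ξ i x := fun x i => by
    simp [B, E, splitEquiv]
  have hrl : ∀ x i, B.repr x (Sum.inl i) = b.repr (E x).1 i := fun x i => by
    simp [B]
  have hE1 : ∀ x, ((E x).1 : V) = x - ∑ i, ξ i x • e i := fun x => by
    simp [E, splitEquiv, LinearMap.sum_apply]
  have hEy : ∀ y : LinearMap.ker (LinearMap.pi ξ), (E y).1 = y := by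
    intro y
    have hy' : ∀ i, ξ i y = 0 := fun i => congrFun (LinearMap.mem_ker.1 y.2) i
    apply Subtype.ext
    rw [hE1]
    simp [hy']
  have hyk : ∀ (i : ι) (j : κ), ξ j (b i) = 0 := fun i j =>
    congrFun (LinearMap.mem_ker.1 (b i).2) j
  have h0 : (0 : F) ∈ smallScalars F := by simp [smallScalars]
  have hSres : ∀ S ∈ d.subs, S.comap (Submodule.subtype (LinearMap.ker (LinearMap.pi ξ))) ∈
      (d.restrict (LinearMap.ker (LinearMap.pi ξ))).subs := by
    intro S hS
    simp only [VD.subs, Set.mem_insert_iff, Set.mem_singleton_iff] at hS ⊢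
    rcases hS with rfl | rfl | rfl | rfl | rfl <;> simp [VD.restrict]
  refine ⟨ι ⊕ κ, inferInstance, B, ?_, ?_, ?_, ?_⟩
  · rintro S hSS (i | i)
    · rw [hBl]
      rcases hb.subs _ (hSres S hSS) i with h | h
      · exact Or.inl h
      · right
        intro x hx
        rw [hrl]
        apply h
        rw [Submodule.mem_comap, Submodule.subtype_apply, hE1]
        refine S.sub_mem hx (S.sum_mem fun j _ => ?_)
        rcases hS S hSS j with h | h
        · exact S.smul_mem _ h
        · rw [h x hx, zero_smul]; exact S.zero_mem
    · rw [hBr]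
      simp only [hrr]
      exact hS S hSS i
  · intro s hs
    have hsum := hV1 s hs
    have hmem : ∑ i, ξ i s • e i ∈ d.V1 := by
      refine (Submodule.span_le.2 ?_ : _ ≤ d.V1) hsum
      exact fun x hx => hx.1
    have hdec : s = ((E s).1 : V) + ∑ i, ξ i s • e i := by rw [hE1]; abel
    rw [hdec]
    refine Submodule.add_mem _ ?_ ?_
    · have h1 : (E s).1 ∈ (d.restrict (LinearMap.ker (LinearMap.pi ξ))).V1 := by
        change ((E s).1 : V) ∈ d.V1
        rw [hE1]
        exact d.V1.sub_mem hs hmem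
      have h2 := Submodule.mem_map_of_mem (f := Submodule.subtype _) (hb.V1 h1)
      rw [Submodule.map_span] at h2
      refine Submodule.span_mono ?_ h2
      rintro _ ⟨y, ⟨hy1, hy2⟩, rfl⟩
      refine ⟨hy1, ?_⟩
      rintro (i | i)
      · rw [hrl, Submodule.subtype_apply, hEy]; exact hy2 i
      · rw [hrr]
        have : ξ i y = 0 := congrFun (LinearMap.mem_ker.1 y.2) i
        simpa [this] using h0
    · refine Submodule.span_mono ?_ hsum
      rintro x ⟨hx, k, hk, rfl⟩
      have hxi : ∀ i, ξ i (∑ j, k j • e j) = k i := fun i => by simp [hδ]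
      refine ⟨hx, ?_⟩
      rintro (i | i)
      · rw [hrl]
        have : (E (∑ j, k j • e j)).1 = 0 := by
          apply Subtype.ext
          rw [hE1]
          simp only [hxi]
          simp
        rw [this, map_zero]
        exact h0
      · rw [hrr, hxi]; exact hk i
  · rintro (i | i) (j | j)
    · rw [hBl, hBl]
      exact hb.γ i j
    · rw [hBl, hBr]
      intro hi hj
      obtain ⟨k, hk, hkc⟩ := hr j hj
      rw [hkc _ hi (hyk i)]
      have h1 := hb.lam i hi
      change d.lam (b i) ∈ _ at h1
      simp only [Set.mem_insert_iff, Set.mem_singleton_iff, smallScalars] at *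
      rcases hk with rfl | rfl | rfl <;> rcases h1 with h1 | h1 | h1 <;> simp [h1]
    · rw [hBl, hBr]
      intro hi hj
      rw [hl i hi _ hj (hyk j)]
      exact h0
    · rw [hBr, hBr]
      exact ht i j
  · rintro (i | i)
    · rw [hBl]
      exact hb.lam i
    · rw [hBr]
      exact hlam i

end split

end VD

namespace VD
variable {F V : Type*} [Field F] [AddCommGroup V] [Module F V]

theorem Irr.split {d : VD F V} (h : d.Irr) {κ : Type} [Fintype κ] [DecidableEq κ] [Nonempty κ]
    (e : κ → V) (ξ : κ → Dual F V)
    (hδ : ∀ i j, ξ i (e j) = if i = j then 1 else 0)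
    (hS : ∀ S ∈ d.subs, ∀ i, e i ∈ S ∨ ∀ x ∈ S, ξ i x = 0)
    (hV1 : ∀ s ∈ d.V1, ∑ i, ξ i s • e i ∈ Submodule.span F
      {x | x ∈ d.V1 ∧ ∃ k : κ → F, (∀ i, k i ∈ smallScalars F) ∧ x = ∑ i, k i • e i})
    (hl : ∀ i, e i ∈ d.C → ∀ x ∈ d.D, (∀ j, ξ j x = 0) → d.γ (e i) x = 0)
    (hr : ∀ j, e j ∈ d.D → ∃ k ∈ ({0, 1, -1} : Set F), ∀ c ∈ d.C, (∀ i, ξ i c = 0) →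
      d.γ c (e j) = k * d.lam c)
    (ht : ∀ i j, e i ∈ d.C → e j ∈ d.D → d.γ (e i) (e j) ∈ smallScalars F)
    (hlam : ∀ i, e i ∈ d.C → d.lam (e i) ∈ ({0, 1, -1} : Set F)) : False := by
  refine h.nk (Kr.of_split e ξ hδ (h.ih _ fun htop => ?_) hS hV1 hl hr ht hlam)
  let i : κ := Classical.arbitrary κ
  have h1 : e i ∈ LinearMap.ker (LinearMap.pi ξ) := htop ▸ Submodule.mem_top
  have h2 : ξ i (e i) = 0 := congrFun (LinearMap.mem_ker.1 h1) i
  simp [hδ] at h2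

theorem Irr.D_eq_top {d : VD F V} (h : d.Irr) : d.D = ⊤ := by
  have key : ∀ x ∉ d.D, (x ∈ d.V1 ∨ d.V1 ≤ d.D) → False := by
    intro x hx hV
    obtain ⟨ξ, hξ, hξx⟩ := exists_dual_one d.D hx
    have hC : d.C ≤ d.D := h.ax.CD
    refine h.split (κ := Unit) (fun _ => x) (fun _ => ξ) (by simp [hξx]) ?_ ?_
      (fun _ hxC => absurd (hC hxC) hx) (fun _ hxD => absurd hxD hx)
      (fun _ _ hxC => absurd (hC hxC) hx) (fun _ hxC => absurd (hC hxC) hx)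
    · intro S hS _
      right
      intro y hy
      apply hξ
      simp only [VD.subs, Set.mem_insert_iff, Set.mem_singleton_iff] at hS
      rcases hS with rfl | rfl | rfl | rfl | rfl
      · exact hC (h.ax.PC hy)
      · exact hC (h.ax.QC hy)
      · exact hC hy
      · exact h.ax.TD hy
      · exact hy
    · intro s hs
      rcases hV with hV | hV
      · simp only [Finset.univ_unique, Finset.sum_singleton]
        refine Submodule.smul_mem _ _ (Submodule.subset_span ⟨hV, 1, ?_, ?_⟩)
        · simp [smallScalars]
        · simp
      · simp [hξ s (hV hs)]
  by_contra hD
  obtain ⟨x, -, hx⟩ := SetLike.exists_of_lt (lt_top_iff_ne_top.2 hD)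
  by_cases hV : d.V1 ≤ d.D
  · exact key x hx (Or.inr hV)
  · obtain ⟨y, hy, hy'⟩ := SetLike.not_le_iff_exists.1 hV
    exact key y hy' (Or.inl hy)

/-- The subspaces other than `V1` and `D`. -/
def subs' (d : VD F V) : Set (Submodule F V) := {d.P, d.Q, d.C, d.T}

/-- `t` is a vector with `e i + t ∈ V1` that can be split off together with the `e j`. -/
structure Attach (d : VD F V) {κ : Type} (e : κ → V) (ξ : κ → Dual F V) (i : κ) (t : V)
    (A : Submodule F V) : Prop where
  mem : e i + t ∈ d.V1
  ξt : ∀ j, ξ j t = 0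
  gC : ∀ c ∈ d.C, d.γ c t = 0
  gt : t ∈ d.C → ∀ x, d.γ t x = 0
  subs : ∀ S ∈ d.subs', t ∈ S ∨ S ≤ A
  eAV : ∀ j, e j ∈ A ∨ e j ∈ d.V1
  van : ∀ x ∈ d.V1, x ∈ A → ξ i x = 0

/-- How the `i`-th vector of a dual system interacts with `V1`. -/
def Stat (d : VD F V) {κ : Type} (e : κ → V) (ξ : κ → Dual F V) (i : κ) : Prop :=
  e i ∈ d.V1 ∨ (∀ x ∈ d.V1, ξ i x = 0) ∨ ∃ t A, d.Attach e ξ i t A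

theorem Irr.splitAtt {d : VD F V} (h : d.Irr) {κ : Type} [Fintype κ] [DecidableEq κ] [Nonempty κ]
    (e : κ → V) (ξ : κ → Dual F V)
    (hδ : ∀ i j, ξ i (e j) = if i = j then 1 else 0)
    (hS : ∀ S ∈ d.subs', ∀ i, e i ∈ S ∨ ∀ x ∈ S, ξ i x = 0)
    (hst : ∀ i, d.Stat e ξ i)
    (hl : ∀ i, e i ∈ d.C → ∀ x, (∀ j, ξ j x = 0) → d.γ (e i) x = 0)
    (hr : ∀ j, ∃ k ∈ ({0, 1, -1} : Set F), ∀ c ∈ d.C, (∀ i, ξ i c = 0) →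
      d.γ c (e j) = k * d.lam c)
    (ht : ∀ i j, e i ∈ d.C → d.γ (e i) (e j) ∈ smallScalars F)
    (hlam : ∀ i, e i ∈ d.C → d.lam (e i) ∈ ({0, 1, -1} : Set F)) : False := by
  classical
  have hD := h.D_eq_top
  have h0 : (0 : F) ∈ smallScalars F := by simp [smallScalars]
  have h1 : (1 : F) ∈ smallScalars F := by simp [smallScalars]
  obtain ⟨p, hp⟩ : ∃ p : κ → Prop, ∀ i, p i ↔ e i ∉ d.V1 ∧ ¬ ∀ x ∈ d.V1, ξ i x = 0 :=
    ⟨_, fun _ => Iff.rfl⟩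
  have hτ : ∀ i : {i // p i}, ∃ t A, d.Attach e ξ i t A := fun i =>
    ((hst i).resolve_left ((hp i).1 i.2).1).resolve_left ((hp i).1 i.2).2
  choose t A hA using hτ
  have hη : ∀ i : {i // p i}, ∃ g : Dual F V, (∀ x ∈ A i, g x = 0) ∧ ∀ x ∈ d.V1, g x = ξ i x :=
    fun i => exists_dual_eq (A i) d.V1 (ξ i) fun x hx hx' => (hA i).van x hx' hx
  choose η hηA hηV using hη
  have hηe : ∀ i j, η i (e j) = 0 := by
    intro i j
    rcases (hA i).eAV j with hj | hj
    · exact hηA i _ hj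
    · rw [hηV i _ hj, hδ, if_neg]
      rintro rfl
      exact ((hp i).1 i.2).1 hj
  have hηt : ∀ i j, η i (t j) = if i = j then 1 else 0 := by
    intro i j
    have h2 := hηV i _ (hA j).mem
    rw [map_add, map_add, hηe, (hA j).ξt, hδ, zero_add, add_zero] at h2
    rw [h2]
    simp [Subtype.ext_iff]
  refine h.split (κ := κ ⊕ {i // p i}) (Sum.elim e t) (Sum.elim ξ η) ?_ ?_ ?_ ?_ ?_ ?_ ?_
  · rintro (i | i) (j | j)
    · simp [hδ]
    · simp [(hA j).ξt]
    · simpa using hηe i j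
    · simp [hηt]
  · intro S hSS i
    have hS4 : S ∈ d.subs' ∨ S = d.D := by
      simp only [VD.subs, VD.subs', Set.mem_insert_iff, Set.mem_singleton_iff] at *
      tauto
    rcases hS4 with hS4 | rfl
    · rcases i with i | i
      · exact hS S hS4 i
      · exact ((hA i).subs S hS4).imp id fun hle x hx => hηA i x (hle hx)
    · left
      rw [hD]
      trivial
  · intro s hs
    have hterm : ∑ i, (Sum.elim ξ η i) s • (Sum.elim e t i) =
        ∑ i : {i // p i}, ξ i s • (e i + t i) + ∑ i : {i : κ // ¬ p i},
          ξ i s • e i := by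
      have h2 := Fintype.sum_subtype_add_sum_subtype
        p (fun i => ξ i s • e i)
      simp only [Fintype.sum_sum_type, Sum.elim_inl, Sum.elim_inr, smul_add,
        Finset.sum_add_distrib]
      rw [← h2]
      simp only [hηV _ s hs]
      abel
    rw [hterm]
    have hsingle : ∀ {α : Type} [DecidableEq α] (i j : α),
        (Pi.single i 1 : α → F) j ∈ smallScalars F := by
      intro α _ i j
      rw [Pi.single_apply]
      split_ifs
      exacts [h1, h0]
    refine Submodule.add_mem _ ?_ ?_
    · refine Submodule.sum_mem _ fun i _ => Submodule.smul_mem _ _ (Submodule.subset_span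
        ⟨(hA i).mem, Sum.elim (Pi.single i.1 1) (Pi.single i 1), ?_, ?_⟩)
      · rintro (j | j)
        · exact hsingle _ _
        · exact hsingle _ _
      · simp [Pi.single_apply, ite_smul]
    · refine Submodule.sum_mem _ fun i _ => ?_
      by_cases hv : ∀ x ∈ d.V1, ξ i x = 0
      · rw [hv s hs, zero_smul]; exact Submodule.zero_mem _
      have hi : e i ∈ d.V1 := by
        by_contra hi
        exact i.2 ((hp i).2 ⟨hi, hv⟩)
      refine Submodule.smul_mem _ _ (Submodule.subset_span
        ⟨hi, Sum.elim (Pi.single i.1 1) 0, ?_, ?_⟩)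
      · rintro (j | j)
        · exact hsingle _ _
        · exact h0
      · simp [Pi.single_apply, ite_smul]
  · rintro (i | i) hi x - hx
    · exact hl i hi x fun j => hx (Sum.inl j)
    · exact (hA i).gt hi x
  · rintro (j | j) -
    · obtain ⟨k, hk, hkc⟩ := hr j
      exact ⟨k, hk, fun c hc hcξ => hkc c hc fun i => hcξ (Sum.inl i)⟩
    · exact ⟨0, by simp, fun c hc _ => by simpa using (hA j).gC c hc⟩
  · rintro (i | i) (j | j) hi -
    · exact ht i j hi
    · change d.γ (e i) (t j) ∈ _
      rw [(hA j).gC (e i) hi]; exact h0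
    · simpa [(hA i).gt hi] using h0
    · simpa [(hA i).gt hi] using h0
  · rintro (i | i) hi
    · exact hlam i hi
    · have h2 := h.ax.sym _ hi _ hi
      simp only [Sum.elim_inr] at h2 hi
      rw [(hA i).gt hi, add_zero, eq_comm, neg_eq_zero, mul_self_eq_zero] at h2
      simp [h2]

end VD

namespace VD
variable {F V : Type*} [Field F] [AddCommGroup V] [Module F V]

/-- `t` is radical for the pairing. -/
structure Rad (d : VD F V) (t : V) : Prop where
  gC : ∀ c ∈ d.C, d.γ c t = 0
  gt : t ∈ d.C → ∀ x, d.γ t x = 0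

/-- `x` can be split off, with coordinate `f`, together with the radical vector `t`. -/
structure Att (d : VD F V) (x : V) (f : Dual F V) (t : V) (A : Submodule F V) : Prop where
  mem : x + t ∈ d.V1
  ft : f t = 0
  rad : d.Rad t
  subs : ∀ S ∈ d.subs', t ∈ S ∨ S ≤ A
  xA : x ∈ A
  van : ∀ v ∈ d.V1, v ∈ A → f v = 0

/-- The possible interactions with `V1` of a vector `x` with coordinate `f` that is split off
together with the vectors of `W`. -/
def St (d : VD F V) (x : V) (f : Dual F V) (W : Set V) : Prop :=
  x ∈ d.V1 ∨ (∀ v ∈ d.V1, f v = 0) ∨ ∃ t A, d.Att x f t A ∧ ∀ w ∈ W, w ∈ A ∨ w ∈ d.V1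

theorem St.stat {d : VD F V} {κ : Type} {e : κ → V} {ξ : κ → Dual F V} {i : κ} {W : Set V}
    (h : d.St (e i) (ξ i) W) (hW : ∀ j, j ≠ i → e j ∈ W)
    (hξ : ∀ j, j ≠ i → ∀ t, (∀ c ∈ d.C, d.γ c t = 0) → ξ j t = 0) : d.Stat e ξ i := by
  classical
  rcases h with h | h | ⟨t, A, h, hA⟩
  · exact Or.inl h
  · exact Or.inr (Or.inl h)
  · refine Or.inr (Or.inr ⟨t, A, h.mem, fun j => ?_, h.rad.gC, h.rad.gt, h.subs,
      fun j => ?_, h.van⟩)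
    · by_cases hj : j = i
      · rw [hj]; exact h.ft
      · exact hξ j hj t h.rad.gC
    · by_cases hj : j = i
      · rw [hj]; exact Or.inl h.xA
      · exact hA _ (hW j hj)

/-- A radical vector `t` with `x + t ∈ V1`. -/
structure AttC (d : VD F V) (x t : V) (A : Submodule F V) : Prop where
  mem : x + t ∈ d.V1
  rad : d.Rad t
  subs : ∀ S ∈ d.subs', t ∈ S ∨ S ≤ A
  CA : d.C ≤ A

/-- The possible interactions with `V1` of a vector `x` of `C` whose coordinate vanishes at all
vectors satisfying `p`. -/
def StC (d : VD F V) (x : V) (p : V → Prop) : Prop :=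
  x ∈ d.V1 ∨ (∀ v ∈ d.V1, p v) ∨ ∃ t A, d.AttC x t A ∧ ∀ v ∈ d.V1, v ∈ A → p v

theorem Rad.smul {d : VD F V} {t : V} (h : d.Rad t) (a : F) : d.Rad (a • t) := by
  refine ⟨fun c hc => by simp [h.gC c hc], fun ht x => ?_⟩
  rcases eq_or_ne a 0 with rfl | ha
  · simp
  · simp [h.gt ((d.C.smul_mem_iff ha).1 ht)]

theorem StC.smul {d : VD F V} {x : V} {p : V → Prop} (h : d.StC x p) (a : F) :
    d.StC (a • x) p := by
  rcases h with h | h | ⟨t, A, h, hp⟩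
  · exact Or.inl (d.V1.smul_mem _ h)
  · exact Or.inr (Or.inl h)
  · refine Or.inr (Or.inr ⟨a • t, A, ⟨?_, h.rad.smul a, ?_, h.CA⟩, hp⟩)
    · rw [← smul_add]; exact d.V1.smul_mem _ h.mem
    · exact fun S hS => (h.subs S hS).imp_left (S.smul_mem _)

theorem StC.st {d : VD F V} {x : V} {p : V → Prop} (h : d.StC x p) (hx : x ∈ d.C) {f : Dual F V}
    {W : Set V} (hW : ∀ w ∈ W, w ∈ d.C) (hf : ∀ t, d.Rad t → f t = 0) (hp : ∀ v, p v → f v = 0) :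
    d.St x f W := by
  rcases h with h | h | ⟨t, A, h, hpA⟩
  · exact Or.inl h
  · exact Or.inr (Or.inl fun v hv => hp v (h v hv))
  · exact Or.inr (Or.inr ⟨t, A, ⟨h.mem, hf t h.rad, h.rad, h.subs, h.CA hx,
      fun v hv hvA => hp v (hpA v hv hvA)⟩, fun w hw => Or.inl (h.CA (hW w hw))⟩)

theorem forall_subs' {d : VD F V} {p : Submodule F V → Prop} :
    (∀ S ∈ d.subs', p S) ↔ p d.P ∧ p d.Q ∧ p d.C ∧ p d.T := by
  simp [subs']

section basic

variable {d : VD F V} (h : d.Irr)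
include h

theorem Irr.gP {x : V} (hx : x ∈ d.P) (y : V) : d.γ x y = 0 :=
  h.ax.gP x hx y (by rw [h.D_eq_top]; trivial)

theorem Irr.gQ {x : V} (hx : x ∈ d.Q) (y : V) : d.γ x y = 0 :=
  h.ax.gQ x hx y (by rw [h.D_eq_top]; trivial)

theorem Irr.swap {x y : V} (hx : x ∈ d.C) (hy : y ∈ d.C) :
    d.γ x y = -d.γ y x - d.lam x * d.lam y := by
  linear_combination h.ax.sym x hx y hy

theorem Irr.lam_eq_zero {x : V} (hx : x ∈ d.C) (h0 : d.γ x x = 0) : d.lam x = 0 := by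
  have := h.ax.sym x hx x hx
  rw [h0] at this
  have h2 : d.lam x * d.lam x = 0 := by linear_combination this
  simpa using h2

theorem Irr.self_eq_zero {x : V} (hx : x ∈ d.C) (h0 : d.lam x = 0) : d.γ x x = 0 := by
  have := h.ax.sym x hx x hx
  rw [h0] at this
  have h2 : 2 * d.γ x x = 0 := by linear_combination this
  exact (mul_eq_zero.1 h2).resolve_left h.two

theorem Irr.self_eq {x : V} (hx : x ∈ d.C) (h1 : d.lam x = 1) : d.γ x x = -2⁻¹ := by
  have := h.ax.sym x hx x hx
  rw [h1] at this
  have h2 := h.two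
  field_simp
  linear_combination this

/-- Splitting off one radical vector. -/
theorem Irr.single (v : V) (A : Submodule F V) (hr : d.Rad v) (hv : v ∉ A)
    (hS : ∀ S ∈ d.subs', v ∈ S ∨ S ≤ A) (hV : v ∈ d.V1 ∨ d.V1 ≤ A) : False := by
  obtain ⟨ξ, hξ, hξv⟩ := exists_dual_one A hv
  refine h.splitAtt (κ := Unit) (fun _ => v) (fun _ => ξ) (by simp [hξv])
    (fun S hSS _ => (hS S hSS).imp_right fun hle x hx => hξ x (hle hx))
    (fun _ => hV.imp_right fun hle => Or.inl fun x hx => hξ x (hle hx))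
    (fun _ hC x _ => hr.gt hC x) (fun _ => ⟨0, by simp, fun c hc _ => by simp [hr.gC c hc]⟩)
    (fun _ _ hC => by simp [hr.gt hC, smallScalars])
    (fun _ hC => by simp [h.lam_eq_zero hC (hr.gt hC v)])

/-- Splitting off two radical vectors whose sum lies in `V1`. -/
theorem Irr.pair (x y : V) (A B : Submodule F V) (hxr : d.Rad x) (hyr : d.Rad y)
    (hxy : x + y ∈ d.V1) (hyA : y ∈ A) (hxB : x ∈ B)
    (hSx : ∀ S ∈ d.subs', x ∈ S ∨ S ≤ A) (hSy : ∀ S ∈ d.subs', y ∈ S ∨ S ≤ B)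
    (hx : x ∉ A ⊔ (d.V1 ⊓ B)) : False := by
  obtain ⟨ξ, hξ, hξx⟩ := exists_dual_one _ hx
  refine h.splitAtt (κ := Unit) (fun _ => x) (fun _ => ξ) (by simp [hξx])
    (fun S hSS _ => (hSx S hSS).imp_right fun hle z hz => hξ z (Submodule.mem_sup_left (hle hz)))
    (fun _ => Or.inr (Or.inr ⟨y, B, hxy, fun _ => hξ y (Submodule.mem_sup_left hyA), hyr.gC,
      hyr.gt, hSy, fun _ => Or.inl hxB,
      fun z hz hz' => hξ z (Submodule.mem_sup_right ⟨hz, hz'⟩)⟩))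
    (fun _ hC x _ => hxr.gt hC x) (fun _ => ⟨0, by simp, fun c hc _ => by simp [hxr.gC c hc]⟩)
    (fun _ _ hC => by simp [hxr.gt hC, smallScalars])
    (fun _ hC => by simp [h.lam_eq_zero hC (hxr.gt hC x)])

/-- Splitting off `r` in the radical of `C` together with a vector dual to it. -/
theorem Irr.rz (r w : V) (ξ : Dual F V) (hr : r ∈ d.C) (hrC : ∀ c ∈ d.C, d.γ r c = 0)
    (hrw : d.γ r w = 1) (hξw : ξ w = 0) (hξC : ∀ c ∈ d.C, ξ c = d.γ c w)
    (hT : r ∈ d.T ∨ ∀ x ∈ d.T, ξ x = 0) (hw : w ∈ d.V1 ∨ ∀ x ∈ d.V1, d.γ r x = 0)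
    (hst : d.St r ξ {w}) : False := by
  have hlr := h.lam_eq_zero hr (hrC r hr)
  have hwC : w ∉ d.C := fun hw => by simp [hrC w hw] at hrw
  have hξr : ξ r = 1 := by rw [hξC r hr, hrw]
  refine h.splitAtt (κ := Fin 2) ![r, w] ![ξ, d.γ r] ?_ ?_ ?_ ?_ ?_ ?_ ?_
  · simp [Fin.forall_fin_two, hξr, hξw, hrC r hr, hrw]
  · rw [forall_subs']
    simp only [Fin.forall_fin_two, Matrix.cons_val_zero, Matrix.cons_val_one]
    refine ⟨⟨Or.inr fun x hx => ?_, Or.inr fun x hx => h.ax.gCP r hr x hx⟩,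
      ⟨Or.inr fun x hx => ?_, Or.inr fun x hx => h.ax.gCT r hr x (h.ax.QT hx)⟩,
      ⟨Or.inl hr, Or.inr hrC⟩, ⟨hT, Or.inr (h.ax.gCT r hr)⟩⟩
    · rw [hξC x (h.ax.PC hx), h.gP hx]
    · rw [hξC x (h.ax.QC hx), h.gQ hx]
  · rw [Fin.forall_fin_two]
    refine ⟨St.stat (W := {w}) hst ?_ ?_, hw.imp_right Or.inl⟩
    · simp [Fin.forall_fin_two]
    · simp only [Fin.forall_fin_two]
      exact ⟨fun h => (h rfl).elim, fun _ t ht => ht r hr⟩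
  · simp only [Fin.forall_fin_two, Matrix.cons_val_zero, Matrix.cons_val_one]
    exact ⟨fun _ x hx => hx.2, fun hw => (hwC hw).elim⟩
  · simp only [Fin.forall_fin_two, Matrix.cons_val_zero, Matrix.cons_val_one]
    refine ⟨⟨0, by simp, fun c hc _ => ?_⟩, ⟨0, by simp, fun c hc hx => ?_⟩⟩
    · rw [h.swap hc hr, hrC c hc, hlr]; simp
    · rw [← hξC c hc, hx.1]; simp
  · simp only [Fin.forall_fin_two, Matrix.cons_val_zero, Matrix.cons_val_one]
    refine ⟨⟨fun _ => ?_, fun _ => ?_⟩, fun hw => (hwC hw).elim, fun hw => (hwC hw).elim⟩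
    · simp [hrC r hr, smallScalars]
    · simp [hrw, smallScalars]
  · simp only [Fin.forall_fin_two, Matrix.cons_val_zero, Matrix.cons_val_one]
    exact ⟨fun _ => by simp [hlr], fun hw => (hwC hw).elim⟩

/-- Splitting off a non-isotropic vector of `C`. -/
theorem Irr.peel (c : V) (hc : c ∈ d.C) (hl : d.lam c ≠ 0)
    (hst : d.StC c fun v => d.γ c v = 0) : False := by
  have hsc : ∃ c, c ∈ d.C ∧ d.lam c = 1 ∧ d.StC c fun v => d.γ c v = 0 := by
    refine ⟨(d.lam c)⁻¹ • c, d.C.smul_mem _ hc, by simp [hl], ?_⟩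
    simpa [hl] using hst.smul (d.lam c)⁻¹
  clear hst hl hc c
  obtain ⟨c, hc, hl, hst⟩ := hsc
  have hcc := h.self_eq hc hl
  have h2 := h.two
  have hcc' : -2 * d.γ c c = 1 := by rw [hcc]; field_simp
  refine h.splitAtt (κ := Unit) (fun _ => c) (fun _ => (-2 : F) • d.γ c) ?_ ?_ ?_ ?_ ?_ ?_ ?_
  · simpa using hcc'
  · rw [forall_subs']
    refine ⟨fun _ => Or.inr fun x hx => ?_, fun _ => Or.inr fun x hx => ?_, fun _ => Or.inl hc,
      fun _ => Or.inr fun x hx => ?_⟩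
    · simp [h.ax.gCP c hc x hx]
    · simp [h.ax.gCT c hc x (h.ax.QT hx)]
    · simp [h.ax.gCT c hc x hx]
  · intro i
    exact St.stat (W := ∅) (hst.st hc (by simp) (fun t ht => by simp [ht.gC c hc])
      fun v hv => by simp [hv]) (fun j hj => (hj rfl).elim) fun j hj => (hj rfl).elim
  · intro _ _ x hx
    have := hx ()
    simpa [h2] using this
  · refine fun _ => ⟨-1, by simp, fun c' hc' hx => ?_⟩
    have hx0 : d.γ c c' = 0 := by simpa [h2] using hx ()
    rw [h.swap hc' hc, hx0, hl]; ring
  · intro _ _ _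
    simp [hcc, smallScalars]
  · intro _ _
    simp [hl]

/-- Splitting off two vectors of `C` that are dual to each other. -/
theorem Irr.hp_aux (c y : V) (hc : c ∈ d.C) (hy : y ∈ d.C) (hl : d.lam c = 0)
    (hly : d.lam y = 0 ∨ d.lam y = 1) (hcy : d.γ c y = 1)
    (hstc : d.St c (-d.γ y + d.γ y y • d.γ c) {y}) (hsty : d.St y (d.γ c) {c}) : False := by
  have hcc := h.self_eq_zero hc hl
  have hyc : d.γ y c = -1 := by rw [h.swap hy hc, hcy, hl]; ring
  refine h.splitAtt (κ := Fin 2) ![c, y] ![-d.γ y + d.γ y y • d.γ c, d.γ c] ?_ ?_ ?_ ?_ ?_ ?_ ?_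
  · simp [Fin.forall_fin_two, hcc, hcy, hyc]
  · rw [forall_subs']
    simp only [Fin.forall_fin_two, Matrix.cons_val_zero, Matrix.cons_val_one]
    refine ⟨⟨Or.inr fun x hx => ?_, Or.inr fun x hx => ?_⟩,
      ⟨Or.inr fun x hx => ?_, Or.inr fun x hx => ?_⟩, ⟨Or.inl hc, Or.inl hy⟩,
      ⟨Or.inr fun x hx => ?_, Or.inr fun x hx => ?_⟩⟩
    · simp [h.ax.gCP c hc x hx, h.ax.gCP y hy x hx]
    · simp [h.ax.gCP c hc x hx]
    · simp [h.ax.gCT c hc x (h.ax.QT hx), h.ax.gCT y hy x (h.ax.QT hx)]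
    · simp [h.ax.gCT c hc x (h.ax.QT hx)]
    · simp [h.ax.gCT c hc x hx, h.ax.gCT y hy x hx]
    · simp [h.ax.gCT c hc x hx]
  · rw [Fin.forall_fin_two]
    refine ⟨St.stat (W := {y}) hstc ?_ ?_, St.stat (W := {c}) hsty ?_ ?_⟩
    · simp [Fin.forall_fin_two]
    · simp only [Fin.forall_fin_two]
      exact ⟨fun h => (h rfl).elim, fun _ t ht => ht c hc⟩
    · simp [Fin.forall_fin_two]
    · simp only [Fin.forall_fin_two]
      refine ⟨fun _ t ht => ?_, fun h => (h rfl).elim⟩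
      simp [ht c hc, ht y hy]
  · simp only [Fin.forall_fin_two, Matrix.cons_val_zero, Matrix.cons_val_one]
    refine ⟨fun _ x hx => hx.2, fun _ x hx => ?_⟩
    simpa [hx.2] using hx.1
  · simp only [Fin.forall_fin_two, Matrix.cons_val_zero, Matrix.cons_val_one]
    refine ⟨⟨0, by simp, fun x hx hx' => ?_⟩, ⟨-d.lam y, ?_, fun x hx hx' => ?_⟩⟩
    · rw [h.swap hx hc, hx'.2, hl]; ring
    · rcases hly with h | h <;> simp [h]
    · have h1 : d.γ y x = 0 := by simpa [hx'.2] using hx'.1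
      rw [h.swap hx hy, h1]; ring
  · simp only [Fin.forall_fin_two, Matrix.cons_val_zero, Matrix.cons_val_one]
    refine ⟨⟨fun _ => ?_, fun _ => ?_⟩, fun _ => ?_, fun _ => ?_⟩
    · simp [hcc, smallScalars]
    · simp [hcy, smallScalars]
    · simp [hyc, smallScalars]
    · rcases hly with hly | hly
      · simp [h.self_eq_zero hy hly, smallScalars]
      · simp [h.self_eq hy hly, smallScalars]
  · simp only [Fin.forall_fin_two, Matrix.cons_val_zero, Matrix.cons_val_one]
    refine ⟨fun _ => by simp [hl], fun _ => ?_⟩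
    rcases hly with h | h <;> simp [h]

theorem Irr.exists_smul_lam (g : V) : ∃ a : F, a ≠ 0 ∧ (d.lam (a • g) = 0 ∨ d.lam (a • g) = 1) := by
  have _ := h
  by_cases hg : d.lam g = 0
  · exact ⟨1, one_ne_zero, Or.inl (by simp [hg])⟩
  · exact ⟨(d.lam g)⁻¹, inv_ne_zero hg, Or.inr (by simp [hg])⟩

theorem Irr.hp (c y : V) (hc : c ∈ d.C) (hy : y ∈ d.C) (hl : d.lam c = 0) (hcy : d.γ c y ≠ 0)
    (hstc : d.StC c fun v => d.γ y v = 0 ∧ d.γ c v = 0) (hsty : d.StC y fun v => d.γ c v = 0) :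
    False := by
  obtain ⟨a, ha, hla⟩ := h.exists_smul_lam y
  refine h.hp_aux ((a * d.γ c y)⁻¹ • c) (a • y) (d.C.smul_mem _ hc) (d.C.smul_mem _ hy)
    (by simp [hl]) hla (by simp; field_simp) ?_ ?_
  · refine (hstc.smul _).st (d.C.smul_mem _ hc) (by simpa using d.C.smul_mem a hy) ?_ ?_
    · intro t ht
      simp [ht.gC c hc, ht.gC y hy]
    · rintro v ⟨h1, h2⟩
      simp [h1, h2]
  · refine (hsty.smul _).st (d.C.smul_mem _ hy) (by simpa using d.C.smul_mem _ hc) ?_ ?_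
    · intro t ht
      simp [ht.gC c hc]
    · intro v hv
      simp [hv]

/-- Splitting off four vectors `r`, `c`, `g`, `z`. -/
theorem Irr.quad (r c g z : V) (ξ : Dual F V) (hr : r ∈ d.C) (hc : c ∈ d.C) (hg : g ∈ d.C)
    (hz : z ∈ d.V1) (hrC : ∀ x ∈ d.C, d.γ r x = 0) (hl : d.lam c = 0)
    (hlg : d.lam g = 0 ∨ d.lam g = 1) (hcg : d.γ c g = 1) (hrz : d.γ r z = 1)
    (hgz : d.γ g z = 0) (hrc : ∀ v ∈ d.V1, d.γ c v = d.γ r v)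
    (hξz : ξ z = 0) (hξC : ∀ x ∈ d.C, ξ x = d.γ x z + d.γ g x - d.γ g g * d.γ c x)
    (hT : r ∈ d.T ∨ ∀ x ∈ d.T, ξ x = 0) (hstr : d.St r ξ d.C)
    (hstc : c ∈ d.V1 ∨ ∃ t, d.AttC c t d.C ∧ ξ t = 0 ∧
      ∀ v ∈ d.V1, v ∈ d.C → d.γ g v = 0) : False := by
  have hzC : z ∉ d.C := fun hz => by simp [hrC z hz] at hrz
  have hcc := h.self_eq_zero hc hl
  have hrr := hrC r hr
  have hlr := h.lam_eq_zero hr hrr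
  have hgc : d.γ g c = -1 := by rw [h.swap hg hc, hcg, hl]; ring
  have hCr : ∀ x ∈ d.C, d.γ x r = 0 := fun x hx => by
    rw [h.swap hx hr, hrC x hx, hlr]; ring
  have hcz : d.γ c z = 1 := by rw [hrc z hz, hrz]
  have hξr : ξ r = 1 := by rw [hξC r hr, hrz, hCr g hg, hCr c hc]; ring
  have hξc : ξ c = 0 := by rw [hξC c hc, hcz, hgc, hcc]; ring
  have hξg : ξ g = 0 := by rw [hξC g hg, hgz, hcg]; ring
  refine h.splitAtt (κ := Fin 4) ![r, c, g, z]
    ![ξ, -d.γ g + d.γ g g • (d.γ c - d.γ r), d.γ c - d.γ r, d.γ r] ?_ ?_ ?_ ?_ ?_ ?_ ?_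
  · intro i j
    fin_cases i <;> fin_cases j <;>
      simp [hξr, hξc, hξg, hξz, hrr, hcc, hgc, hcg, hCr c hc, hCr g hg, hrC c hc, hrC g hg, hrz,
        hgz, hcz]
  · rw [forall_subs']
    refine ⟨?_, ?_, ?_, ?_⟩ <;> intro i <;> fin_cases i
    · right; intro x hx
      have := hξC x (h.ax.PC hx)
      simpa [h.gP hx, h.ax.gCP g hg x hx, h.ax.gCP c hc x hx] using this
    · right; intro x hx
      simp [h.ax.gCP g hg x hx, h.ax.gCP c hc x hx, h.ax.gCP r hr x hx]
    · right; intro x hx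
      simp [h.ax.gCP c hc x hx, h.ax.gCP r hr x hx]
    · right; intro x hx
      simp [h.ax.gCP r hr x hx]
    · right; intro x hx
      have := hξC x (h.ax.QC hx)
      have hx' := h.ax.QT hx
      simpa [h.gQ hx, h.ax.gCT g hg x hx', h.ax.gCT c hc x hx'] using this
    · right; intro x hx
      have hx' := h.ax.QT hx
      simp [h.ax.gCT g hg x hx', h.ax.gCT c hc x hx', h.ax.gCT r hr x hx']
    · right; intro x hx
      have hx' := h.ax.QT hx
      simp [h.ax.gCT c hc x hx', h.ax.gCT r hr x hx']
    · right; intro x hx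
      have hx' := h.ax.QT hx
      simp [h.ax.gCT r hr x hx']
    · exact Or.inl hr
    · exact Or.inl hc
    · exact Or.inl hg
    · exact Or.inr hrC
    · exact hT
    · right; intro x hx'
      simp [h.ax.gCT g hg x hx', h.ax.gCT c hc x hx', h.ax.gCT r hr x hx']
    · right; intro x hx'
      simp [h.ax.gCT c hc x hx', h.ax.gCT r hr x hx']
    · right; intro x hx'
      simp [h.ax.gCT r hr x hx']
  · have hAC : ∀ x f, d.St x f d.C → d.St x f {v | v ∈ d.C ∨ v ∈ d.V1} := by
      rintro x f (h | h | ⟨t, A, h, hA⟩)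
      · exact Or.inl h
      · exact Or.inr (Or.inl h)
      · exact Or.inr (Or.inr ⟨t, A, h, fun w hw => hw.elim (hA w) Or.inr⟩)
    have hW : ∀ j, ![r, c, g, z] j ∈ {v | v ∈ d.C ∨ v ∈ d.V1} := by
      intro j; fin_cases j <;> simp [hr, hc, hg, hz]
    intro i
    fin_cases i
    · refine St.stat (hAC _ _ hstr) (fun j _ => hW j) ?_
      intro j hj t ht
      fin_cases j <;> simp [ht r hr, ht c hc, ht g hg] at hj ⊢
    · rcases hstc with hc | ⟨t, ht, hξt, hv⟩
      · exact Or.inl hc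
      · refine Or.inr (Or.inr ⟨t, d.C, ht.mem, ?_, ht.rad.gC, ht.rad.gt, ht.subs, hW, ?_⟩)
        · intro j
          fin_cases j <;> simp [ht.rad.gC g hg, ht.rad.gC c hc, ht.rad.gC r hr, hξt]
        · intro v hvV hvC
          simp [hv v hvV hvC, hrc v hvV]
    · right; left; intro v hv
      simp [hrc v hv]
    · exact Or.inl hz
  · intro i hi x hx
    simp only [Fin.forall_fin_succ, IsEmpty.forall_iff] at hx
    have h3 : d.γ r x = 0 := hx.2.2.2.1
    have h2 : d.γ c x = 0 := by simpa [h3] using hx.2.2.1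
    have h1 : d.γ g x = 0 := by simpa [h3, h2] using hx.2.1
    fin_cases i
    · exact h3
    · exact h2
    · exact h1
    · exact (hzC hi).elim
  · intro j
    have key : ∀ x ∈ d.C, (∀ i, (![ξ, -d.γ g + d.γ g g • (d.γ c - d.γ r), d.γ c - d.γ r, d.γ r] :
        Fin 4 → Dual F V) i x = 0) → d.γ r x = 0 ∧ d.γ c x = 0 ∧ d.γ g x = 0 ∧ d.γ x z = 0 := by
      intro x hxC hx
      simp only [Fin.forall_fin_succ, IsEmpty.forall_iff] at hx
      have h3 : d.γ r x = 0 := hx.2.2.2.1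
      have h2 : d.γ c x = 0 := by simpa [h3] using hx.2.2.1
      have h1 : d.γ g x = 0 := by simpa [h3, h2] using hx.2.1
      have h0 : ξ x = 0 := hx.1
      rw [hξC x hxC, h1, h2] at h0
      exact ⟨h3, h2, h1, by simpa using h0⟩
    fin_cases j
    · exact ⟨0, by simp, fun x hx _ => by simp [hCr x hx]⟩
    · refine ⟨0, by simp, fun x hx hx' => ?_⟩
      obtain ⟨-, h2, -, -⟩ := key x hx hx'
      simp [h.swap hx hc, h2, hl]
    · refine ⟨-d.lam g, by rcases hlg with h | h <;> simp [h], fun x hx hx' => ?_⟩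
      obtain ⟨-, -, h1, -⟩ := key x hx hx'
      simp [h.swap hx hg, h1, mul_comm]
    · refine ⟨0, by simp, fun x hx hx' => ?_⟩
      simp [(key x hx hx').2.2.2]
  · have hgg : d.γ g g ∈ smallScalars F := by
      rcases hlg with hlg | hlg
      · simp [h.self_eq_zero hg hlg, smallScalars]
      · simp [h.self_eq hg hlg, smallScalars]
    intro i j hi
    fin_cases i <;> fin_cases j <;>
      first
      | exact (hzC hi).elim
      | exact hgg
      | simp [smallScalars, hrr, hcc, hgc, hcg, hCr c hc, hCr g hg, hrC c hc, hrC g hg, hrz,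
          hgz, hcz]
  · intro i hi
    fin_cases i
    · simp [hlr]
    · simp [hl]
    · rcases hlg with h | h <;> simp [h]
    · exact (hzC hi).elim

end basic
end VD

namespace VD
variable {F V : Type*} [Field F] [AddCommGroup V] [Module F V]

/-- The vectors of `C` that pair to zero with everything. -/
def L (d : VD F V) : Submodule F V := d.C ⊓ LinearMap.ker d.γ

/-- The vectors that pair to zero with `C`. -/
def R (d : VD F V) : Submodule F V where
  carrier := {x | ∀ c ∈ d.C, d.γ c x = 0}
  add_mem' hx hy c hc := by simp [hx c hc, hy c hc]
  zero_mem' c _ := by simp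
  smul_mem' a x hx c hc := by simp [hx c hc]

theorem rad_of_mem_R {d : VD F V} {x : V} (hx : x ∈ d.R) (hC : x ∈ d.C → x ∈ d.L) : d.Rad x :=
  ⟨hx, fun h y => by rw [LinearMap.mem_ker.1 (hC h).2]; rfl⟩

theorem rad_of_notMem {d : VD F V} {x : V} (hx : x ∈ d.R) (hC : x ∉ d.C) : d.Rad x :=
  rad_of_mem_R hx fun h => (hC h).elim

section

variable {d : VD F V} (h : d.Irr)
include h

theorem Irr.P_le_L : d.P ≤ d.L := fun _ hx =>
  ⟨h.ax.PC hx, LinearMap.mem_ker.2 (LinearMap.ext (h.gP hx))⟩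

theorem Irr.Q_le_L : d.Q ≤ d.L := fun _ hx =>
  ⟨h.ax.QC hx, LinearMap.mem_ker.2 (LinearMap.ext (h.gQ hx))⟩

theorem Irr.L_le_R : d.L ≤ d.R := by
  rintro x ⟨hx, hk⟩ c hc
  have hk0 : ∀ y, d.γ x y = 0 := fun y => by rw [LinearMap.mem_ker.1 hk]; rfl
  rw [h.swap hc hx, hk0, h.lam_eq_zero hx (hk0 x)]
  ring

theorem Irr.T_le_R : d.T ≤ d.R := fun x hx c hc => h.ax.gCT c hc x hx

theorem Irr.rad_L {x : V} (hx : x ∈ d.L) : d.Rad x := rad_of_mem_R (h.L_le_R hx) fun _ => hx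

theorem Irr.rad_T {x : V} (hx : x ∈ d.T) (hC : x ∉ d.C) : d.Rad x := rad_of_notMem (h.T_le_R hx) hC

theorem Irr.V1_P_T {v : V} (hv : v ∈ d.V1) (hP : v ∈ d.P) (hT : v ∈ d.T) : v = 0 := by
  by_contra h0
  have hC := h.ax.PC hP
  by_cases hQ : v ∈ d.Q
  · exact h.single v ⊥ (h.rad_L (h.P_le_L hP)) (by simpa using h0)
      (forall_subs'.2 ⟨.inl hP, .inl hQ, .inl hC, .inl hT⟩) (.inl hv)
  · exact h.single v d.Q (h.rad_L (h.P_le_L hP)) hQ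
      (forall_subs'.2 ⟨.inl hP, .inr le_rfl, .inl hC, .inl hT⟩) (.inl hv)

theorem Irr.V1_Q {v : V} (hv : v ∈ d.V1) (hQ : v ∈ d.Q) : v = 0 := by
  by_contra h0
  exact h.single v d.P (h.rad_L (h.Q_le_L hQ)) (fun hP => h0 (h.V1_P_T hv hP (h.ax.QT hQ)))
    (forall_subs'.2 ⟨.inr le_rfl, .inl hQ, .inl (h.ax.QC hQ), .inl (h.ax.QT hQ)⟩) (.inl hv)

theorem Irr.V1_P {v : V} (hv : v ∈ d.V1) (hP : v ∈ d.P) : v = 0 := by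
  by_contra h0
  exact h.single v d.T (h.rad_L (h.P_le_L hP)) (fun hT => h0 (h.V1_P_T hv hP hT))
    (forall_subs'.2 ⟨.inl hP, .inr h.ax.QT, .inl (h.ax.PC hP), .inr le_rfl⟩) (.inl hv)

theorem Irr.P_Q {v : V} (hP : v ∈ d.P) (hQ : v ∈ d.Q) : v = 0 := by
  by_contra h0
  exact h.single v d.V1 (h.rad_L (h.P_le_L hP)) (fun hv => h0 (h.V1_P hv hP))
    (forall_subs'.2 ⟨.inl hP, .inl hQ, .inl (h.ax.PC hP), .inl (h.ax.QT hQ)⟩) (.inr le_rfl)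

theorem Irr.V1_inf_P : d.V1 ⊓ d.P = ⊥ :=
  (Submodule.eq_bot_iff _).2 fun _ hx => h.V1_P hx.1 hx.2

theorem Irr.V1_P_add_Q {p q : V} (hp : p ∈ d.P) (hq : q ∈ d.Q) (hpq : p + q ∈ d.V1) :
    p + q = 0 := by
  have hp0 : p = 0 := by
    by_contra h0
    obtain ⟨A, hAQ, hAT, hpA, hAT'⟩ : ∃ A : Submodule F V, d.Q ≤ A ∧ (p ∈ d.T ∨ d.T ≤ A) ∧
        p ∉ A ∧ A ≤ d.T := by
      by_cases hT : p ∈ d.T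
      · exact ⟨d.Q, le_rfl, .inl hT, fun hQ => h0 (h.P_Q hp hQ), h.ax.QT⟩
      · exact ⟨d.T, h.ax.QT, .inr le_rfl, hT, le_rfl⟩
    refine h.pair p q A d.P (h.rad_L (h.P_le_L hp)) (h.rad_L (h.Q_le_L hq)) hpq (hAQ hq) hp
      (forall_subs'.2 ⟨.inl hp, .inr hAQ, .inl (h.ax.PC hp), hAT⟩)
      (forall_subs'.2 ⟨.inr le_rfl, .inl hq, .inl (h.ax.QC hq), .inl (h.ax.QT hq)⟩) ?_
    rwa [h.V1_inf_P, sup_bot_eq]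
  subst hp0
  rw [zero_add] at *
  exact h.V1_Q hpq hq

theorem Irr.V1_PQ : d.V1 ⊓ (d.P ⊔ d.Q) = ⊥ := by
  rw [Submodule.eq_bot_iff]
  rintro x ⟨hx, hx'⟩
  obtain ⟨p, hp, q, hq, rfl⟩ := Submodule.mem_sup.1 hx'
  exact h.V1_P_add_Q hp hq hx

theorem Irr.V1_L_T {v : V} (hv : v ∈ d.V1) (hL : v ∈ d.L) (hT : v ∈ d.T) : v = 0 := by
  by_contra h0
  refine h.single v (d.P ⊔ d.Q) (h.rad_L hL) (fun hPQ => h0 ?_)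
    (forall_subs'.2 ⟨.inr le_sup_left, .inr le_sup_right, .inl hL.1, .inl hT⟩) (.inl hv)
  have : v ∈ d.V1 ⊓ (d.P ⊔ d.Q) := ⟨hv, hPQ⟩
  rwa [h.V1_PQ, Submodule.mem_bot] at this

theorem Irr.V1_P_add_LT {p t : V} (hp : p ∈ d.P) (ht : t ∈ d.L) (htT : t ∈ d.T)
    (hpt : p + t ∈ d.V1) : p + t = 0 := by
  by_cases hpT : p ∈ d.T
  · exact h.V1_L_T hpt (d.L.add_mem (h.P_le_L hp) ht) (d.T.add_mem hpT htT)
  · refine (h.pair p t d.T (d.P ⊔ d.Q) (h.rad_L (h.P_le_L hp)) (h.rad_L ht) hpt htT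
      (Submodule.mem_sup_left hp)
      (forall_subs'.2 ⟨.inl hp, .inr h.ax.QT, .inl (h.ax.PC hp), .inr le_rfl⟩)
      (forall_subs'.2 ⟨.inr le_sup_left, .inr le_sup_right, .inl ht.1, .inl htT⟩) ?_).elim
    rwa [h.V1_PQ, sup_bot_eq]

theorem Irr.V1_L {v : V} (hv : v ∈ d.V1) (hL : v ∈ d.L) : v = 0 := by
  by_contra h0
  refine h.single v (d.P ⊔ d.T) (h.rad_L hL) (fun hPT => h0 ?_)
    (forall_subs'.2 ⟨.inr le_sup_left, .inr (h.ax.QT.trans le_sup_right), .inl hL.1,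
      .inr le_sup_right⟩) (.inl hv)
  obtain ⟨p, hp, t, ht, rfl⟩ := Submodule.mem_sup.1 hPT
  exact h.V1_P_add_LT hp ((d.L.add_mem_iff_right (h.P_le_L hp)).1 hL) ht hv

theorem Irr.P_T {v : V} (hP : v ∈ d.P) (hT : v ∈ d.T) : v = 0 := by
  by_contra h0
  refine h.single v (d.Q ⊔ d.V1) (h.rad_L (h.P_le_L hP)) (fun hQV => h0 ?_)
    (forall_subs'.2 ⟨.inl hP, .inr le_sup_left, .inl (h.ax.PC hP), .inl hT⟩) (.inr le_sup_right)
  obtain ⟨q, hq, u, hu, rfl⟩ := Submodule.mem_sup.1 hQV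
  have hu0 : u = 0 := h.V1_L hu ((d.L.add_mem_iff_right (h.Q_le_L hq)).1 (h.P_le_L hP))
  subst hu0
  rw [add_zero] at *
  exact h.P_Q hP hq

theorem Irr.of_LT_P_V1 {v : V} (hL : v ∈ d.L) (hT : v ∈ d.T) (hv : v ∈ d.P ⊔ d.V1) : v = 0 := by
  obtain ⟨p, hp, u, hu, rfl⟩ := Submodule.mem_sup.1 hv
  have hu0 : u = 0 := h.V1_L hu ((d.L.add_mem_iff_right (h.P_le_L hp)).1 hL)
  subst hu0
  rw [add_zero] at *
  exact h.P_T hp hT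

theorem Irr.Q_eq_bot : d.Q = ⊥ := by
  rw [Submodule.eq_bot_iff]
  intro v hQ
  by_contra h0
  exact h.single v (d.P ⊔ d.V1) (h.rad_L (h.Q_le_L hQ))
    (fun hv => h0 (h.of_LT_P_V1 (h.Q_le_L hQ) (h.ax.QT hQ) hv))
    (forall_subs'.2 ⟨.inr le_sup_left, .inl hQ, .inl (h.ax.QC hQ), .inl (h.ax.QT hQ)⟩)
    (.inr le_sup_right)

theorem Irr.Q_le (A : Submodule F V) : d.Q ≤ A := by
  rw [h.Q_eq_bot]; exact bot_le

theorem Irr.L_T {v : V} (hL : v ∈ d.L) (hT : v ∈ d.T) : v = 0 := by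
  by_contra h0
  exact h.single v (d.P ⊔ d.V1) (h.rad_L hL) (fun hv => h0 (h.of_LT_P_V1 hL hT hv))
    (forall_subs'.2 ⟨.inr le_sup_left, .inr (h.Q_le _), .inl hL.1, .inl hT⟩)
    (.inr le_sup_right)

theorem Irr.V1_T_C {v : V} (hv : v ∈ d.V1) (hT : v ∈ d.T) : v ∈ d.C := by
  by_contra hC
  exact h.single v d.C (h.rad_T hT hC) hC
    (forall_subs'.2 ⟨.inr h.ax.PC, .inr h.ax.QC, .inr le_rfl, .inl hT⟩) (.inl hv)

theorem Irr.subs_of_T {t : V} (hT : t ∈ d.T) : ∀ S ∈ d.subs', t ∈ S ∨ S ≤ d.C :=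
  forall_subs'.2 ⟨.inr h.ax.PC, .inr h.ax.QC, .inr le_rfl, .inl hT⟩

theorem Irr.C_of_P_add_T {p t : V} (hp : p ∈ d.P) (ht : t ∈ d.T) (hpt : p + t ∈ d.V1) :
    t ∈ d.C := by
  by_contra hC
  refine h.pair p t d.T d.C (h.rad_L (h.P_le_L hp)) (h.rad_T ht hC) hpt ht (h.ax.PC hp)
    (forall_subs'.2 ⟨.inl hp, .inr h.ax.QT, .inl (h.ax.PC hp), .inr le_rfl⟩)
    (h.subs_of_T ht) fun hp' => hC ?_
  obtain ⟨t', ht', u, hu, rfl⟩ := Submodule.mem_sup.1 hp'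
  have h1 : t + t' ∈ d.V1 := by
    have := d.V1.sub_mem hpt hu.1
    rwa [show t' + u + t - u = t + t' by abel] at this
  have h2 := h.V1_T_C h1 (d.T.add_mem ht ht')
  exact (d.C.add_mem_iff_left ((d.C.add_mem_iff_left hu.2).1 (h.ax.PC hp))).1 h2

theorem Irr.C_of_L_add_T {l t : V} (hl : l ∈ d.L) (ht : t ∈ d.T) (hlt : l + t ∈ d.V1) :
    t ∈ d.C := by
  by_contra hC
  refine h.pair l t (d.P ⊔ d.T) d.C (h.rad_L hl) (h.rad_T ht hC) hlt (Submodule.mem_sup_right ht)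
    hl.1 (forall_subs'.2 ⟨.inr le_sup_left, .inr (h.Q_le _), .inl hl.1, .inr le_sup_right⟩)
    (h.subs_of_T ht) fun hl' => hC ?_
  obtain ⟨w, hw, u, hu, rfl⟩ := Submodule.mem_sup.1 hl'
  obtain ⟨p, hp, t', ht', rfl⟩ := Submodule.mem_sup.1 hw
  have h1 : p + (t + t') ∈ d.V1 := by
    have := d.V1.sub_mem hlt hu.1
    rwa [show p + t' + u + t - u = p + (t + t') by abel] at this
  have h2 := h.C_of_P_add_T hp (d.T.add_mem ht ht') h1
  exact (d.C.add_mem_iff_left ((d.C.add_mem_iff_right (h.ax.PC hp)).1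
    ((d.C.add_mem_iff_left hu.2).1 hl.1))).1 h2

theorem Irr.V1_R_le {v : V} (hv : v ∈ d.V1) (hR : v ∈ d.R) : v ∈ d.C ⊔ d.T := by
  by_contra hCT
  exact h.single v (d.C ⊔ d.T) (rad_of_notMem hR fun hC => hCT (Submodule.mem_sup_left hC)) hCT
    (forall_subs'.2 ⟨.inr (h.ax.PC.trans le_sup_left), .inr (h.Q_le _), .inr le_sup_left,
      .inr le_sup_right⟩) (.inl hv)

theorem Irr.T_le : d.T ≤ d.C ⊔ d.V1 := by
  intro t ht
  by_contra hCV
  exact h.single t (d.C ⊔ d.V1) (h.rad_T ht fun hC => hCV (Submodule.mem_sup_left hC)) hCV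
    (forall_subs'.2 ⟨.inr (h.ax.PC.trans le_sup_left), .inr (h.Q_le _), .inr le_sup_left,
      .inl ht⟩) (.inr le_sup_right)

theorem Irr.R_le : d.R ≤ d.C ⊔ d.V1 := by
  intro x hx
  by_contra hCV
  exact h.single x (d.C ⊔ d.V1) (rad_of_notMem hx fun hC => hCV (Submodule.mem_sup_left hC)) hCV
    (forall_subs'.2 ⟨.inr (h.ax.PC.trans le_sup_left), .inr (h.Q_le _), .inr le_sup_left,
      .inr h.T_le⟩) (.inr le_sup_right)

theorem Irr.P_le : d.P ≤ d.T ⊔ d.V1 := by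
  intro p hp
  by_contra hTV
  exact h.single p (d.T ⊔ d.V1) (h.rad_L (h.P_le_L hp)) hTV
    (forall_subs'.2 ⟨.inl hp, .inr (h.Q_le _), .inl (h.ax.PC hp), .inr le_sup_left⟩)
    (.inr le_sup_right)

theorem Irr.L_le : d.L ≤ d.T ⊔ d.V1 := by
  intro l hl
  by_contra hTV
  exact h.single l (d.T ⊔ d.V1) (h.rad_L hl) hTV
    (forall_subs'.2 ⟨.inr h.P_le, .inr (h.Q_le _), .inl hl.1, .inr le_sup_left⟩)
    (.inr le_sup_right)

theorem Irr.exists_T_of_L {l : V} (hl : l ∈ d.L) : ∃ t ∈ d.T, t ∈ d.C ∧ t + l ∈ d.V1 := by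
  obtain ⟨t, ht, u, hu, rfl⟩ := Submodule.mem_sup.1 (h.L_le hl)
  have hu' : t + u + -t ∈ d.V1 := by rwa [show t + u + -t = u by abel]
  refine ⟨-t, d.T.neg_mem ht, h.C_of_L_add_T hl (d.T.neg_mem ht) hu', ?_⟩
  rwa [show -t + (t + u) = u by abel]

end
end VD

namespace VD
variable {F V : Type*} [Field F] [AddCommGroup V] [Module F V]

/-- The vectors of `C` that pair to zero with `V1`. -/
def Z (d : VD F V) : Submodule F V where
  carrier := {x | x ∈ d.C ∧ ∀ v ∈ d.V1, d.γ x v = 0}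
  add_mem' hx hy := ⟨d.C.add_mem hx.1 hy.1, fun v hv => by simp [hx.2 v hv, hy.2 v hv]⟩
  zero_mem' := ⟨d.C.zero_mem, by simp⟩
  smul_mem' a _ hx := ⟨d.C.smul_mem a hx.1, fun v hv => by simp [hx.2 v hv]⟩

/-- The vectors of `C` that pair to zero with `C`. -/
def RC (d : VD F V) : Submodule F V where
  carrier := {x | x ∈ d.C ∧ ∀ v ∈ d.C, d.γ x v = 0}
  add_mem' hx hy := ⟨d.C.add_mem hx.1 hy.1, fun v hv => by simp [hx.2 v hv, hy.2 v hv]⟩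
  zero_mem' := ⟨d.C.zero_mem, by simp⟩
  smul_mem' a _ hx := ⟨d.C.smul_mem a hx.1, fun v hv => by simp [hx.2 v hv]⟩

/-- The part of `C` lying in `V1 + T`. -/
def Cb (d : VD F V) : Submodule F V := d.C ⊓ (d.V1 ⊔ d.T)

/-- A vector of `Cb` is either congruent to one of `V1` modulo `C ∩ T`, or attached to `T`. -/
theorem Cb_cases {d : VD F V} {c : V} (hc : c ∈ d.Cb) : (∃ u ∈ d.V1, u ∈ d.C ∧ ∃ t ∈ d.T, t ∈ d.C ∧
    c = u + t) ∨ ∃ t ∈ d.T, t ∉ d.C ∧ c + t ∈ d.V1 := by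
  obtain ⟨hC, hVT⟩ := hc
  obtain ⟨u, hu, t, ht, rfl⟩ := Submodule.mem_sup.1 hVT
  by_cases htC : t ∈ d.C
  · exact .inl ⟨u, hu, (d.C.add_mem_iff_left htC).1 hC, t, ht, htC, rfl⟩
  · exact .inr ⟨-t, d.T.neg_mem ht, by rwa [neg_mem_iff], by rwa [add_neg_cancel_right]⟩

section

variable {d : VD F V} (h : d.Irr)
include h

theorem Irr.I_le_RC {t : V} (ht : t ∈ d.T) (hC : t ∈ d.C) : t ∈ d.RC := by
  refine ⟨hC, fun c hc => ?_⟩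
  rw [h.swap hC hc, h.ax.gCT c hc t ht, h.lam_eq_zero hC (h.ax.gCT t hC t ht)]
  ring

theorem Irr.lam_RC {r : V} (hr : r ∈ d.RC) : d.lam r = 0 :=
  h.lam_eq_zero hr.1 (hr.2 r hr.1)

theorem Irr.g_RC {r c : V} (hr : r ∈ d.RC) (hc : c ∈ d.C) : d.γ c r = 0 := by
  rw [h.swap hc hr.1, hr.2 c hc, h.lam_RC hr]
  ring

theorem Irr.I_attached {t l : V} (ht : t ∈ d.T) (hC : t ∈ d.C) (htl : t + l ∈ d.V1)
    (hl : l = 0 ∨ l ∈ d.L ∧ (l ∈ d.P ∨ d.P = ⊥) ∧ ∀ v ∈ d.V1, v ∈ d.T → v = 0) : t = 0 := by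
  by_contra h0
  have htR := h.I_le_RC ht hC
  obtain ⟨w, hw, hwV⟩ : ∃ w, d.γ t w = 1 ∧ (w ∈ d.V1 ∨ ∀ x ∈ d.V1, d.γ t x = 0) := by
    by_cases hV : ∀ x ∈ d.V1, d.γ t x = 0
    · have : d.γ t ≠ 0 := fun hk => h0 (h.L_T ⟨hC, LinearMap.mem_ker.2 hk⟩ ht)
      obtain ⟨w, hw⟩ := DFunLike.ne_iff.1 this
      exact ⟨(d.γ t w)⁻¹ • w, by simpa using inv_mul_cancel₀ hw, Or.inr hV⟩
    · push Not at hV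
      obtain ⟨w, hwV, hw⟩ := hV
      exact ⟨(d.γ t w)⁻¹ • w, by simpa using inv_mul_cancel₀ hw, Or.inl (d.V1.smul_mem _ hwV)⟩
  obtain ⟨ξ, hξ, hξC⟩ := exists_dual_eq (F ∙ w) d.C (d.γ.flip w) (by
    intro x hx hxC
    obtain ⟨a, rfl⟩ := Submodule.mem_span_singleton.1 hx
    have := htR.2 _ hxC
    rw [map_smul, hw, smul_eq_mul, mul_one] at this
    simp [this])
  have hξw := hξ w (Submodule.mem_span_singleton_self w)
  refine h.rz t w ξ hC htR.2 hw hξw hξC (.inl ht) hwV ?_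
  rcases hl with rfl | ⟨hl, hlP, hVT⟩
  · left; simpa using htl
  · right; right
    refine ⟨l, d.T ⊔ F ∙ w, ⟨htl, ?_, h.rad_L hl, forall_subs'.2 ⟨?_, .inr (h.Q_le _), .inl hl.1,
      .inr le_sup_left⟩, Submodule.mem_sup_left ht, ?_⟩, ?_⟩
    · rw [hξC l hl.1, LinearMap.flip_apply, LinearMap.mem_ker.1 hl.2]; rfl
    · exact hlP.imp_right fun hP => hP.le.trans bot_le
    · intro v hv hv'
      obtain ⟨t', ht', x, hx, rfl⟩ := Submodule.mem_sup.1 hv'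
      obtain ⟨a, rfl⟩ := Submodule.mem_span_singleton.1 hx
      have hγ : d.γ t (t' + a • w) = a := by
        rw [map_add, map_smul, hw, h.ax.gCT t hC t' ht']; simp
      rcases hwV with hwV | hV
      · rw [hVT t' ((d.V1.add_mem_iff_left (d.V1.smul_mem a hwV)).1 hv) ht']
        simp [hξw]
      · rw [hV _ hv] at hγ
        rw [← hγ] at hv ⊢
        rw [zero_smul, add_zero] at hv ⊢
        rw [hVT t' hv ht', map_zero]
    · rintro _ rfl
      exact Or.inl (Submodule.mem_sup_right (Submodule.mem_span_singleton_self _))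

theorem Irr.V1_T {v : V} (hv : v ∈ d.V1) (hT : v ∈ d.T) : v = 0 :=
  h.I_attached (l := 0) hT (h.V1_T_C hv hT) (by simpa using hv) (.inl rfl)

theorem Irr.P_eq_bot : d.P = ⊥ := by
  rw [Submodule.eq_bot_iff]
  intro p hp
  obtain ⟨t, ht, hC, htp⟩ := h.exists_T_of_L (h.P_le_L hp)
  have ht0 := h.I_attached ht hC htp
    (.inr ⟨h.P_le_L hp, .inl hp, fun v hv hT => h.V1_T hv hT⟩)
  subst ht0
  rw [zero_add] at htp
  exact h.V1_P htp hp

theorem Irr.L_eq_zero {l : V} (hl : l ∈ d.L) : l = 0 := by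
  obtain ⟨t, ht, hC, htp⟩ := h.exists_T_of_L hl
  have ht0 := h.I_attached ht hC htp (.inr ⟨hl, .inr h.P_eq_bot, fun v hv hT => h.V1_T hv hT⟩)
  subst ht0
  rw [zero_add] at htp
  exact h.V1_L htp hl

theorem Irr.P_le' (A : Submodule F V) : d.P ≤ A := by
  rw [h.P_eq_bot]; exact bot_le

theorem Irr.lam_C1 {c : V} (hc : c ∈ d.C) (hV : c ∈ d.V1) : d.lam c = 0 := by
  by_contra h0
  exact h.peel c hc h0 (.inl hV)

theorem Irr.lam_Z {c : V} (hc : c ∈ d.Z) : d.lam c = 0 := by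
  by_contra h0
  exact h.peel c hc.1 h0 (.inr (.inl hc.2))

theorem Irr.C1_C1 {c c' : V} (hc : c ∈ d.C) (hV : c ∈ d.V1) (hc' : c' ∈ d.C) (hV' : c' ∈ d.V1) :
    d.γ c c' = 0 := by
  by_contra h0
  exact h.hp c c' hc hc' (h.lam_C1 hc hV) h0 (.inl hV) (.inl hV')

theorem Irr.Z_Z {c c' : V} (hc : c ∈ d.Z) (hc' : c' ∈ d.Z) : d.γ c c' = 0 := by
  by_contra h0
  exact h.hp c c' hc.1 hc'.1 (h.lam_Z hc) h0
    (.inr (.inl fun v hv => ⟨hc'.2 v hv, hc.2 v hv⟩)) (.inr (.inl hc.2))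

theorem Irr.attC_T {c t : V} (ht : t ∈ d.T) (htC : t ∉ d.C) (hct : c + t ∈ d.V1) :
    d.AttC c t d.C := ⟨hct, h.rad_T ht htC, h.subs_of_T ht, le_rfl⟩

theorem Irr.C1_Cb {c c' : V} (hc : c ∈ d.C) (hV : c ∈ d.V1) (hc' : c' ∈ d.Cb) : d.γ c c' = 0 := by
  rcases Cb_cases hc' with ⟨u, hu, huC, t, ht, -, rfl⟩ | ⟨t, ht, htC, hct⟩
  · rw [map_add, h.C1_C1 hc hV huC hu, h.ax.gCT c hc t ht, add_zero]
  · by_contra h0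
    exact h.hp c c' hc hc'.1 (h.lam_C1 hc hV) h0 (.inl hV)
      (.inr (.inr ⟨t, d.C, h.attC_T ht htC hct, fun v hv hvC => h.C1_C1 hc hV hvC hv⟩))

theorem Irr.Cb_C1 {c c' : V} (hc : c ∈ d.C) (hV : c ∈ d.V1) (hc' : c' ∈ d.Cb) : d.γ c' c = 0 := by
  rw [h.swap hc'.1 hc, h.C1_Cb hc hV hc', h.lam_C1 hc hV]
  ring

theorem Irr.lam_Cb {c : V} (hc : c ∈ d.Cb) : d.lam c = 0 := by
  rcases Cb_cases hc with ⟨u, hu, huC, t, ht, htC, rfl⟩ | ⟨t, ht, htC, hct⟩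
  · rw [map_add, h.lam_C1 huC hu, h.lam_RC (h.I_le_RC ht htC), add_zero]
  · by_contra h0
    exact h.peel c hc.1 h0
      (.inr (.inr ⟨t, d.C, h.attC_T ht htC hct, fun v hv hvC => h.Cb_C1 hvC hv hc⟩))

theorem Irr.Cb_Cb {c c' : V} (hc : c ∈ d.Cb) (hc' : c' ∈ d.Cb) : d.γ c c' = 0 := by
  rcases Cb_cases hc with ⟨u, hu, huC, t, ht, htC, rfl⟩ | ⟨t, ht, htC, hct⟩
  · rw [map_add, LinearMap.add_apply, h.C1_Cb huC hu hc', (h.I_le_RC ht htC).2 c' hc'.1, add_zero]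
  rcases Cb_cases hc' with ⟨u, hu, huC, s, hs, -, rfl⟩ | ⟨s, hs, hsC, hcs⟩
  · rw [map_add, h.Cb_C1 huC hu hc, h.ax.gCT c hc.1 s hs, add_zero]
  by_contra h0
  refine h.hp c c' hc.1 hc'.1 (h.lam_Cb hc) h0
    (.inr (.inr ⟨t, d.C, h.attC_T ht htC hct, fun v hv hvC => ⟨?_, ?_⟩⟩))
    (.inr (.inr ⟨s, d.C, h.attC_T hs hsC hcs, fun v hv hvC => ?_⟩))
  · exact h.Cb_C1 hvC hv hc'
  · exact h.Cb_C1 hvC hv hc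
  · exact h.Cb_C1 hvC hv hc

variable [FiniteDimensional F V]

theorem Irr.exists_rep (g : Dual F V) : ∃ y, ∀ c ∈ d.C, d.γ c y = g c := by
  obtain ⟨y, -, hy⟩ := exists_mem_pairing_eq d.γ d.C ⊤ g fun c hc hcy => by
    rw [h.L_eq_zero ⟨hc, LinearMap.mem_ker.2 (LinearMap.ext fun y => hcy y trivial)⟩, map_zero]
  exact ⟨y, hy⟩

end
end VD

namespace VD
variable {F V : Type*} [Field F] [AddCommGroup V] [Module F V]

/-- A vector of `N` that pairs like `f` with `B` and to `1` with `r`. -/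
theorem exists_mem_one [FiniteDimensional F V] {d : VD F V} (N B : Submodule F V) (r : V)
    (f : Dual F V) (hr : r ∉ B)
    (hN : ∀ b ∈ B, ∀ a : F, (∀ y ∈ N, d.γ (b + a • r) y = 0) → f b + a = 0) :
    ∃ y ∈ N, (∀ b ∈ B, d.γ b y = f b) ∧ d.γ r y = 1 := by
  obtain ⟨g, hgB, hgr⟩ := exists_dual_one B hr
  have hk : ∀ b ∈ B, ∀ a : F, (f + (1 - f r) • g) (b + a • r) = f b + a := by
    intro b hb a
    simp [hgB b hb, hgr]
    ring
  obtain ⟨y, hy, hyg⟩ := exists_mem_pairing_eq d.γ (B ⊔ F ∙ r) N (f + (1 - f r) • g) (by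
    intro c hc hcy
    obtain ⟨b, hb, x, hx, rfl⟩ := Submodule.mem_sup.1 hc
    obtain ⟨a, rfl⟩ := Submodule.mem_span_singleton.1 hx
    rw [hk b hb a, hN b hb a hcy])
  refine ⟨y, hy, fun b hb => ?_, ?_⟩
  · rw [hyg b (Submodule.mem_sup_left hb)]
    simpa using hk b hb 0
  · rw [hyg r (Submodule.mem_sup_right (Submodule.mem_span_singleton_self r))]
    simpa using hk 0 B.zero_mem 1

section

variable {d : VD F V} (h : d.Irr)
include h

theorem Irr.rz' (r w : V) (A : Submodule F V) (hr : r ∈ d.RC) (hrw : d.γ r w = 1)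
    (hA : ∀ x ∈ A, ∀ a : F, x + a • w ∈ d.C → d.γ (x + a • w) w = 0)
    (hT : r ∈ d.T ∨ d.T ≤ A) (hw : w ∈ d.V1 ∨ ∀ x ∈ d.V1, d.γ r x = 0)
    (hst : r ∈ d.V1 ∨ d.V1 ≤ A ∨ ∃ t ∈ A, ∃ B, d.AttC r t B ∧ (w ∈ B ∨ w ∈ d.V1) ∧
      ∀ v ∈ d.V1, v ∈ B → v ∈ d.C ∧ d.γ v w = 0) : False := by
  obtain ⟨ξ, hξ, hξC⟩ := exists_dual_eq (A ⊔ F ∙ w) d.C (d.γ.flip w) (by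
    intro x hx hxC
    obtain ⟨y, hy, z, hz, rfl⟩ := Submodule.mem_sup.1 hx
    obtain ⟨a, rfl⟩ := Submodule.mem_span_singleton.1 hz
    exact hA y hy a hxC)
  have hξA : ∀ x ∈ A, ξ x = 0 := fun x hx => hξ x (Submodule.mem_sup_left hx)
  have hξw := hξ w (Submodule.mem_sup_right (Submodule.mem_span_singleton_self w))
  refine h.rz r w ξ hr.1 hr.2 hrw hξw hξC (hT.imp_right fun hT x hx => hξA x (hT hx)) hw ?_
  rcases hst with hst | hst | ⟨t, htA, B, hB, hwB, hv⟩
  · exact .inl hst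
  · exact .inr (.inl fun v hv => hξA v (hst hv))
  · refine .inr (.inr ⟨t, B, ⟨hB.mem, hξA t htA, hB.rad, hB.subs, hB.CA hr.1, ?_⟩, ?_⟩)
    · intro v hv1 hvB
      rw [hξC v (hv v hv1 hvB).1]
      exact (hv v hv1 hvB).2
    · rintro _ rfl
      exact hwB

variable [FiniteDimensional F V]

theorem Irr.quad' (r c g : V) (A B : Submodule F V) (hr : r ∈ d.RC) (hrB : r ∉ B) (hBC : B ≤ d.C)
    (hc : c ∈ B) (hBZ : ∀ x ∈ B, x ∈ d.Z → x = 0) (hBB : ∀ x ∈ B, ∀ y ∈ B, d.γ x y = 0)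
    (hBl : ∀ x ∈ B, d.lam x = 0) (hrc : ∀ v ∈ d.V1, d.γ c v = d.γ r v)
    (hg : g ∈ d.C) (hcg : d.γ c g ≠ 0)
    (hA : ∀ z ∈ d.V1, d.γ r z ≠ 0 → ∀ x ∈ A, ∀ a : F, x + a • z ∈ d.C → x + a • z ∈ B)
    (hT : r ∈ d.T ∨ d.T ≤ A)
    (hstr : d.V1 ≤ A ∨ d.V1 ⊓ d.C ≤ B ∧ ∃ t ∈ A, d.AttC r t d.C)
    (hstc : c ∈ d.V1 ∨ ∃ t ∈ A, d.AttC c t d.C ∧ ∀ v ∈ d.V1, v ∈ d.C → d.γ v g = 0) : False := by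
  wlog hlg : (d.lam g = 0 ∨ d.lam g = 1) ∧ d.γ c g = 1 generalizing r c g
  · obtain ⟨a, ha, hla⟩ := h.exists_smul_lam g
    set s := a * d.γ c g with hs
    have hs0 : s ≠ 0 := mul_ne_zero ha hcg
    refine this (s⁻¹ • r) (s⁻¹ • c) (a • g) (d.RC.smul_mem _ hr) ?_ (B.smul_mem _ hc) ?_
      (d.C.smul_mem _ hg) ?_ ?_ ?_ ?_ ?_ ⟨hla, ?_⟩
    · rwa [B.smul_mem_iff (inv_ne_zero hs0)]
    · intro v hv; simp [hrc v hv]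
    · simp [ha, hcg, hs0]
    · intro z hz hrz
      exact hA z hz fun h0 => hrz (by simp [h0])
    · exact hT.imp_left fun hT => d.T.smul_mem _ hT
    · refine hstr.imp_right fun ⟨hVB, t, ht, hatt⟩ => ⟨hVB, s⁻¹ • t, A.smul_mem _ ht, ?_⟩
      refine ⟨?_, hatt.rad.smul _, ?_, hatt.CA⟩
      · rw [← smul_add]; exact d.V1.smul_mem _ hatt.mem
      · exact fun S hS => (hatt.subs S hS).imp_left fun hS => S.smul_mem _ hS
    · refine hstc.imp (fun hc => d.V1.smul_mem _ hc) fun ⟨t, ht, hatt, hv⟩ =>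
        ⟨s⁻¹ • t, A.smul_mem _ ht, ⟨?_, hatt.rad.smul _, ?_, hatt.CA⟩, ?_⟩
      · rw [← smul_add]; exact d.V1.smul_mem _ hatt.mem
      · exact fun S hS => (hatt.subs S hS).imp_left fun hS => S.smul_mem _ hS
      · exact fun v hv1 hvC => by simp [hv v hv1 hvC]
    · simp only [map_smul, LinearMap.smul_apply, smul_eq_mul]
      rw [hs]; field_simp
  obtain ⟨hlg, hcg⟩ := hlg
  obtain ⟨z, hz, hzB, hrz⟩ := exists_mem_one (d := d) d.V1 B r (d.γ.flip g) hrB (by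
    intro b hb a hba
    have h0 : b + a • c = 0 := by
      refine hBZ _ (B.add_mem hb (B.smul_mem a hc)) ⟨hBC (B.add_mem hb (B.smul_mem a hc)), ?_⟩
      intro v hv
      have := hba v hv
      simp only [map_add, map_smul, LinearMap.add_apply, LinearMap.smul_apply] at this ⊢
      rw [hrc v hv, this]
    rw [add_eq_zero_iff_eq_neg.1 h0]
    simp [hcg])
  simp only [LinearMap.flip_apply] at hzB
  set g' := g - d.γ g z • r with hg'
  have hg'C : g' ∈ d.C := d.C.sub_mem hg (d.C.smul_mem _ hr.1)
  have hBg : ∀ x ∈ d.C, d.γ x g' = d.γ x g := fun x hx => by simp [hg', h.g_RC hr hx]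
  have hlg' : d.lam g' = d.lam g := by simp [hg', h.lam_RC hr]
  obtain ⟨ξ, hξA, hξC⟩ := exists_dual_eq (A ⊔ F ∙ z) d.C
    (d.γ.flip z + d.γ g' - d.γ g' g' • d.γ c) (by
    intro x hx hxC
    have hxB : x ∈ B := by
      obtain ⟨y, hy, w, hw, rfl⟩ := Submodule.mem_sup.1 hx
      obtain ⟨a, rfl⟩ := Submodule.mem_span_singleton.1 hw
      exact hA z hz (by simp [hrz]) y hy a hxC
    have h1 := h.swap hg'C hxC
    rw [hBg x hxC, hBl x hxB] at h1
    simp [hzB x hxB, h1, hBB c hc x hxB])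
  have hξA' : ∀ x ∈ A, ξ x = 0 := fun x hx => hξA x (Submodule.mem_sup_left hx)
  have hξC' : ∀ x ∈ d.C, ξ x = d.γ x z + d.γ g' x - d.γ g' g' * d.γ c x := fun x hx => by
    rw [hξC x hx]; simp
  refine h.quad r c g' z ξ hr.1 (hBC hc) hg'C hz hr.2 (hBl c hc) (by rwa [hlg'])
    (by rw [hBg c (hBC hc), hcg]) hrz (by simp [hg', hrz]) hrc
    (hξA z (Submodule.mem_sup_right (Submodule.mem_span_singleton_self z)))
    hξC' (hT.imp_right fun hT x hx => hξA' x (hT hx)) ?_ ?_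
  · rcases hstr with hst | ⟨hVB, t, htA, hatt⟩
    · exact .inr (.inl fun v hv => hξA' v (hst hv))
    · refine .inr (.inr ⟨t, d.C, ⟨hatt.mem, hξA' t htA, hatt.rad, hatt.subs, hr.1, ?_⟩,
        fun w hw => .inl hw⟩)
      intro v hv hvC
      have hvB := hVB ⟨hv, hvC⟩
      have h1 := h.swap hg'C hvC
      rw [hBg v hvC, hBl v hvB] at h1
      simp [hξC' v hvC, hzB v hvB, h1, hBB c hc v hvB]
  · refine hstc.imp_right fun ⟨t, htA, hatt, hv⟩ => ⟨t, hatt, hξA' t htA, fun v hv1 hvC => ?_⟩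
    rw [h.swap hg'C hvC, hBg v hvC, hv v hv1 hvC, h.lam_C1 hvC hv1]
    ring

theorem Irr.T_Z {t : V} (ht : t ∈ d.T) (hZ : t ∈ d.Z) : t = 0 := by
  by_contra h0
  obtain ⟨g, hg, hgt⟩ := exists_dual_one (d.C ⊓ d.V1) (v := t) fun hv => h0 (h.V1_T hv.2 ht)
  obtain ⟨y, hy⟩ := h.exists_rep g
  have hr := h.I_le_RC ht hZ.1
  have hty : d.γ t y = 1 := by rw [hy t hZ.1, hgt]
  refine h.rz' t y d.V1 hr hty ?_ (.inl ht) (.inr hZ.2) (.inr (.inl le_rfl))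
  intro x hx a hxa
  have ha := hr.2 _ hxa
  rw [map_add, map_smul, hZ.2 x hx, hty] at ha
  obtain rfl : a = 0 := by simpa using ha
  rw [zero_smul, add_zero] at hxa ⊢
  rw [hy x hxa, hg x ⟨hxa, hx⟩]

theorem Irr.C1_Z {c : V} (hV : c ∈ d.V1) (hZ : c ∈ d.Z) : c = 0 := by
  by_contra h0
  by_cases hc : ∀ y ∈ d.C, d.γ c y = 0
  · have hr : c ∈ d.RC := ⟨hZ.1, hc⟩
    obtain ⟨g, hg, hgt⟩ := exists_dual_one (d.C ⊓ d.T) (v := c) fun hv => h0 (h.V1_T hV hv.2)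
    obtain ⟨y, hy⟩ := h.exists_rep g
    have hcy : d.γ c y = 1 := by rw [hy c hZ.1, hgt]
    refine h.rz' c y d.T hr hcy ?_ (.inr le_rfl) (.inr hZ.2) (.inl hV)
    intro x hx a hxa
    have ha := hr.2 _ hxa
    rw [map_add, map_smul, h.ax.gCT c hZ.1 x hx, hcy] at ha
    obtain rfl : a = 0 := by simpa using ha
    rw [zero_smul, add_zero] at hxa ⊢
    rw [hy x hxa, hg x ⟨hxa, hx⟩]
  · push Not at hc
    obtain ⟨y, hy, hcy⟩ := hc
    exact h.hp c y hZ.1 hy (h.lam_C1 hZ.1 hV) hcy (.inl hV) (.inr (.inl hZ.2))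

end
end VD

namespace VD
variable {F V : Type*} [Field F] [AddCommGroup V] [Module F V]

/-- If `r` pairs with `V1` like no vector of `B`, a vector of `V1` separates `r` from `B`. -/
theorem exists_separating [FiniteDimensional F V] {d : VD F V} (B : Submodule F V) (r : V) (hr : r ∉ B)
    (hrB : ¬ ∃ c ∈ B, ∀ v ∈ d.V1, d.γ c v = d.γ r v) :
    ∃ z ∈ d.V1, (∀ b ∈ B, d.γ b z = 0) ∧ d.γ r z = 1 := by
  refine exists_mem_one d.V1 B r 0 hr fun b hb a hba => ?_
  simp only [LinearMap.zero_apply, zero_add]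
  by_contra ha
  refine hrB ⟨-a⁻¹ • b, B.smul_mem _ hb, fun v hv => ?_⟩
  have := hba v hv
  simp only [map_add, map_smul, LinearMap.add_apply, LinearMap.smul_apply, smul_eq_mul] at this ⊢
  field_simp
  linear_combination -this

section

variable {d : VD F V} (h : d.Irr) [FiniteDimensional F V]
include h

theorem Irr.T_C_of_RC {t c : V} (ht : t ∈ d.T) (hC : t ∈ d.C) (hc : c ∈ d.RC) (hV : c ∈ d.V1)
    (hct : ∀ v ∈ d.V1, d.γ c v = d.γ t v) : t = 0 := by
  by_contra h0
  have hr := h.I_le_RC ht hC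
  obtain ⟨z, hz, hzt⟩ : ∃ z ∈ d.V1, d.γ t z = 1 := by
    by_contra hcon
    refine h0 (h.T_Z ht ⟨hC, fun v hv => ?_⟩)
    by_contra hne
    exact hcon ⟨(d.γ t v)⁻¹ • v, d.V1.smul_mem _ hv, by simp [hne]⟩
  obtain ⟨g, hgI, hgC⟩ := exists_dual_eq (d.C ⊓ d.T) (d.C ⊓ d.V1) (d.γ.flip z)
    fun x hx hx' => by simp [h.V1_T hx'.2 hx.2]
  obtain ⟨y, hy⟩ := h.exists_rep g
  have hty : d.γ t y = 0 := by rw [hy t hC, hgI t ⟨hC, ht⟩]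
  have hcz : d.γ c z = 1 := by rw [hct z hz, hzt]
  have hcy : d.γ c y = 1 := by
    rw [hy c hc.1, hgC c ⟨hc.1, hV⟩, LinearMap.flip_apply, hcz]
  obtain ⟨ξt, hξt, hξtC⟩ := exists_dual_eq (d.V1 ⊔ F ∙ y) d.C (d.γ.flip (z - y)) (by
    intro x hx hxC
    obtain ⟨v, hv, w, hw, rfl⟩ := Submodule.mem_sup.1 hx
    obtain ⟨a, rfl⟩ := Submodule.mem_span_singleton.1 hw
    have h1 := hr.2 _ hxC
    have h2 := hc.2 _ hxC
    simp only [map_add, map_smul, hty, hcy, hct v hv, smul_eq_mul] at h1 h2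
    obtain rfl : a = 0 := by linear_combination h2 - h1
    rw [zero_smul, add_zero] at hxC ⊢
    simp [hy v hxC, hgC v ⟨hxC, hv⟩])
  obtain ⟨ξc, hξc, hξcC⟩ := exists_dual_eq (d.T ⊔ (F ∙ z ⊔ F ∙ y)) d.C (d.γ.flip y) (by
    intro x hx hxC
    obtain ⟨s, hs, w, hw, rfl⟩ := Submodule.mem_sup.1 hx
    obtain ⟨w₁, hw₁, w₂, hw₂, rfl⟩ := Submodule.mem_sup.1 hw
    obtain ⟨a, rfl⟩ := Submodule.mem_span_singleton.1 hw₁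
    obtain ⟨b, rfl⟩ := Submodule.mem_span_singleton.1 hw₂
    have h1 := hr.2 _ hxC
    have h2 := hc.2 _ hxC
    simp only [map_add, map_smul, hty, hcy, hzt, hcz, h.ax.gCT _ hC s hs, h.ax.gCT _ hc.1 s hs,
      smul_eq_mul] at h1 h2
    obtain rfl : a = 0 := by linear_combination h1
    obtain rfl : b = 0 := by linear_combination h2
    rw [zero_smul, zero_smul, add_zero, add_zero] at hxC ⊢
    simp [hy s hxC, hgI s ⟨hxC, hs⟩])
  have hzC : z ∉ d.C := fun hz => by simp [hr.2 z hz] at hzt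
  have hyC : y ∉ d.C := fun hz => by simp [hc.2 y hz] at hcy
  have e1 : ξt t = 1 := by simp [hξtC t hC, hzt, hty]
  have e2 : ξt c = 0 := by simp [hξtC c hc.1, hcz, hcy]
  have e3 : ξt z = 0 := hξt z (Submodule.mem_sup_left hz)
  have e4 : ξt y = 0 := hξt y (Submodule.mem_sup_right (Submodule.mem_span_singleton_self _))
  have e5 : ξc t = 0 := by simp [hξcC t hC, hty]
  have e6 : ξc c = 1 := by simp [hξcC c hc.1, hcy]
  have e7 : ξc z = 0 := hξc z
    (Submodule.mem_sup_right (Submodule.mem_sup_left (Submodule.mem_span_singleton_self _)))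
  have e8 : ξc y = 0 := hξc y
    (Submodule.mem_sup_right (Submodule.mem_sup_right (Submodule.mem_span_singleton_self _)))
  have f1 := hr.2 t hC
  have f2 := hr.2 c hc.1
  have f3 := hc.2 t hC
  have f4 := hc.2 c hc.1
  refine h.splitAtt (κ := Fin 4) ![t, c, z, y] ![ξt, ξc, d.γ t, d.γ c - d.γ t] ?_ ?_ ?_ ?_ ?_ ?_ ?_
  · intro i j
    fin_cases i <;> fin_cases j <;>
      simp [e1, e2, e3, e4, e5, e6, e7, e8, f1, f2, f3, f4, hty, hcz, hcy, hzt]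
  · rw [forall_subs', h.P_eq_bot, h.Q_eq_bot]
    refine ⟨?_, ?_, ?_, ?_⟩ <;> intro i <;> fin_cases i
    iterate 8 (right; intro x hx; simp [(Submodule.mem_bot F).1 hx])
    · exact .inl hC
    · exact .inl hc.1
    · exact .inr hr.2
    · right; intro x hx
      simp [hr.2 x hx, hc.2 x hx]
    · exact .inl ht
    · exact .inr fun x hx => hξc x (Submodule.mem_sup_left hx)
    · exact .inr fun x hx => h.ax.gCT t hC x hx
    · right; intro x hx
      simp [h.ax.gCT t hC x hx, h.ax.gCT c hc.1 x hx]
  · intro i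
    fin_cases i
    · exact .inr (.inl fun v hv => hξt v (Submodule.mem_sup_left hv))
    · exact .inl hV
    · exact .inl hz
    · right; left; intro v hv
      simp [hct v hv]
  · intro i hi x hx
    simp only [Fin.forall_fin_succ, IsEmpty.forall_iff] at hx
    have h3 : d.γ t x = 0 := hx.2.2.1
    have h2 : d.γ c x = 0 := by simpa [h3] using hx.2.2.2.1
    fin_cases i
    · exact h3
    · exact h2
    · exact (hzC hi).elim
    · exact (hyC hi).elim
  · intro j
    refine ⟨0, by simp, fun x hx hx' => ?_⟩
    simp only [Fin.forall_fin_succ, IsEmpty.forall_iff] at hx'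
    have h1 : d.γ x y = 0 := by simpa [hξcC x hx] using hx'.2.1
    have h2 : d.γ x z = 0 := by simpa [hξtC x hx, h1] using hx'.1
    fin_cases j
    · simp [h.g_RC hr hx]
    · simp [h.g_RC hc hx]
    · simp [h2]
    · simp [h1]
  · intro i j hi
    fin_cases i <;> fin_cases j <;>
      first
      | exact (hzC hi).elim
      | exact (hyC hi).elim
      | simp [smallScalars, f1, f2, f3, f4, hty, hcz, hcy, hzt]
  · intro i hi
    fin_cases i
    · simp [h.lam_RC hr]
    · simp [h.lam_RC hc]
    · exact (hzC hi).elim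
    · exact (hyC hi).elim

theorem Irr.T_C {t : V} (ht : t ∈ d.T) (hC : t ∈ d.C) : t = 0 := by
  by_contra h0
  have hr := h.I_le_RC ht hC
  have htB : t ∉ d.C ⊓ d.V1 := fun hv => h0 (h.V1_T hv.2 ht)
  by_cases hex : ∃ c ∈ d.C ⊓ d.V1, ∀ v ∈ d.V1, d.γ c v = d.γ t v
  · obtain ⟨c, hc, hcv⟩ := hex
    by_cases hcr : ∀ g ∈ d.C, d.γ c g = 0
    · exact h0 (h.T_C_of_RC ht hC ⟨hc.1, hcr⟩ hc.2 hcv)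
    · push Not at hcr
      obtain ⟨g, hg, hcg⟩ := hcr
      refine h.quad' t c g d.V1 (d.C ⊓ d.V1) hr htB inf_le_left hc
        (fun x hx hxZ => h.C1_Z hx.2 hxZ) (fun x hx y hy => h.C1_C1 hx.1 hx.2 hy.1 hy.2)
        (fun x hx => h.lam_C1 hx.1 hx.2) hcv hg hcg
        (fun z hz _ x hx a hxa => ⟨hxa, d.V1.add_mem hx (d.V1.smul_mem _ hz)⟩)
        (.inl ht) (.inl le_rfl) (.inl hc.2)
  · obtain ⟨z, hz, hzB, hzt⟩ := exists_separating (d.C ⊓ d.V1) t htB hex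
    exact h.rz' t z d.V1 hr hzt
      (fun x hx a hxa => hzB _ ⟨hxa, d.V1.add_mem hx (d.V1.smul_mem _ hz)⟩)
      (.inl ht) (.inl hz) (.inr (.inl le_rfl))

/-- Vectors of `T + ⟨z⟩` in `C` vanish when `z` pairs nontrivially with `RC`. -/
theorem Irr.T_add_C {r x z : V} {a : F} (hr : r ∈ d.RC) (hz : d.γ r z ≠ 0) (hx : x ∈ d.T)
    (hxa : x + a • z ∈ d.C) : x + a • z = 0 := by
  have h1 := hr.2 _ hxa
  rw [map_add, map_smul, h.ax.gCT r hr.1 x hx, zero_add, smul_eq_mul] at h1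
  obtain rfl := (mul_eq_zero.1 h1).resolve_right hz
  rw [zero_smul, add_zero] at hxa ⊢
  exact h.T_C hx hxa

theorem Irr.RC_C1 {r : V} (hr : r ∈ d.RC) (hV : r ∈ d.V1) : r = 0 := by
  by_contra h0
  obtain ⟨z, hz, -, hzr⟩ := exists_separating (d := d) ⊥ r (by simpa using h0)
    fun ⟨c, hc, hcr⟩ => h0 (h.C1_Z hV ⟨hr.1, by
      intro v hv; rw [← hcr v hv, (Submodule.mem_bot F).1 hc]; simp⟩)
  refine h.rz' r z d.T hr hzr (fun x hx a hxa => ?_) (.inr le_rfl) (.inl hz) (.inl hV)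
  rw [h.T_add_C hr (by simp [hzr]) hx hxa]; simp

theorem Irr.Cb_attached {r : V} (hr : r ∈ d.Cb) (hV : r ∉ d.V1) :
    ∃ t ∈ d.T, t ∉ d.C ∧ r + t ∈ d.V1 := by
  refine (Cb_cases hr).resolve_left ?_
  rintro ⟨u, hu, huC, t, ht, htC, rfl⟩
  rw [h.T_C ht htC, add_zero] at hV
  exact hV hu

theorem Irr.RC_Z {r : V} (hr : r ∈ d.RC) (hZ : r ∈ d.Z) : r = 0 := by
  by_contra h0
  by_cases hb : r ∈ d.Cb
  · have hV : r ∉ d.V1 := fun hV => h0 (h.C1_Z hV hZ)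
    obtain ⟨t, ht, htC, hrt⟩ := h.Cb_attached hb hV
    obtain ⟨g, hg, hgr⟩ := exists_dual_one (d.C ⊓ d.V1) (v := r) fun hv => hV hv.2
    obtain ⟨y, hy⟩ := h.exists_rep g
    have hry : d.γ r y = 1 := by rw [hy r hr.1, hgr]
    refine h.rz' r y d.T hr hry (fun x hx a hxa => ?_) (.inr le_rfl) (.inr hZ.2)
      (.inr (.inr ⟨t, ht, d.C ⊔ F ∙ y, ⟨hrt, h.rad_T ht htC,
        fun S hS => (h.subs_of_T ht S hS).imp_right fun h => h.trans le_sup_left, le_sup_left⟩,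
        .inl (Submodule.mem_sup_right (Submodule.mem_span_singleton_self _)), ?_⟩))
    · rw [h.T_add_C hr (by simp [hry]) hx hxa]; simp
    · intro v hv hvy
      obtain ⟨c, hc, w, hw, rfl⟩ := Submodule.mem_sup.1 hvy
      obtain ⟨a, rfl⟩ := Submodule.mem_span_singleton.1 hw
      have h1 := hZ.2 _ hv
      rw [map_add, map_smul, hr.2 c hc, hry] at h1
      obtain rfl : a = 0 := by simpa using h1
      rw [zero_smul, add_zero] at hv ⊢
      exact ⟨hc, by rw [hy c hc, hg c ⟨hc, hv⟩]⟩
  · obtain ⟨g, hg, hgr⟩ := exists_dual_one d.Cb hb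
    obtain ⟨y, hy⟩ := h.exists_rep g
    have hry : d.γ r y = 1 := by rw [hy r hr.1, hgr]
    refine h.rz' r y (d.V1 ⊔ d.T) hr hry (fun x hx a hxa => ?_) (.inr le_sup_right) (.inr hZ.2)
      (.inr (.inl le_sup_left))
    obtain ⟨v, hv, t, ht, rfl⟩ := Submodule.mem_sup.1 hx
    have h1 := hr.2 _ hxa
    rw [map_add, map_smul, hry, map_add, hZ.2 v hv, h.ax.gCT r hr.1 t ht] at h1
    obtain rfl : a = 0 := by simpa using h1
    rw [zero_smul, add_zero] at hxa ⊢
    rw [hy _ hxa, hg _ ⟨hxa, hx⟩]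

theorem Irr.RC_Cb {r : V} (hr : r ∈ d.RC) (hb : r ∈ d.Cb) : r = 0 := by
  by_contra h0
  have hV : r ∉ d.V1 := fun hV => h0 (h.RC_C1 hr hV)
  obtain ⟨t, ht, htC, hrt⟩ := h.Cb_attached hb hV
  have hrB : r ∉ d.C ⊓ d.V1 := fun hv => hV hv.2
  by_cases hex : ∃ c ∈ d.C ⊓ d.V1, ∀ v ∈ d.V1, d.γ c v = d.γ r v
  · obtain ⟨c, hc, hcv⟩ := hex
    by_cases hcr : ∀ g ∈ d.C, d.γ c g = 0
    · obtain rfl := h.RC_C1 ⟨hc.1, hcr⟩ hc.2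
      exact h0 (h.RC_Z hr ⟨hr.1, fun v hv => by simp [← hcv v hv]⟩)
    · push Not at hcr
      obtain ⟨g, hg, hcg⟩ := hcr
      refine h.quad' r c g d.T (d.C ⊓ d.V1) hr hrB inf_le_left hc
        (fun x hx hxZ => h.C1_Z hx.2 hxZ) (fun x hx y hy => h.C1_C1 hx.1 hx.2 hy.1 hy.2)
        (fun x hx => h.lam_C1 hx.1 hx.2) hcv hg hcg
        (fun z hz hrz x hx a hxa => ?_)
        (.inr le_rfl) (.inr ⟨inf_comm d.C d.V1 |>.ge, t, ht, h.attC_T ht htC hrt⟩) (.inl hc.2)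
      rw [h.T_add_C hr hrz hx hxa]
      exact Submodule.zero_mem _
  · obtain ⟨z, hz, hzB, hzr⟩ := exists_separating (d.C ⊓ d.V1) r hrB hex
    refine h.rz' r z d.T hr hzr (fun x hx a hxa => ?_) (.inr le_rfl) (.inl hz)
      (.inr (.inr ⟨t, ht, d.C, h.attC_T ht htC hrt, .inr hz, fun v hv hvC => ⟨hvC, hzB v ⟨hvC, hv⟩⟩⟩))
    rw [h.T_add_C hr (by simp [hzr]) hx hxa]; simp

/-- A vector of `C` pairing to `1` with a given `c ∈ Cb` and to `0` with `V1 ∩ C`. -/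
theorem Irr.exists_C_dual {c : V} (hc : c ∈ d.Cb) (hV : c ∉ d.V1) :
    ∃ y ∈ d.C, (∀ v ∈ d.C ⊓ d.V1, d.γ v y = 0) ∧ d.γ c y = 1 := by
  refine exists_mem_one d.C (d.C ⊓ d.V1) c 0 (fun hv => hV hv.2) fun b hb a hba => ?_
  have h0 : b + a • c = 0 := h.RC_Cb
    ⟨d.C.add_mem hb.1 (d.C.smul_mem _ hc.1), hba⟩
    (d.Cb.add_mem ⟨hb.1, Submodule.mem_sup_left hb.2⟩ (d.Cb.smul_mem _ hc))
  have : a = 0 := by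
    by_contra ha
    refine hV ?_
    rw [← d.V1.smul_mem_iff ha, ← d.V1.add_mem_iff_right hb.2, h0]
    exact d.V1.zero_mem
  simp [this]

theorem Irr.Cb_Z {c : V} (hc : c ∈ d.Cb) (hZ : c ∈ d.Z) : c = 0 := by
  by_contra h0
  have hV : c ∉ d.V1 := fun hV => h0 (h.C1_Z hV hZ)
  obtain ⟨t, ht, htC, hct⟩ := h.Cb_attached hc hV
  obtain ⟨y, hy, hyB, hcy⟩ := h.exists_C_dual hc hV
  refine h.hp c y hc.1 hy (h.lam_Cb hc) (by simp [hcy])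
    (.inr (.inr ⟨t, d.C, h.attC_T ht htC hct, fun v hv hvC => ⟨?_, hZ.2 v hv⟩⟩))
    (.inr (.inl hZ.2))
  rw [h.swap hy hvC, hyB v ⟨hvC, hv⟩, h.lam_C1 hvC hv]
  ring

theorem Irr.RC_eq_zero {r : V} (hr : r ∈ d.RC) : r = 0 := by
  by_contra h0
  have hb : r ∉ d.Cb := fun hb => h0 (h.RC_Cb hr hb)
  by_cases hex : ∃ c ∈ d.Cb, ∀ v ∈ d.V1, d.γ c v = d.γ r v
  · obtain ⟨c, hc, hcv⟩ := hex
    have hc0 : c ≠ 0 := by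
      rintro rfl
      exact h0 (h.RC_Z hr ⟨hr.1, fun v hv => by simp [← hcv v hv]⟩)
    obtain ⟨g, hg, hcg, hst⟩ : ∃ g ∈ d.C, d.γ c g ≠ 0 ∧ (c ∈ d.V1 ∨ ∃ t ∈ d.V1 ⊔ d.T,
        d.AttC c t d.C ∧ ∀ v ∈ d.V1, v ∈ d.C → d.γ v g = 0) := by
      by_cases hV : c ∈ d.V1
      · by_contra hcon
        refine hc0 (h.RC_Cb ⟨hc.1, fun g hg => ?_⟩ hc)
        by_contra hne
        exact hcon ⟨g, hg, hne, .inl hV⟩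
      · obtain ⟨t, ht, htC, hct⟩ := h.Cb_attached hc hV
        obtain ⟨y, hy, hyB, hcy⟩ := h.exists_C_dual hc hV
        exact ⟨y, hy, by simp [hcy], .inr ⟨t, Submodule.mem_sup_right ht, h.attC_T ht htC hct,
          fun v hv hvC => hyB v ⟨hvC, hv⟩⟩⟩
    exact h.quad' r c g (d.V1 ⊔ d.T) d.Cb hr hb inf_le_left hc
      (fun x hx hxZ => h.Cb_Z hx hxZ) (fun x hx y hy => h.Cb_Cb hx hy)
      (fun x hx => h.lam_Cb hx) hcv hg hcg
      (fun z hz _ x hx a hxa => ⟨hxa, Submodule.add_mem _ hx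
        (Submodule.mem_sup_left (d.V1.smul_mem _ hz))⟩)
      (.inr le_sup_right) (.inl le_sup_left) hst
  · obtain ⟨z, hz, hzB, hzr⟩ := exists_separating d.Cb r hb hex
    exact h.rz' r z (d.V1 ⊔ d.T) hr hzr
      (fun x hx a hxa => hzB _ ⟨hxa, Submodule.add_mem _ hx
        (Submodule.mem_sup_left (d.V1.smul_mem _ hz))⟩)
      (.inr le_sup_right) (.inl hz) (.inr (.inl le_sup_left))

end
end VD

namespace VD
variable {F V : Type*} [Field F] [AddCommGroup V] [Module F V]

section

variable {d : VD F V} (h : d.Irr) [FiniteDimensional F V]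
include h

theorem Irr.Cb_of_stC {c : V} (hc : c ∈ d.Cb) (hst : ∀ x ∈ d.C, d.StC c fun v =>
    d.γ x v = 0 ∧ d.γ c v = 0) : c = 0 := by
  by_contra h0
  obtain ⟨z, hz, hcz⟩ : ∃ z ∈ d.V1, d.γ c z ≠ 0 := by
    by_contra hcon
    push Not at hcon
    exact h0 (h.Cb_Z hc ⟨hc.1, hcon⟩)
  obtain ⟨x, hx, hxz⟩ := exists_mem_pairing_eq d.γ d.C d.C (d.γ.flip z) fun r hr hrC => by
    rw [h.RC_eq_zero ⟨hr, hrC⟩, map_zero]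
  simp only [LinearMap.flip_apply] at hxz
  have hk : z - x ∈ d.R := fun y hy => by simp [hxz y hy]
  have hkC : z - x ∉ d.C := fun hk => hcz (h.Cb_C1 ((d.C.sub_mem_iff_left hx).1 hk) hz hc)
  refine h.hp c x hc.1 hx (h.lam_Cb hc) (by rwa [hxz c hc.1]) (hst x hx)
    (.inr (.inr ⟨z - x, d.C ⊔ d.T, ⟨by rwa [add_sub_cancel], rad_of_notMem hk hkC,
      forall_subs'.2 ⟨.inr (h.P_le' _), .inr (h.Q_le _), .inr le_sup_left, .inr le_sup_right⟩,
      le_sup_left⟩, fun v hv hvCT => ?_⟩))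
  obtain ⟨c', hc', t, ht, rfl⟩ := Submodule.mem_sup.1 hvCT
  have hb : c' ∈ d.Cb := ⟨hc', by
    rw [← add_sub_cancel_right c' t]
    exact Submodule.sub_mem _ (Submodule.mem_sup_left hv) (Submodule.mem_sup_right ht)⟩
  rw [map_add, h.Cb_Cb hc hb, h.ax.gCT c hc.1 t ht, add_zero]

theorem Irr.C1_eq_zero {c : V} (hc : c ∈ d.C) (hV : c ∈ d.V1) : c = 0 :=
  h.Cb_of_stC ⟨hc, Submodule.mem_sup_left hV⟩ fun _ _ => .inl hV

theorem Irr.Cb_eq_zero {c : V} (hc : c ∈ d.Cb) : c = 0 := by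
  by_cases hV : c ∈ d.V1
  · exact h.C1_eq_zero hc.1 hV
  · obtain ⟨t, ht, htC, hct⟩ := h.Cb_attached hc hV
    refine h.Cb_of_stC hc fun _ _ => .inr (.inr ⟨t, d.C, h.attC_T ht htC hct, fun v hv hvC => ?_⟩)
    simp [h.C1_eq_zero hvC hv]

theorem Irr.T_eq_bot : d.T = ⊥ := by
  rw [Submodule.eq_bot_iff]
  intro t ht
  obtain ⟨c, hc, v, hv, rfl⟩ := Submodule.mem_sup.1 (h.T_le ht)
  have hc0 : c = 0 := h.Cb_eq_zero ⟨hc, by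
    rw [← add_sub_cancel_right c v]
    exact Submodule.sub_mem _ (Submodule.mem_sup_right ht) (Submodule.mem_sup_left hv)⟩
  subst hc0
  rw [zero_add] at ht ⊢
  exact h.V1_T hv ht

/-- A vector of `C` whose functional is represented by `V1` is attached. -/
theorem Irr.attC {c : V} (hc : c ∈ d.C) (h0 : c ≠ 0) (hZ : ∀ z ∈ d.Z, d.γ z c = 0) :
    ∃ k, d.AttC c k d.C := by
  obtain ⟨v, hv, hvc⟩ := exists_mem_pairing_eq d.γ d.C d.V1 (d.γ.flip c) fun r hr hrC =>
    hZ r ⟨hr, hrC⟩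
  simp only [LinearMap.flip_apply] at hvc
  have hk : v - c ∈ d.R := fun y hy => by simp [hvc y hy]
  have hkC : v - c ∉ d.C := fun hk => by
    have hv0 := h.C1_eq_zero ((d.C.sub_mem_iff_left hc).1 hk) hv
    subst hv0
    have hl := h.lam_eq_zero hc (by rw [← hvc c hc, map_zero])
    refine h0 (h.RC_eq_zero ⟨hc, fun y hy => ?_⟩)
    rw [h.swap hc hy, ← hvc y hy, hl, map_zero]
    ring
  exact ⟨v - c, by rwa [add_sub_cancel], rad_of_notMem hk hkC, forall_subs'.2
    ⟨.inr (h.P_le' _), .inr (h.Q_le _), .inr le_rfl, .inr (h.T_eq_bot.le.trans bot_le)⟩, le_rfl⟩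

theorem Irr.exists_C_ne {c : V} (hc : c ∈ d.C) (h0 : c ≠ 0) : ∃ y ∈ d.C, d.γ c y ≠ 0 := by
  by_contra hcon
  push Not at hcon
  exact h0 (h.RC_eq_zero ⟨hc, hcon⟩)

theorem Irr.Z_eq_zero {c : V} (hZ : c ∈ d.Z) : c = 0 := by
  by_contra h0
  obtain ⟨k, hk⟩ := h.attC hZ.1 h0 fun z hz => h.Z_Z hz hZ
  obtain ⟨y, hy, hcy⟩ := h.exists_C_ne hZ.1 h0
  exact h.hp c y hZ.1 hy (h.lam_Z hZ) hcy
    (.inr (.inr ⟨k, d.C, hk, fun v hv hvC => by simp [h.C1_eq_zero hvC hv]⟩)) (.inr (.inl hZ.2))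

theorem Irr.C_eq_zero {c : V} (hc : c ∈ d.C) : c = 0 := by
  by_contra h0
  have key : ∀ x ∈ d.C, x ≠ 0 → ∀ p : V → Prop, p 0 → d.StC x p := by
    intro x hx hx0 p hp
    obtain ⟨k, hk⟩ := h.attC hx hx0 fun z hz => by simp [h.Z_eq_zero hz]
    exact .inr (.inr ⟨k, d.C, hk, fun v hv hvC => by rwa [h.C1_eq_zero hvC hv]⟩)
  by_cases hl : d.lam c = 0
  · obtain ⟨y, hy, hcy⟩ := h.exists_C_ne hc h0
    refine h.hp c y hc hy hl hcy (key c hc h0 _ (by simp)) (key y hy ?_ _ (by simp))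
    rintro rfl
    simp at hcy
  · exact h.peel c hc hl (key c hc h0 _ (by simp))

theorem Irr.false : False := by
  have hx0 : ∀ x : V, x = 0 := by
    intro x
    have hx : x ∈ d.C ⊔ d.V1 := h.R_le fun c hc => by simp [h.C_eq_zero hc]
    obtain ⟨c, hc, v, hv, rfl⟩ := Submodule.mem_sup.1 hx
    obtain rfl := h.C_eq_zero hc
    have hv' := h.V1_R_le hv fun c hc => by simp [h.C_eq_zero hc]
    obtain ⟨c, hc, t, ht, rfl⟩ := Submodule.mem_sup.1 hv'
    rw [h.T_eq_bot, Submodule.mem_bot] at ht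
    rw [h.C_eq_zero hc, ht]; simp
  have : Subsingleton V := ⟨fun x y => by rw [hx0 x, hx0 y]⟩
  refine h.nk ⟨Empty, inferInstance, Basis.empty V, ?_, ?_, ?_, ?_⟩
  · exact fun _ _ i => i.elim
  · intro x _
    rw [hx0 x]
    exact Submodule.zero_mem _
  · exact fun i => i.elim
  · exact fun i => i.elim

end

/-- Every compatible `VD` has a good basis. -/
theorem Ax.kr (h2 : (2 : F) ≠ 0) : ∀ (n : ℕ) {V : Type*} [AddCommGroup V] [Module F V]
    [FiniteDimensional F V] {d : VD F V}, d.Ax → finrank F V = n → d.Kr := by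
  intro n
  induction n using Nat.strong_induction_on with
  | _ n ih =>
    intro V _ _ _ d hd hn
    by_contra hk
    refine Irr.false (d := d) ⟨h2, hd, hk, fun Y hY => ?_⟩
    exact ih (finrank F Y) (hn ▸ Submodule.finrank_lt hY) (hd.restrict Y) rfl

end VD

namespace VD
variable {F V V' : Type*} [Field F] [AddCommGroup V] [Module F V] [AddCommGroup V'] [Module F V']

/-- A linear equivalence preserving the data. -/
structure Iso (d : VD F V) (d' : VD F V') (φ : V ≃ₗ[F] V') : Prop where
  V1 : ∀ x, x ∈ d.V1 ↔ φ x ∈ d'.V1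
  P : ∀ x, x ∈ d.P ↔ φ x ∈ d'.P
  Q : ∀ x, x ∈ d.Q ↔ φ x ∈ d'.Q
  C : ∀ x, x ∈ d.C ↔ φ x ∈ d'.C
  T : ∀ x, x ∈ d.T ↔ φ x ∈ d'.T
  D : ∀ x, x ∈ d.D ↔ φ x ∈ d'.D
  γ : ∀ x ∈ d.C, ∀ y ∈ d.D, d'.γ (φ x) (φ y) = d.γ x y
  lam : ∀ x ∈ d.C, d'.lam (φ x) = d.lam x

instance (F : Type*) [Field F] : Finite (smallScalars F) := by
  unfold smallScalars
  exact Set.toFinite _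

/-- The type of combinatorial descriptions of data on a space of dimension `m`. -/
abbrev Code (F : Type*) [Field F] (m : ℕ) : Type _ :=
  (Set (Fin m) × Set (Fin m) × Set (Fin m) × Set (Fin m) × Set (Fin m)) ×
    Set (Fin m → smallScalars F) × Set (Fin m × Fin m × smallScalars F) ×
    Set (Fin m × smallScalars F)

/-- The combinatorial description of the data in a basis. -/
def code (d : VD F V) {m : ℕ} (b : Basis (Fin m) F V) : Code F m :=
  (({i | b i ∈ d.P}, {i | b i ∈ d.Q}, {i | b i ∈ d.C}, {i | b i ∈ d.T}, {i | b i ∈ d.D}),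
    {k | ∑ i, (k i : F) • b i ∈ d.V1},
    {p | b p.1 ∈ d.C ∧ b p.2.1 ∈ d.D ∧ d.γ (b p.1) (b p.2.1) = p.2.2},
    {p | b p.1 ∈ d.C ∧ d.lam (b p.1) = p.2})

variable {m : ℕ} {b : Basis (Fin m) F V} {b' : Basis (Fin m) F V'}

theorem equiv_mem {S : Submodule F V} {S' : Submodule F V'}
    (hS : ∀ i, b i ∈ S ∨ ∀ x ∈ S, b.repr x i = 0) (hSS : {i | b i ∈ S} = {i | b' i ∈ S'})
    {x : V} (hx : x ∈ S) : b.equiv b' (Equiv.refl _) x ∈ S' := by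
  rw [← b.sum_repr x, map_sum]
  refine Submodule.sum_mem _ fun i _ => ?_
  rw [map_smul, b.equiv_apply]
  rcases hS i with hi | hi
  · refine S'.smul_mem _ ?_
    have : i ∈ {i | b i ∈ S} := hi
    rw [hSS] at this
    exact this
  · rw [hi x hx, zero_smul]
    exact S'.zero_mem

theorem equiv_symm_symm : (b.equiv b' (Equiv.refl _)).symm = b'.equiv b (Equiv.refl _) := by
  simp

theorem equiv_mem_iff {S : Submodule F V} {S' : Submodule F V'}
    (hS : ∀ i, b i ∈ S ∨ ∀ x ∈ S, b.repr x i = 0)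
    (hS' : ∀ i, b' i ∈ S' ∨ ∀ x ∈ S', b'.repr x i = 0)
    (hSS : {i | b i ∈ S} = {i | b' i ∈ S'}) (x : V) :
    x ∈ S ↔ b.equiv b' (Equiv.refl _) x ∈ S' := by
  refine ⟨equiv_mem hS hSS, fun hx => ?_⟩
  have := equiv_mem (b' := b) hS' hSS.symm hx
  rwa [← equiv_symm_symm, LinearEquiv.symm_apply_apply] at this

theorem equiv_V1 {d : VD F V} {d' : VD F V'} (hd : d.Good b)
    (hc : {k : Fin m → smallScalars F | ∑ i, (k i : F) • b i ∈ d.V1} =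
      {k | ∑ i, (k i : F) • b' i ∈ d'.V1})
    {x : V} (hx : x ∈ d.V1) : b.equiv b' (Equiv.refl _) x ∈ d'.V1 := by
  have hle : d.V1 ≤ d'.V1.comap (b.equiv b' (Equiv.refl _)).toLinearMap := by
    refine hd.V1.trans (Submodule.span_le.2 ?_)
    rintro y ⟨hy, hk⟩
    have h1 : (fun i => ⟨b.repr y i, hk i⟩ : Fin m → smallScalars F) ∈
        {k : Fin m → smallScalars F | ∑ i, (k i : F) • b i ∈ d.V1} := by
      simpa [b.sum_repr] using hy
    rw [hc] at h1
    change b.equiv b' (Equiv.refl _) y ∈ d'.V1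
    rw [← b.sum_repr y, map_sum]
    simp only [map_smul, b.equiv_apply, Equiv.refl_apply]
    exact h1
  exact hle hx

theorem iso_of_code {d : VD F V} {d' : VD F V'} (hd : d.Good b) (hd' : d'.Good b')
    (hc : d.code b = d'.code b') : d.Iso d' (b.equiv b' (Equiv.refl _)) := by
  simp only [code, Prod.mk.injEq] at hc
  obtain ⟨⟨hP, hQ, hC, hT, hD⟩, hV, hγ, hl⟩ := hc
  have h1 : ∀ S ∈ d.subs, ∀ i, b i ∈ S ∨ ∀ x ∈ S, b.repr x i = 0 := hd.subs
  have h1' : ∀ S ∈ d'.subs, ∀ i, b' i ∈ S ∨ ∀ x ∈ S, b'.repr x i = 0 := hd'.subs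
  refine ⟨fun x => ⟨equiv_V1 hd hV, fun hx => ?_⟩,
    equiv_mem_iff (h1 _ (by simp [VD.subs])) (h1' _ (by simp [VD.subs])) hP,
    equiv_mem_iff (h1 _ (by simp [VD.subs])) (h1' _ (by simp [VD.subs])) hQ,
    equiv_mem_iff (h1 _ (by simp [VD.subs])) (h1' _ (by simp [VD.subs])) hC,
    equiv_mem_iff (h1 _ (by simp [VD.subs])) (h1' _ (by simp [VD.subs])) hT,
    equiv_mem_iff (h1 _ (by simp [VD.subs])) (h1' _ (by simp [VD.subs])) hD, ?_, ?_⟩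
  · have := equiv_V1 (b' := b) hd' hV.symm hx
    rwa [← equiv_symm_symm, LinearEquiv.symm_apply_apply] at this
  · intro x hx y hy
    rw [← b.sum_repr x, ← b.sum_repr y]
    simp only [map_sum, map_smul, LinearMap.sum_apply, LinearMap.smul_apply, b.equiv_apply,
      Equiv.refl_apply]
    refine Finset.sum_congr rfl fun j _ => ?_
    rcases h1 d.D (by simp [VD.subs]) j with hj | hj
    · refine congrArg _ (Finset.sum_congr rfl fun i _ => ?_)
      rcases h1 d.C (by simp [VD.subs]) i with hi | hi
      · have : (i, j, (⟨_, hd.γ i j hi hj⟩ : smallScalars F)) ∈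
            {p : Fin m × Fin m × smallScalars F |
              b p.1 ∈ d.C ∧ b p.2.1 ∈ d.D ∧ d.γ (b p.1) (b p.2.1) = p.2.2} := ⟨hi, hj, rfl⟩
        rw [hγ] at this
        rw [this.2.2]
      · simp [hi x hx]
    · simp [hj y hy]
  · intro x hx
    rw [← b.sum_repr x]
    simp only [map_sum, map_smul, b.equiv_apply, Equiv.refl_apply]
    refine Finset.sum_congr rfl fun i _ => ?_
    rcases h1 d.C (by simp [VD.subs]) i with hi | hi
    · have hs : d.lam (b i) ∈ smallScalars F := by
        have := hd.lam i hi
        simp only [Set.mem_insert_iff, Set.mem_singleton_iff, smallScalars] at this ⊢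
        tauto
      have : (i, (⟨_, hs⟩ : smallScalars F)) ∈
          {p : Fin m × smallScalars F | b p.1 ∈ d.C ∧ d.lam (b p.1) = p.2} := ⟨hi, rfl⟩
      rw [hl] at this
      rw [this.2]
    · simp [hi x hx]

theorem Kr.exists_fin {d : VD F V} (h : d.Kr) (hm : finrank F V = m) :
    ∃ b : Basis (Fin m) F V, d.Good b := by
  obtain ⟨ι, _, b, hb⟩ := h
  have e : ι ≃ Fin m := Fintype.equivFinOfCardEq (by rw [← hm, finrank_eq_card_basis b])
  refine ⟨b.reindex e, ?_, ?_, ?_, ?_⟩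
  · intro S hS i
    simpa using hb.subs S hS (e.symm i)
  · refine hb.V1.trans (Submodule.span_mono ?_)
    rintro x ⟨hx, hk⟩
    exact ⟨hx, fun i => by simpa using hk (e.symm i)⟩
  · intro i j
    simpa using hb.γ (e.symm i) (e.symm j)
  · intro i
    simpa using hb.lam (e.symm i)

end VD

namespace LinRel
variable {F E : Type*} [Field F] [AddCommGroup E] [Module F E]

/-- The domain of a linear relation. -/
def dom (G : Submodule F (E × E)) : Submodule F E := G.map (LinearMap.fst F E E)

/-- The range of a linear relation. -/
def rng (G : Submodule F (E × E)) : Submodule F E := G.map (LinearMap.snd F E E)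

/-- The relation is the graph of an injective partial map. -/
def Inj (G : Submodule F (E × E)) : Prop := ∀ x y, (x, y) ∈ G → (x = 0 ↔ y = 0)

theorem mem_dom {G : Submodule F (E × E)} {x : E} : x ∈ dom G ↔ ∃ y, (x, y) ∈ G := by
  simp [dom]

theorem mem_rng {G : Submodule F (E × E)} {y : E} : y ∈ rng G ↔ ∃ x, (x, y) ∈ G := by
  simp [rng]

theorem Inj.eq_right {G : Submodule F (E × E)} (h : Inj G) {x y z : E} (hy : (x, y) ∈ G)
    (hz : (x, z) ∈ G) : y = z := by
  have := G.sub_mem hy hz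
  rw [Prod.mk_sub_mk, sub_self] at this
  exact sub_eq_zero.1 ((h _ _ this).1 rfl)

theorem Inj.eq_left {G : Submodule F (E × E)} (h : Inj G) {x y z : E} (hy : (y, x) ∈ G)
    (hz : (z, x) ∈ G) : y = z := by
  have := G.sub_mem hy hz
  rw [Prod.mk_sub_mk, sub_self] at this
  exact sub_eq_zero.1 ((h _ _ this).2 rfl)

theorem Inj.finrank_dom {G : Submodule F (E × E)} (h : Inj G) :
    finrank F (dom G) = finrank F G := by
  rw [dom, ← LinearMap.range_domRestrict]
  refine LinearMap.finrank_range_of_inj ((injective_iff_map_eq_zero _).2 ?_)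
  rintro ⟨⟨x, y⟩, hxy⟩ h0
  have hx : x = 0 := h0
  have hy := (h x y hxy).1 hx
  simp [hx, hy]

theorem Inj.finrank_rng {G : Submodule F (E × E)} (h : Inj G) :
    finrank F (rng G) = finrank F G := by
  rw [rng, ← LinearMap.range_domRestrict]
  refine LinearMap.finrank_range_of_inj ((injective_iff_map_eq_zero _).2 ?_)
  rintro ⟨⟨x, y⟩, hxy⟩ h0
  have hy : y = 0 := h0
  have hx := (h x y hxy).2 hy
  simp [hx, hy]

theorem Inj.sup_span {G : Submodule F (E × E)} (h : Inj G) {a b : E} (ha : a ∉ dom G)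
    (hb : b ∉ rng G) : Inj (G ⊔ F ∙ (a, b)) := by
  intro x y hxy
  obtain ⟨⟨x', y'⟩, hg, z, hz, hzx⟩ := Submodule.mem_sup.1 hxy
  obtain ⟨s, rfl⟩ := Submodule.mem_span_singleton.1 hz
  obtain ⟨rfl, rfl⟩ : x' + s • a = x ∧ y' + s • b = y := by simpa using hzx
  have hxg : x' ∈ dom G := mem_dom.2 ⟨_, hg⟩
  have hyg : y' ∈ rng G := mem_rng.2 ⟨_, hg⟩
  rcases eq_or_ne s 0 with rfl | hs
  · simpa using h x' y' hg
  · constructor <;> intro h0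
    · refine (ha ?_).elim
      rw [← Submodule.smul_mem_iff _ hs, ← Submodule.add_mem_iff_right _ hxg, h0]
      exact Submodule.zero_mem _
    · refine (hb ?_).elim
      rw [← Submodule.smul_mem_iff _ hs, ← Submodule.add_mem_iff_right _ hyg, h0]
      exact Submodule.zero_mem _

variable [FiniteDimensional F E]

theorem exists_maximal {G₀ : Submodule F (E × E)} (p : Submodule F (E × E) → Prop)
    (h₀ : p G₀) : ∃ G, p G ∧ G₀ ≤ G ∧ ∀ G', p G' → G ≤ G' → G' = G := by
  obtain ⟨G, ⟨hG, hle⟩, hmax⟩ := WellFounded.has_min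
    (wellFounded_gt (α := Submodule F (E × E))) {G | p G ∧ G₀ ≤ G} ⟨G₀, h₀, le_rfl⟩
  refine ⟨G, hG, hle, fun G' hG' hle' => ?_⟩
  by_contra hne
  exact hmax G' ⟨hG', hle.trans hle'⟩ (lt_of_le_of_ne hle' (Ne.symm hne))

/-- An injective subrelation of a balanced relation extends to a full one. -/
theorem exists_extend {R G₀ : Submodule F (E × E)} (hle : G₀ ≤ R) (h₀ : Inj G₀)
    (hR : finrank F (dom R) = finrank F (rng R)) :
    ∃ G, G₀ ≤ G ∧ G ≤ R ∧ Inj G ∧ dom G = dom R ∧ rng G = rng R := by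
  obtain ⟨G, ⟨hGR, hG⟩, hle, hmax⟩ := exists_maximal (fun G => G ≤ R ∧ Inj G) ⟨hle, h₀⟩
  have hd : dom G ≤ dom R := Submodule.map_mono hGR
  have hr : rng G ≤ rng R := Submodule.map_mono hGR
  have hfin := hG.finrank_dom.trans hG.finrank_rng.symm
  have key : ∀ a b, (a, b) ∈ R → a ∉ dom G → b ∉ rng G → False := by
    intro a b hab ha hb
    have := hmax (G ⊔ F ∙ (a, b))
      ⟨sup_le hGR ((Submodule.span_singleton_le_iff_mem _ _).2 hab), hG.sup_span ha hb⟩ le_sup_left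
    apply ha
    rw [← this]
    exact mem_dom.2 ⟨b, Submodule.mem_sup_right (Submodule.mem_span_singleton_self _)⟩
  have hdom : dom G = dom R := by
    by_contra hne
    have hlt := lt_of_le_of_ne hd hne
    have hlt' : rng G < rng R := by
      refine lt_of_le_of_ne hr fun h => ?_
      have := Submodule.finrank_lt_finrank_of_lt hlt
      rw [hfin, h, hR] at this
      exact lt_irrefl _ this
    obtain ⟨a, haR, ha⟩ := SetLike.exists_of_lt hlt
    obtain ⟨b, hbR, hb⟩ := SetLike.exists_of_lt hlt'
    obtain ⟨a', haa⟩ := mem_dom.1 haR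
    obtain ⟨b', hbb⟩ := mem_rng.1 hbR
    by_cases ha' : a' ∈ rng G
    · by_cases hb' : b' ∈ dom G
      · obtain ⟨x, hx⟩ := mem_rng.1 ha'
        obtain ⟨y, hy⟩ := mem_dom.1 hb'
        refine key (a - x) (b - y) ?_ (fun hm => ha ?_) fun hm => hb ?_
        · have := R.add_mem (R.sub_mem haa (hGR hx)) (R.sub_mem hbb (hGR hy))
          simpa using this
        · exact (Submodule.sub_mem_iff_left _ (mem_dom.2 ⟨_, hx⟩)).1 hm
        · exact (Submodule.sub_mem_iff_left _ (mem_rng.2 ⟨_, hy⟩)).1 hm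
      · exact key b' b hbb hb' hb
    · exact key a a' haa ha ha'
  refine ⟨G, hle, hGR, hG, hdom, Submodule.eq_of_le_of_finrank_eq hr ?_⟩
  rw [← hfin, hdom, hR]

/-- The automorphism whose graph is a given injective relation with full domain. -/
theorem Inj.exists_equiv {G : Submodule F (E × E)} (h : Inj G) (hd : dom G = ⊤) :
    ∃ g : E ≃ₗ[F] E, ∀ x, (x, g x) ∈ G := by
  have hsurj : ∀ x, ∃ y, (x, y) ∈ G := fun x => mem_dom.1 (by rw [hd]; trivial)
  choose f hf using hsurj
  let f' : E →ₗ[F] E :=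
    { toFun := f
      map_add' := fun x y => h.eq_right (hf _) (by simpa using G.add_mem (hf x) (hf y))
      map_smul' := fun a x => h.eq_right (hf _) (by simpa using G.smul_mem a (hf x)) }
  have hinj : Function.Injective f' :=
    (injective_iff_map_eq_zero _).2 fun x hx => (h x _ (hf x)).2 hx
  exact ⟨LinearEquiv.ofInjectiveEndo f' hinj, fun x => hf x⟩

end LinRel

namespace LinRel
variable {F E : Type*} [Field F] [AddCommGroup E] [Module F E]

/-- The converse relation. -/
def swap (G : Submodule F (E × E)) : Submodule F (E × E) :=
  G.comap (LinearEquiv.prodComm F E E).toLinearMap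

theorem mem_swap {G : Submodule F (E × E)} {x y : E} : (x, y) ∈ swap G ↔ (y, x) ∈ G := Iff.rfl

/-- The relation preserves the form `B`. -/
def Isom (B : E →ₗ[F] E →ₗ[F] F) (G : Submodule F (E × E)) : Prop :=
  ∀ x x' y y', (x, x') ∈ G → (y, y') ∈ G → B x y = B x' y'

theorem Isom.sup {B : E →ₗ[F] E →ₗ[F] F} (hs : ∀ x y, B x y = B y x)
    {G H : Submodule F (E × E)} (hG : Isom B G) (hH : Isom B H)
    (h : ∀ x x' y y', (x, x') ∈ G → (y, y') ∈ H → B x y = B x' y') : Isom B (G ⊔ H) := by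
  intro x x' y y' hx hy
  obtain ⟨⟨x₁, x₁'⟩, hx₁, ⟨x₂, x₂'⟩, hx₂, hx⟩ := Submodule.mem_sup.1 hx
  obtain ⟨⟨y₁, y₁'⟩, hy₁, ⟨y₂, y₂'⟩, hy₂, hy⟩ := Submodule.mem_sup.1 hy
  obtain ⟨rfl, rfl⟩ : x₁ + x₂ = x ∧ x₁' + x₂' = x' := by simpa using hx
  obtain ⟨rfl, rfl⟩ : y₁ + y₂ = y ∧ y₁' + y₂' = y' := by simpa using hy
  simp only [map_add, LinearMap.add_apply]
  rw [hG _ _ _ _ hx₁ hy₁, hH _ _ _ _ hx₂ hy₂, h _ _ _ _ hx₁ hy₂, hs x₂ y₁, hs x₂' y₁',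
    h _ _ _ _ hy₁ hx₂]

end LinRel

/-- The orthogonal complement of a subspace. -/
def perp {F E : Type*} [Field F] [AddCommGroup E] [Module F E] (B : E →ₗ[F] E →ₗ[F] F)
    (S : Submodule F E) : Submodule F E where
  carrier := {x | ∀ y ∈ S, B x y = 0}
  zero_mem' y _ := by simp
  add_mem' hx hx' y hy := by simp [hx y hy, hx' y hy]
  smul_mem' a x hx y hy := by simp [hx y hy]

theorem mem_perp {F E : Type*} [Field F] [AddCommGroup E] [Module F E] {B : E →ₗ[F] E →ₗ[F] F}
    {S : Submodule F E} {x : E} : x ∈ perp B S ↔ ∀ y ∈ S, B x y = 0 := Iff.rfl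

/-- A symmetric form by which every functional is represented. -/
structure SymForm {F E : Type*} [Field F] [AddCommGroup E] [Module F E]
    (B : E →ₗ[F] E →ₗ[F] F) : Prop where
  symm : ∀ x y, B x y = B y x
  rep : ∀ g : Dual F E, ∃ y, ∀ x, B y x = g x

namespace LinRel
variable {F E : Type*} [Field F] [AddCommGroup E] [Module F E] [FiniteDimensional F E]

/-- **Witt extension** for relations whose domain contains its orthogonal complement. -/
theorem Isom.exists_equiv (h2 : (2 : F) ≠ 0) {B : E →ₗ[F] E →ₗ[F] F} (hB : SymForm B)
    {G₀ : Submodule F (E × E)} (h₀ : Isom B G₀) (hi₀ : Inj G₀) (hp₀ : perp B (dom G₀) ≤ dom G₀) :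
    ∃ g : E ≃ₗ[F] E, (∀ x y, B (g x) (g y) = B x y) ∧ ∀ x y, (x, y) ∈ G₀ → g x = y := by
  obtain ⟨G, ⟨hG, hi⟩, hle, hmax⟩ := exists_maximal (fun G => Isom B G ∧ Inj G) ⟨h₀, hi₀⟩
  have hd : dom G = ⊤ := by
    rw [eq_top_iff]
    rintro x -
    by_contra hx
    have hdle : dom G₀ ≤ dom G := Submodule.map_mono hle
    have hp : perp B (dom G) ≤ dom G := fun y hy =>
      hdle (hp₀ fun z hz => hy z (hdle hz))
    obtain ⟨g, hg0, hg1⟩ := exists_dual_one (dom G) hx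
    obtain ⟨y, hy⟩ := hB.rep g
    have hyp : y ∈ perp B (dom G) := fun z hz => by rw [hy, hg0 z hz]
    have hyx : B x y = 1 := by rw [hB.symm, hy, hg1]
    obtain ⟨y', hyy⟩ := mem_dom.1 (hp hyp)
    obtain ⟨g', hg'⟩ := exists_dual_of_graph
      (G.map ((LinearMap.snd F E E).prod ((B x).comp (LinearMap.fst F E E)))) (by
        rintro s ⟨⟨z, z'⟩, hz, hzs⟩
        obtain ⟨rfl, rfl⟩ : z' = 0 ∧ B x z = s := by simpa using hzs
        rw [(hi _ _ hz).2 rfl, map_zero])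
    obtain ⟨x', hx'⟩ := hB.rep g'
    have hx'G : ∀ z z', (z, z') ∈ G → B x' z' = B x z := fun z z' hz => by
      rw [hx']
      exact hg' z' (B x z) ⟨(z, z'), hz, rfl⟩
    have hy'p : ∀ z z', (z, z') ∈ G → B y' z' = 0 := fun z z' hz => by
      rw [← hG _ _ _ _ hyy hz, hyp z (mem_dom.2 ⟨_, hz⟩)]
    obtain ⟨s, hs⟩ : ∃ s : F, s * 2 = B x x - B x' x' := ⟨_, div_mul_cancel₀ _ h2⟩
    have hx''G : ∀ z z', (z, z') ∈ G → B (x' + s • y') z' = B x z := fun z z' hz => by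
      simp [hx'G z z' hz, hy'p z z' hz]
    have hx'' : B (x' + s • y') (x' + s • y') = B x x := by
      have h1 := hy'p _ _ hyy
      have h2 := hx'G _ _ hyy
      rw [hyx] at h2
      have h3 := hB.symm x' y'
      simp only [map_add, map_smul, LinearMap.add_apply, LinearMap.smul_apply, smul_eq_mul,
        h1, h2, ← h3]
      linear_combination hs
    have hr : x' + s • y' ∉ rng G := fun hr => by
      obtain ⟨z, hz⟩ := mem_rng.1 hr
      have : x - z ∈ perp B (dom G) := fun v hv => by
        obtain ⟨v', hv'⟩ := mem_dom.1 hv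
        rw [map_sub, LinearMap.sub_apply, hG _ _ _ _ hz hv', hx''G _ _ hv', sub_self]
      exact hx ((Submodule.sub_mem_iff_left _ (mem_dom.2 ⟨_, hz⟩)).1 (hp this))
    have := hmax (G ⊔ F ∙ (x, x' + s • y')) ⟨hG.sup hB.symm ?_ ?_, hi.sup_span hx hr⟩ le_sup_left
    · apply hx
      rw [← this]
      exact mem_dom.2 ⟨_, Submodule.mem_sup_right (Submodule.mem_span_singleton_self _)⟩
    · intro a a' b b' ha hb
      obtain ⟨k, hk⟩ := Submodule.mem_span_singleton.1 ha
      obtain ⟨l, hl⟩ := Submodule.mem_span_singleton.1 hb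
      simp only [Prod.smul_mk, Prod.mk.injEq] at hk hl
      obtain ⟨rfl, rfl⟩ := hk
      obtain ⟨rfl, rfl⟩ := hl
      simp only [map_smul, LinearMap.smul_apply, hx'']
    · intro a a' b b' ha hb
      obtain ⟨l, hl⟩ := Submodule.mem_span_singleton.1 hb
      simp only [Prod.smul_mk, Prod.mk.injEq] at hl
      obtain ⟨rfl, rfl⟩ := hl
      rw [map_smul, map_smul, hB.symm a, hB.symm a', hx''G _ _ ha]
  obtain ⟨g, hg⟩ := hi.exists_equiv hd
  exact ⟨g, fun x y => (hG _ _ _ _ (hg x) (hg y)).symm,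
    fun x y hxy => hi.eq_right (hg x) (hle hxy)⟩

end LinRel

/-- A maximal isotropic subspace `U`, an isotropic subspace `W` and an isotropic flag `V₁ ≤ V`,
with a unit vector `e` spanning `U^⊥` modulo `U`. -/
structure Config {F E : Type*} [Field F] [AddCommGroup E] [Module F E]
    (B : E →ₗ[F] E →ₗ[F] F) where
  U : Submodule F E
  W : Submodule F E
  V : Submodule F E
  V₁ : Submodule F E
  e : E
  V₁_le : V₁ ≤ V
  isoU : U ≤ perp B U
  isoW : W ≤ perp B W
  isoV : V ≤ perp B V
  e_mem : e ∈ perp B U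
  ee : B e e = 1
  sub_mem : ∀ x ∈ perp B U, x - B x e • e ∈ U

namespace Config
variable {F E : Type*} [Field F] [AddCommGroup E] [Module F E] {B : E →ₗ[F] E →ₗ[F] F}

theorem form_eq (hB : SymForm B) (K : Config B) {x y : E} (hx : x ∈ perp B K.U)
    (hy : y ∈ perp B K.U) : B x y = B x K.e * B y K.e := by
  have h1 := hy _ (K.sub_mem x hx)
  rw [hB.symm] at h1
  simp only [map_sub, map_smul, LinearMap.sub_apply, LinearMap.smul_apply, smul_eq_mul] at h1
  rw [hB.symm K.e y] at h1
  linear_combination h1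

theorem lam_U (hB : SymForm B) (K : Config B) {x : E} (hx : x ∈ K.U) : B x K.e = 0 := by
  rw [hB.symm]
  exact K.e_mem x hx

theorem mem_U_of_lam (K : Config B) {x : E} (hx : x ∈ perp B K.U) (h : B x K.e = 0) : x ∈ K.U := by
  simpa [h] using K.sub_mem x hx

theorem mem_U_of_self (hB : SymForm B) (K : Config B) {x : E} (hx : x ∈ perp B K.U)
    (h : B x x = 0) : x ∈ K.U := by
  refine K.mem_U_of_lam hx ?_
  rw [K.form_eq hB hx hx] at h
  exact mul_self_eq_zero.1 h

theorem mem_U_of_W (hB : SymForm B) (K : Config B) {x : E} (hx : x ∈ perp B K.U)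
    (hW : x ∈ K.W) : x ∈ K.U := K.mem_U_of_self hB hx (K.isoW hW x hW)

theorem mem_U_of_V (hB : SymForm B) (K : Config B) {x : E} (hx : x ∈ perp B K.U)
    (hV : x ∈ K.V) : x ∈ K.U := K.mem_U_of_self hB hx (K.isoV hV x hV)

theorem exists_sec (K : Config B) : ∃ w : E →ₗ[F] E,
    ∀ c ∈ perp B K.U ⊔ K.W, w c ∈ K.W ∧ c - w c ∈ perp B K.U := by
  let s : (perp B K.U × K.W) →ₗ[F] E := (perp B K.U).subtype.coprod K.W.subtype
  obtain ⟨r, hr⟩ := s.rangeRestrict.exists_rightInverse_of_surjective s.range_rangeRestrict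
  obtain ⟨w, hw⟩ := LinearMap.exists_extend
    (K.W.subtype.comp ((LinearMap.snd F (perp B K.U) K.W).comp r))
  have hwr : ∀ c : LinearMap.range s, w c = (r c).2 := fun c => LinearMap.congr_fun hw c
  refine ⟨w, fun c hc => ?_⟩
  have hcs : c ∈ LinearMap.range s := by
    obtain ⟨x, hx, y, hy, rfl⟩ := Submodule.mem_sup.1 hc
    exact ⟨(⟨x, hx⟩, ⟨y, hy⟩), rfl⟩
  have h1 := hwr ⟨c, hcs⟩
  have h2 : ((r ⟨c, hcs⟩).1 : E) + (r ⟨c, hcs⟩).2 = c :=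
    congrArg Subtype.val (LinearMap.congr_fun hr ⟨c, hcs⟩)
  simp only at h1
  rw [h1]
  refine ⟨(r ⟨c, hcs⟩).2.2, ?_⟩
  have h3 : c - (r ⟨c, hcs⟩).2 = (r ⟨c, hcs⟩).1 := by rw [sub_eq_iff_eq_add, h2]
  rw [h3]
  exact (r ⟨c, hcs⟩).1.2

/-- A linear choice of the `W`-component on `U^⊥ + W`. -/
noncomputable def sec (K : Config B) : E →ₗ[F] E := K.exists_sec.choose

theorem sec_mem (K : Config B) {c : E} (hc : c ∈ perp B K.U ⊔ K.W) : K.sec c ∈ K.W :=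
  (K.exists_sec.choose_spec c hc).1

theorem sub_sec_mem (K : Config B) {c : E} (hc : c ∈ perp B K.U ⊔ K.W) :
    c - K.sec c ∈ perp B K.U := (K.exists_sec.choose_spec c hc).2

/-- The data induced on `V`. -/
noncomputable def data (K : Config B) : VD F K.V where
  V1 := K.V₁.comap K.V.subtype
  P := K.U.comap K.V.subtype
  Q := K.W.comap K.V.subtype
  C := (perp B K.U ⊔ K.W).comap K.V.subtype
  T := (perp B K.W).comap K.V.subtype
  D := (perp B (K.U ⊓ K.W)).comap K.V.subtype
  γ := B.compl₁₂ (K.sec.comp K.V.subtype) K.V.subtype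
  lam := (B.flip K.e).comp ((LinearMap.id - K.sec).comp K.V.subtype)

theorem γ_eq (hB : SymForm B) (K : Config B) {c y : K.V} {w : E} (hw : w ∈ K.W)
    (hcw : c - w ∈ perp B K.U) (hy : y ∈ K.data.D) : K.data.γ c y = B w y := by
  have hc : (c : E) ∈ perp B K.U ⊔ K.W := by
    simpa using Submodule.add_mem_sup hcw hw
  have h1 : w - K.sec c ∈ K.W := K.W.sub_mem hw (K.sec_mem hc)
  have h2 : w - K.sec c ∈ perp B K.U := by
    simpa using (perp B K.U).sub_mem (K.sub_sec_mem hc) hcw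
  have h3 := hy _ ⟨K.mem_U_of_W hB h2 h1, h1⟩
  rw [hB.symm, map_sub, LinearMap.sub_apply] at h3
  exact (sub_eq_zero.1 h3).symm

theorem lam_eq (hB : SymForm B) (K : Config B) {c : K.V} {w : E} (hw : w ∈ K.W)
    (hcw : c - w ∈ perp B K.U) : K.data.lam c = B (c - w) K.e := by
  have hc : (c : E) ∈ perp B K.U ⊔ K.W := by
    simpa using Submodule.add_mem_sup hcw hw
  have h1 : w - K.sec c ∈ K.W := K.W.sub_mem hw (K.sec_mem hc)
  have h2 : w - K.sec c ∈ perp B K.U := by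
    simpa using (perp B K.U).sub_mem (K.sub_sec_mem hc) hcw
  have h3 := K.lam_U hB (K.mem_U_of_W hB h2 h1)
  have h4 : K.data.lam c = B (c - K.sec c) K.e := rfl
  rw [h4]
  simp only [map_sub, LinearMap.sub_apply] at h3 ⊢
  linear_combination h3

theorem data_ax (hB : SymForm B) (K : Config B) : K.data.Ax where
  PC x hx := Submodule.mem_sup_left (K.isoU hx)
  QC x hx := Submodule.mem_sup_right hx
  CD x hx n hn := by
    obtain ⟨f, hf, w, hw, hfw⟩ := Submodule.mem_sup.1 hx
    rw [← hfw, map_add, LinearMap.add_apply, hf n hn.1, K.isoW hw n hn.2, add_zero]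
  TD x hx n hn := hx n hn.2
  QT x hx := K.isoW hx
  gP x hx y hy := by
    rw [K.γ_eq hB (w := 0) K.W.zero_mem (by simpa using K.isoU hx) hy]
    simp
  gQ x hx y hy := by
    rw [K.γ_eq hB (w := x) hx (by simp) hy]
    exact K.isoV x.2 y y.2
  gCP x hx y hy := by
    have h1 := K.sub_sec_mem hx y hy
    rw [map_sub, LinearMap.sub_apply] at h1
    have h2 : B x y = 0 := K.isoV x.2 y y.2
    have h3 : K.data.γ x y = B (K.sec x) y := rfl
    rw [h3]
    simp only [Submodule.subtype_apply] at h1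
    linear_combination h2 - h1
  gCT x hx y hy := by
    have h3 : K.data.γ x y = B (K.sec x) y := rfl
    rw [h3, hB.symm]
    exact hy _ (K.sec_mem hx)
  sym x hx y hy := by
    have h1 : K.data.γ x y = B (K.sec x) y := rfl
    have h2 : K.data.γ y x = B (K.sec y) x := rfl
    have h3 : K.data.lam x = B (x - K.sec x) K.e := rfl
    have h4 : K.data.lam y = B (y - K.sec y) K.e := rfl
    rw [h1, h2, h3, h4]
    have h5 := K.form_eq hB (K.sub_sec_mem hx) (K.sub_sec_mem hy)
    have h6 : B x y = 0 := K.isoV x.2 y y.2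
    have h7 := K.isoW (K.sec_mem hx) _ (K.sec_mem hy)
    simp only [Submodule.subtype_apply] at h5 h7
    rw [← h5]
    simp only [map_sub, LinearMap.sub_apply]
    rw [h6, h7, hB.symm x]
    ring

end Config

theorem VD.Iso.symm {F V V' : Type*} [Field F] [AddCommGroup V] [Module F V] [AddCommGroup V']
    [Module F V'] {d : VD F V} {d' : VD F V'} {φ : V ≃ₗ[F] V'} (h : d.Iso d' φ) :
    d'.Iso d φ.symm where
  V1 x := by rw [h.V1, φ.apply_symm_apply]
  P x := by rw [h.P, φ.apply_symm_apply]
  Q x := by rw [h.Q, φ.apply_symm_apply]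
  C x := by rw [h.C, φ.apply_symm_apply]
  T x := by rw [h.T, φ.apply_symm_apply]
  D x := by rw [h.D, φ.apply_symm_apply]
  γ x hx y hy := by
    rw [← h.γ _ (by rwa [h.C, φ.apply_symm_apply]) _ (by rwa [h.D, φ.apply_symm_apply]),
      φ.apply_symm_apply, φ.apply_symm_apply]
  lam x hx := by
    rw [← h.lam _ (by rwa [h.C, φ.apply_symm_apply]), φ.apply_symm_apply]

namespace Config
open LinRel
variable {F E : Type*} [Field F] [AddCommGroup E] [Module F E] {B : E →ₗ[F] E →ₗ[F] F}

/-- The graph of a linear equivalence between the `V`-parts. -/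
def graphV {K K' : Config B} (φ : K.V ≃ₗ[F] K'.V) : Submodule F (E × E) :=
  LinearMap.range (K.V.subtype.prod (K'.V.subtype.comp φ.toLinearMap))

theorem mem_graphV {K K' : Config B} {φ : K.V ≃ₗ[F] K'.V} {x y : E} :
    (x, y) ∈ graphV φ ↔ ∃ v : K.V, v = x ∧ φ v = y := by
  simp [graphV]

/-- Pairs in `W × W'` having the same pairings with `V` and `V'`. -/
def relW {K K' : Config B} (φ : K.V ≃ₗ[F] K'.V) : Submodule F (E × E) where
  carrier := {p | p.1 ∈ K.W ∧ p.2 ∈ K'.W ∧ ∀ v : K.V, B p.1 v = B p.2 (φ v)}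
  zero_mem' := ⟨K.W.zero_mem, K'.W.zero_mem, fun v => by simp⟩
  add_mem' hp hq := ⟨K.W.add_mem hp.1 hq.1, K'.W.add_mem hp.2.1 hq.2.1, fun v => by
    simp [hp.2.2 v, hq.2.2 v]⟩
  smul_mem' a _ hp := ⟨K.W.smul_mem a hp.1, K'.W.smul_mem a hp.2.1, fun v => by
    simp [hp.2.2 v]⟩

/-- Pairs which are moreover congruent to corresponding vectors of `V` and `V'` modulo `U^⊥`. -/
def relC {K K' : Config B} (φ : K.V ≃ₗ[F] K'.V) : Submodule F (E × E) where
  carrier := {p | p ∈ relW φ ∧ ∃ c : K.V, p.1 - c ∈ perp B K.U ∧ p.2 - φ c ∈ perp B K'.U ∧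
    B (p.1 - c) K.e = B (p.2 - φ c) K'.e}
  zero_mem' := ⟨Submodule.zero_mem _, 0, by simp⟩
  add_mem' := by
    rintro p q ⟨hp, c, h1, h2, h3⟩ ⟨hq, c', h1', h2', h3'⟩
    refine ⟨Submodule.add_mem _ hp hq, c + c', ?_, ?_, ?_⟩
    · have := Submodule.add_mem _ h1 h1'
      rwa [← add_sub_add_comm] at this
    · have := Submodule.add_mem _ h2 h2'
      rwa [← add_sub_add_comm, ← Submodule.coe_add, ← map_add] at this
    · simp only [map_sub, LinearMap.sub_apply, Prod.fst_add, Prod.snd_add, map_add,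
        LinearMap.add_apply, Submodule.coe_add] at h3 h3' ⊢
      linear_combination h3 + h3'
  smul_mem' := by
    rintro a p ⟨hp, c, h1, h2, h3⟩
    refine ⟨Submodule.smul_mem _ a hp, a • c, ?_, ?_, ?_⟩
    · have := Submodule.smul_mem _ a h1
      rwa [smul_sub] at this
    · have := Submodule.smul_mem _ a h2
      rwa [smul_sub, ← Submodule.coe_smul, ← map_smul] at this
    · simp only [map_sub, LinearMap.sub_apply, Prod.smul_fst, Prod.smul_snd, map_smul,
        LinearMap.smul_apply, Submodule.coe_smul, smul_eq_mul] at h3 ⊢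
      linear_combination a * h3

variable {K K' : Config B} {φ : K.V ≃ₗ[F] K'.V}

theorem mem_relW_symm {x y : E} (h : (x, y) ∈ relW φ) : (y, x) ∈ relW φ.symm :=
  ⟨h.2.1, h.1, fun v => by rw [h.2.2, φ.apply_symm_apply]⟩

theorem mem_relC_symm {x y : E} (h : (x, y) ∈ relC φ) : (y, x) ∈ relC φ.symm := by
  obtain ⟨h, c, h1, h2, h3⟩ := h
  refine ⟨mem_relW_symm h, φ c, h2, ?_, ?_⟩
  · rwa [φ.symm_apply_apply]
  · rw [φ.symm_apply_apply, h3]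

theorem rng_relW (φ : K.V ≃ₗ[F] K'.V) : rng (relW φ) = dom (relW φ.symm) := by
  ext x
  rw [mem_rng, mem_dom]
  exact exists_congr fun y => ⟨mem_relW_symm, mem_relW_symm⟩

theorem rng_relC (φ : K.V ≃ₗ[F] K'.V) : rng (relC φ) = dom (relC φ.symm) := by
  ext x
  rw [mem_rng, mem_dom]
  exact exists_congr fun y => ⟨mem_relC_symm, mem_relC_symm⟩

theorem mem_relC_iff (hB : SymForm B) (h : K.data.Iso K'.data φ) {w w' : E}
    (hw : (w, w') ∈ relC φ) (v : K.V) : v + w ∈ perp B K.U ↔ φ v + w' ∈ perp B K'.U := by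
  obtain ⟨-, c, h1, h2, -⟩ := hw
  have e1 : (v : E) + w = (v + c : K.V) + (w - c) := by push_cast; abel
  have e2 : (φ v : E) + w' = (φ (v + c) : K'.V) + (w' - φ c) := by push_cast [map_add]; abel
  rw [e1, e2, Submodule.add_mem_iff_left _ h1, Submodule.add_mem_iff_left _ h2]
  have h3 := h.P (v + c)
  exact ⟨fun hx => K'.isoU (h3.1 (K.mem_U_of_V hB hx (v + c).2)),
    fun hx => K.isoU (h3.2 (K'.mem_U_of_V hB hx (φ (v + c)).2))⟩

theorem relC_lam (hB : SymForm B) (h : K.data.Iso K'.data φ) {w w' : E}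
    (hw : (w, w') ∈ relC φ) (v : K.V) (hv : v + w ∈ perp B K.U) :
    B (v + w) K.e = B (φ v + w') K'.e := by
  obtain ⟨-, c, h1, h2, h3⟩ := hw
  have e1 : (v : E) + w = (v + c : K.V) + (w - c) := by push_cast; abel
  have e2 : (φ v : E) + w' = (φ (v + c) : K'.V) + (w' - φ c) := by push_cast [map_add]; abel
  rw [e1, Submodule.add_mem_iff_left _ h1] at hv
  have h4 := K.mem_U_of_V hB hv (v + c).2
  have h5 : (φ (v + c) : E) ∈ K'.U := (h.P (v + c)).1 h4
  rw [e1, e2, map_add, map_add, LinearMap.add_apply, LinearMap.add_apply, h3, K.lam_U hB h4,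
    K'.lam_U hB h5]

variable [FiniteDimensional F E]

theorem dom_relW (hB : SymForm B) (h : K.data.Iso K'.data φ) : dom (relW φ) = K.W := by
  ext w
  rw [mem_dom]
  refine ⟨fun ⟨y, hy⟩ => hy.1, fun hw => ?_⟩
  obtain ⟨y, hy, hyw⟩ := exists_mem_pairing_eq (B.comp (K'.V.subtype.comp φ.toLinearMap)) ⊤ K'.W
    ((B w).comp K.V.subtype) (fun v _ hv => by
      have h1 : v ∈ K.data.T := (h.T v).2 hv
      simp only [LinearMap.comp_apply]
      rw [hB.symm]
      exact h1 w hw)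
  refine ⟨y, hw, hy, fun v => ?_⟩
  rw [hB.symm y]
  exact (hyw v trivial).symm

theorem dom_relC (hB : SymForm B) (h : K.data.Iso K'.data φ) :
    dom (relC φ) = K.W ⊓ (K.V ⊔ perp B K.U) := by
  ext w
  rw [mem_dom]
  constructor
  · rintro ⟨y, hy, c, hc, -⟩
    refine ⟨hy.1, ?_⟩
    simpa using Submodule.add_mem_sup c.2 hc
  · rintro ⟨hw, hV⟩
    obtain ⟨c, hcV, p, hp, hcp⟩ := Submodule.mem_sup.1 hV
    lift c to K.V using hcV
    have hwc : w - c ∈ perp B K.U := by rwa [← hcp, add_sub_cancel_left]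
    have hcw : c - w ∈ perp B K.U := by
      rw [← neg_sub]
      exact Submodule.neg_mem _ hwc
    have hcC : c ∈ K.data.C := by
      have := Submodule.add_mem_sup hcw hw
      rwa [sub_add_cancel] at this
    have hcC' := (h.C c).1 hcC
    set w₀ := K'.sec (φ c) with hw₀
    have hw₀W : w₀ ∈ K'.W := K'.sec_mem hcC'
    have hw₀c : φ c - w₀ ∈ perp B K'.U := K'.sub_sec_mem hcC'
    obtain ⟨n, hn, hnv⟩ := exists_mem_pairing_eq (B.comp (K'.V.subtype.comp φ.toLinearMap)) ⊤
      (K'.U ⊓ K'.W) ((B w).comp K.V.subtype - (B w₀).comp (K'.V.subtype.comp φ.toLinearMap))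
      (fun v _ hv => by
        have h1 : v ∈ K.data.D := (h.D v).2 hv
        have h2 := h.γ c hcC v h1
        rw [K.γ_eq hB hw hcw h1, K'.γ_eq hB hw₀W hw₀c ((h.D v).1 h1)] at h2
        simp [h2])
    have hnU := hn.1
    have hw₀c' : w₀ + n - φ c ∈ perp B K'.U := by
      have := Submodule.sub_mem _ (K'.isoU hnU) hw₀c
      convert this using 1
      abel
    refine ⟨w₀ + n, ⟨hw, Submodule.add_mem _ hw₀W hn.2, fun v => ?_⟩, c, hwc, hw₀c', ?_⟩
    · have := hnv v trivial
      simp only [LinearMap.comp_apply, LinearMap.sub_apply, Submodule.subtype_apply,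
        LinearEquiv.coe_coe] at this
      rw [map_add, LinearMap.add_apply, hB.symm n, this]
      ring
    · have h1 := h.lam c hcC
      rw [K.lam_eq hB hw hcw, K'.lam_eq hB hw₀W hw₀c] at h1
      have h2 := K'.lam_U hB hnU
      simp only [map_sub, map_add, LinearMap.sub_apply, LinearMap.add_apply] at h1 ⊢
      linear_combination h1 - h2

/-- The isomorphism of the `V`-parts extends to `V + W`, compatibly with `U^⊥`. -/
theorem exists_relF (hB : SymForm B) (h : K.data.Iso K'.data φ)
    (hW : finrank F K.W = finrank F K'.W)
    (hC : finrank F ↥(K.W ⊓ (K.V ⊔ perp B K.U)) = finrank F ↥(K'.W ⊓ (K'.V ⊔ perp B K'.U))) :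
    ∃ G : Submodule F (E × E), Inj G ∧ Isom B G ∧ (∀ v : K.V, ((v : E), (φ v : E)) ∈ G) ∧
      (∀ w ∈ K.W, ∃ w' ∈ K'.W, (w, w') ∈ G) ∧
      ∀ x y, (x, y) ∈ G → (x ∈ perp B K.U ↔ y ∈ perp B K'.U) ∧
        (x ∈ perp B K.U → B x K.e = B y K'.e) := by
  let G₀ : Submodule F (E × E) := graphV φ ⊓ K.W.comap (LinearMap.fst F E E)
  have hQ : ∀ v : K.V, (v : E) ∈ K.W ↔ (φ v : E) ∈ K'.W := h.Q
  have hG₀ : ∀ v : K.V, (v : E) ∈ K.W → ((v : E), (φ v : E)) ∈ G₀ := fun v hv =>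
    ⟨mem_graphV.2 ⟨v, rfl, rfl⟩, hv⟩
  have hG₀C : G₀ ≤ relC φ := by
    rintro ⟨x, y⟩ ⟨hxy, hx⟩
    obtain ⟨v, rfl, rfl⟩ := mem_graphV.1 hxy
    refine ⟨⟨hx, (hQ v).1 hx, fun u => ?_⟩, v, ?_⟩
    · exact (K.isoV v.2 u u.2).trans (K'.isoV (φ v).2 _ (φ u).2).symm
    · simp
  have hG₀i : Inj G₀ := by
    rintro x y ⟨hxy, hx⟩
    obtain ⟨v, rfl, rfl⟩ := mem_graphV.1 hxy
    simp
  obtain ⟨G₁, h01, h1C, h1i, h1d, h1r⟩ := exists_extend hG₀C hG₀i (by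
    rw [rng_relC, dom_relC hB h, dom_relC hB h.symm, hC])
  have hCW : relC φ ≤ relW φ := fun p hp => hp.1
  obtain ⟨G₂, h12, h2W, h2i, h2d, h2r⟩ := exists_extend (h1C.trans hCW) h1i (by
    rw [rng_relW, dom_relW hB h, dom_relW hB h.symm, hW])
  rw [dom_relC hB h] at h1d
  rw [rng_relC, dom_relC hB h.symm] at h1r
  rw [dom_relW hB h] at h2d
  have hmem : ∀ x y, (x, y) ∈ graphV φ ⊔ G₂ →
      ∃ v : K.V, ∃ w w', (w, w') ∈ G₂ ∧ x = v + w ∧ y = φ v + w' := by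
    intro x y hxy
    obtain ⟨⟨x₁, y₁⟩, h1, ⟨w, w'⟩, h2, hsum⟩ := Submodule.mem_sup.1 hxy
    obtain ⟨v, rfl, rfl⟩ := mem_graphV.1 h1
    simp only [Prod.mk_add_mk, Prod.mk.injEq] at hsum
    exact ⟨v, w, w', h2, hsum.1.symm, hsum.2.symm⟩
  refine ⟨graphV φ ⊔ G₂, ?_, ?_, fun v => Submodule.mem_sup_left (mem_graphV.2 ⟨v, rfl, rfl⟩),
    fun w hw => ?_, ?_⟩
  · intro x y hxy
    obtain ⟨v, w, w', hw, rfl, rfl⟩ := hmem x y hxy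
    have hwW := h2W hw
    constructor <;> intro h0
    · have e : w = (-v : K.V) := by
        push_cast
        exact (neg_eq_of_add_eq_zero_right h0).symm
      have h4 : (w, (φ (-v) : E)) ∈ G₂ := by
        have := h12 (h01 (hG₀ (-v) (e ▸ hwW.1)))
        rwa [← e] at this
      rw [h2i.eq_right hw h4]
      simp
    · have e : w' = (φ (-v) : K'.V) := by
        rw [map_neg]
        push_cast
        exact (neg_eq_of_add_eq_zero_right h0).symm
      have h4 : (((-v : K.V) : E), w') ∈ G₂ := by
        have := h12 (h01 (hG₀ (-v) ((hQ _).2 (e ▸ hwW.2.1))))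
        rwa [← e] at this
      rw [h2i.eq_left hw h4]
      simp
  · refine Isom.sup hB.symm ?_ ?_ ?_
    · intro x x' y y' hx hy
      obtain ⟨v, rfl, rfl⟩ := mem_graphV.1 hx
      obtain ⟨u, rfl, rfl⟩ := mem_graphV.1 hy
      exact (K.isoV v.2 u u.2).trans (K'.isoV (φ v).2 _ (φ u).2).symm
    · intro x x' y y' hx hy
      exact (K.isoW (h2W hx).1 _ (h2W hy).1).trans (K'.isoW (h2W hx).2.1 _ (h2W hy).2.1).symm
    · intro x x' y y' hx hy
      obtain ⟨v, rfl, rfl⟩ := mem_graphV.1 hx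
      rw [hB.symm _ y, hB.symm _ y']
      exact (h2W hy).2.2 v
  · obtain ⟨w', hw'⟩ := mem_dom.1 (h2d ▸ hw)
    exact ⟨w', (h2W hw').2.1, Submodule.mem_sup_right hw'⟩
  · intro x y hxy
    obtain ⟨v, w, w', hw, rfl, rfl⟩ := hmem x y hxy
    have hwW := h2W hw
    have key : v + w ∈ perp B K.U ∨ φ v + w' ∈ perp B K'.U → (w, w') ∈ relC φ := by
      rintro (h0 | h0)
      · have : w ∈ K.W ⊓ (K.V ⊔ perp B K.U) := by
          refine ⟨hwW.1, ?_⟩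
          have := Submodule.add_mem_sup (K.V.neg_mem v.2) h0
          simpa using this
        rw [← h1d] at this
        obtain ⟨w'', hw''⟩ := mem_dom.1 this
        rw [h2i.eq_right hw (h12 hw'')]
        exact h1C hw''
      · have : w' ∈ K'.W ⊓ (K'.V ⊔ perp B K'.U) := by
          refine ⟨hwW.2.1, ?_⟩
          have := Submodule.add_mem_sup (K'.V.neg_mem (φ v).2) h0
          simpa using this
        rw [← h1r] at this
        obtain ⟨w'', hw''⟩ := mem_rng.1 this
        rw [h2i.eq_left hw (h12 hw'')]
        exact h1C hw''
    exact ⟨⟨fun h0 => (mem_relC_iff hB h (key (Or.inl h0)) v).1 h0,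
      fun h0 => (mem_relC_iff hB h (key (Or.inr h0)) v).2 h0⟩,
      fun h0 => relC_lam hB h (key (Or.inl h0)) v h0⟩

end Config

namespace Config
open LinRel
variable {F E : Type*} [Field F] [AddCommGroup E] [Module F E] {B : E →ₗ[F] E →ₗ[F] F}

/-- The relation respects `U^⊥` and its functional modulo `U`. -/
def Compat (K K' : Config B) (G : Submodule F (E × E)) : Prop :=
  ∀ x y, (x, y) ∈ G → (x ∈ perp B K.U ↔ y ∈ perp B K'.U) ∧
    (x ∈ perp B K.U → B x K.e = B y K'.e)

theorem Compat.swap {K K' : Config B} {G : Submodule F (E × E)} (h : Compat K K' G) :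
    Compat K' K (swap G) := fun x y hxy =>
  ⟨(h y x hxy).1.symm, fun hx => ((h y x hxy).2 ((h y x hxy).1.2 hx)).symm⟩

/-- Pairs in `U^⊥ × U'^⊥` that are compatible with the relation `G`. -/
def relU (K K' : Config B) (G : Submodule F (E × E)) : Submodule F (E × E) where
  carrier := {p | p.1 ∈ perp B K.U ∧ p.2 ∈ perp B K'.U ∧ B p.1 K.e = B p.2 K'.e ∧
    ∀ q ∈ G, B p.1 q.1 = B p.2 q.2}
  zero_mem' := ⟨Submodule.zero_mem _, Submodule.zero_mem _, by simp, by simp⟩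
  add_mem' hp hq := ⟨Submodule.add_mem _ hp.1 hq.1, Submodule.add_mem _ hp.2.1 hq.2.1,
    by simp [hp.2.2.1, hq.2.2.1], fun r hr => by simp [hp.2.2.2 r hr, hq.2.2.2 r hr]⟩
  smul_mem' a _ hp := ⟨Submodule.smul_mem _ a hp.1, Submodule.smul_mem _ a hp.2.1,
    by simp [hp.2.2.1], fun r hr => by simp [hp.2.2.2 r hr]⟩

variable {K K' : Config B} {G : Submodule F (E × E)}

theorem mem_relU {x y : E} : (x, y) ∈ relU K K' G ↔ x ∈ perp B K.U ∧ y ∈ perp B K'.U ∧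
    B x K.e = B y K'.e ∧ ∀ f f', (f, f') ∈ G → B x f = B y f' :=
  ⟨fun h => ⟨h.1, h.2.1, h.2.2.1, fun f f' hf => h.2.2.2 (f, f') hf⟩,
    fun h => ⟨h.1, h.2.1, h.2.2.1, fun q hq => h.2.2.2 q.1 q.2 hq⟩⟩

theorem rng_relU : rng (relU K K' G) = dom (relU K' K (swap G)) := by
  ext x
  simp only [mem_rng, mem_dom, mem_relU, mem_swap]
  refine exists_congr fun y => ⟨fun h => ?_, fun h => ?_⟩
  · exact ⟨h.2.1, h.1, h.2.2.1.symm, fun f f' hf => (h.2.2.2 f' f hf).symm⟩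
  · exact ⟨h.2.1, h.1, h.2.2.1.symm, fun f f' hf => (h.2.2.2 f' f hf).symm⟩

theorem dom_relU (hB : SymForm B) (hG : Compat K K' G) : dom (relU K K' G) = perp B K.U := by
  ext x
  rw [mem_dom]
  refine ⟨fun ⟨y, hy⟩ => hy.1, fun hx => ?_⟩
  obtain ⟨g, hg⟩ := exists_dual_of_graph
    (K'.U.map (LinearMap.inl F E F) ⊔ F ∙ (K'.e, B x K.e) ⊔
      G.map ((LinearMap.snd F E E).prod ((B x).comp (LinearMap.fst F E E)))) (by
      intro s hs
      obtain ⟨_, h1, _, ⟨⟨f, f'⟩, hf, rfl⟩, hsum⟩ := Submodule.mem_sup.1 hs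
      obtain ⟨_, ⟨u, hu, rfl⟩, _, h2, rfl⟩ := Submodule.mem_sup.1 h1
      obtain ⟨a, rfl⟩ := Submodule.mem_span_singleton.1 h2
      have e1 : u + a • K'.e + f' = 0 := by simpa using congrArg Prod.fst hsum
      have e2 : a * B x K.e + B x f = s := by simpa using congrArg Prod.snd hsum
      have e3 : f' = -(u + a • K'.e) := (neg_eq_of_add_eq_zero_right e1).symm
      have hf' : f' ∈ perp B K'.U := by
        rw [e3]
        exact Submodule.neg_mem _
          (Submodule.add_mem _ (K'.isoU hu) (Submodule.smul_mem _ a K'.e_mem))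
      obtain ⟨h3, h4⟩ := hG f f' hf
      have hfU := h3.2 hf'
      have h5 := h4 hfU
      have h6 := K'.lam_U hB hu
      have h7 := K.form_eq hB hx hfU
      rw [e3] at h5
      simp only [map_neg, map_add, map_smul, LinearMap.neg_apply, LinearMap.add_apply,
        LinearMap.smul_apply, smul_eq_mul, K'.ee, h6] at h5
      rw [← e2, h7, h5]
      ring)
  obtain ⟨y, hy⟩ := hB.rep g
  refine ⟨y, mem_relU.2 ⟨hx, fun u hu => ?_, ?_, fun f f' hf => ?_⟩⟩
  · rw [hy]
    exact hg u 0 (Submodule.mem_sup_left (Submodule.mem_sup_left ⟨u, hu, rfl⟩))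
  · rw [hy]
    exact (hg _ _ (Submodule.mem_sup_left (Submodule.mem_sup_right
      (Submodule.mem_span_singleton_self _)))).symm
  · rw [hy]
    exact (hg f' (B x f) (Submodule.mem_sup_right ⟨(f, f'), hf, rfl⟩)).symm

variable [FiniteDimensional F E]

/-- A compatible partial isometry extends to an isometry of the whole space carrying `U` to `U'`. -/
theorem exists_isometry (h2 : (2 : F) ≠ 0) (hB : SymForm B) (hi : Inj G) (hG : Isom B G)
    (hc : Compat K K' G) (hU : finrank F K.U = finrank F K'.U)
    (hp : finrank F (perp B K.U) = finrank F (perp B K'.U)) :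
    ∃ g : E ≃ₗ[F] E, (∀ x y, B (g x) (g y) = B x y) ∧ (∀ x y, (x, y) ∈ G → g x = y) ∧
      K.U.map g.toLinearMap = K'.U := by
  let G₀ : Submodule F (E × E) := G ⊓ (perp B K.U).comap (LinearMap.fst F E E)
  have h₀ : G₀ ≤ relU K K' G := by
    rintro ⟨x, y⟩ ⟨hxy, hx⟩
    obtain ⟨h1, h3⟩ := hc x y hxy
    exact mem_relU.2 ⟨hx, h1.1 hx, h3 hx, fun f f' hf => hG _ _ _ _ hxy hf⟩
  obtain ⟨G₃, h03, h3U, h3i, h3d, -⟩ := exists_extend h₀ (fun x y hxy => hi x y hxy.1) (by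
    rw [rng_relU, dom_relU hB hc, dom_relU hB hc.swap, hp])
  rw [dom_relU hB hc] at h3d
  have hI : Isom B (G ⊔ G₃) := by
    refine hG.sup hB.symm ?_ ?_
    · intro x x' y y' hx hy
      have hx := mem_relU.1 (h3U hx)
      have hy := mem_relU.1 (h3U hy)
      rw [K.form_eq hB hx.1 hy.1, K'.form_eq hB hx.2.1 hy.2.1, hx.2.2.1, hy.2.2.1]
    · intro x x' y y' hx hy
      rw [hB.symm x, hB.symm x']
      exact (mem_relU.1 (h3U hy)).2.2.2 _ _ hx
  have hII : Inj (G ⊔ G₃) := by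
    intro x y hxy
    obtain ⟨⟨f, f'⟩, hf, ⟨z, z'⟩, hz, hsum⟩ := Submodule.mem_sup.1 hxy
    obtain ⟨rfl, rfl⟩ : f + z = x ∧ f' + z' = y := by simpa using hsum
    have hzU := mem_relU.1 (h3U hz)
    have hz' := G₃.neg_mem hz
    constructor <;> intro h0
    · have e : f = -z := eq_neg_of_add_eq_zero_left h0
      have h4 : (f, f') ∈ G₃ := h03 ⟨hf, by
        change f ∈ perp B K.U
        rw [e]
        exact Submodule.neg_mem _ hzU.1⟩
      rw [e] at h4
      rw [h3i.eq_right h4 hz', neg_add_cancel]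
    · have e : f' = -z' := eq_neg_of_add_eq_zero_left h0
      have h4 : (f, f') ∈ G₃ := h03 ⟨hf, (hc f f' hf).1.2 (by
        rw [e]
        exact Submodule.neg_mem _ hzU.2.1)⟩
      rw [e] at h4
      rw [h3i.eq_left h4 hz', neg_add_cancel]
  have hd : perp B K.U ≤ dom (G ⊔ G₃) := by
    rw [← h3d]
    exact Submodule.map_mono le_sup_right
  obtain ⟨g, hg, hgG⟩ := hI.exists_equiv h2 hB hII
    (fun x hx => hd fun u hu => hx u (hd (K.isoU hu)))
  refine ⟨g, hg, fun x y hxy => hgG x y (Submodule.mem_sup_left hxy), ?_⟩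
  refine Submodule.eq_of_le_of_finrank_eq ?_ ?_
  · rintro _ ⟨u, hu, rfl⟩
    obtain ⟨u', hu'⟩ := mem_dom.1 (h3d ▸ K.isoU hu)
    have h5 := mem_relU.1 (h3U hu')
    have h6 : g u = u' := hgG _ _ (Submodule.mem_sup_right hu')
    change g u ∈ K'.U
    rw [h6]
    exact K'.mem_U_of_lam h5.2.1 (by rw [← h5.2.2.1, K.lam_U hB hu])
  · rw [LinearEquiv.finrank_map_eq, hU]

/-- Configurations with isomorphic data and equal dimensions are equivalent. -/
theorem exists_isometry_of_iso (h2 : (2 : F) ≠ 0) (hB : SymForm B) {φ : K.V ≃ₗ[F] K'.V}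
    (h : K.data.Iso K'.data φ) (hU : finrank F K.U = finrank F K'.U)
    (hp : finrank F (perp B K.U) = finrank F (perp B K'.U))
    (hW : finrank F K.W = finrank F K'.W)
    (hC : finrank F ↥(K.W ⊓ (K.V ⊔ perp B K.U)) = finrank F ↥(K'.W ⊓ (K'.V ⊔ perp B K'.U))) :
    ∃ g : E ≃ₗ[F] E, (∀ x y, B (g x) (g y) = B x y) ∧ K.U.map g.toLinearMap = K'.U ∧
      K.W.map g.toLinearMap = K'.W ∧ K.V.map g.toLinearMap = K'.V ∧
      K.V₁.map g.toLinearMap = K'.V₁ := by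
  obtain ⟨G, hi, hG, hV, hGW, hc⟩ := exists_relF hB h hW hC
  obtain ⟨g, hg, hgG, hgU⟩ := exists_isometry h2 hB hi hG hc hU hp
  have hgV : ∀ v : K.V, g v = φ v := fun v => hgG _ _ (hV v)
  refine ⟨g, hg, hgU, Submodule.eq_of_le_of_finrank_eq ?_ ?_, ?_, ?_⟩
  · rintro _ ⟨w, hw, rfl⟩
    obtain ⟨w', hw', hww⟩ := hGW w hw
    exact (hgG _ _ hww).symm ▸ hw'
  · rw [LinearEquiv.finrank_map_eq, hW]
  · refine le_antisymm ?_ ?_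
    · rintro _ ⟨v, hv, rfl⟩
      exact (hgV ⟨v, hv⟩).symm ▸ (φ ⟨v, hv⟩).2
    · intro v hv
      exact ⟨φ.symm ⟨v, hv⟩, (φ.symm ⟨v, hv⟩).2, by simp [hgV]⟩
  · refine le_antisymm ?_ ?_
    · rintro _ ⟨v, hv, rfl⟩
      exact (hgV ⟨v, K.V₁_le hv⟩).symm ▸ (h.V1 ⟨v, K.V₁_le hv⟩).1 hv
    · intro v hv
      refine ⟨φ.symm ⟨v, K'.V₁_le hv⟩, (h.V1 _).2 ?_, by simp [hgV]⟩
      rw [φ.apply_symm_apply]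
      exact hv

end Config

theorem finrank_perp {F E : Type*} [Field F] [AddCommGroup E] [Module F E]
    [FiniteDimensional F E] {B : E →ₗ[F] E →ₗ[F] F} (hB : SymForm B) (S : Submodule F E) :
    finrank F S + finrank F (perp B S) = finrank F E := by
  let f : E →ₗ[F] Dual F S := (Submodule.dualRestrict S).comp B
  have hf : LinearMap.range f = ⊤ := by
    rw [LinearMap.range_eq_top]
    intro g
    obtain ⟨g', hg'⟩ := LinearMap.exists_extend g
    obtain ⟨y, hy⟩ := hB.rep g'
    refine ⟨y, LinearMap.ext fun s => ?_⟩
    rw [← hg']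
    exact hy s
  have hk : LinearMap.ker f = perp B S := by
    ext x
    rw [LinearMap.mem_ker, mem_perp]
    exact ⟨fun h y hy => LinearMap.congr_fun h ⟨y, hy⟩, fun h => LinearMap.ext fun s => h s s.2⟩
  rw [← f.finrank_range_add_finrank_ker, hk, hf, finrank_top, Subspace.dual_finrank_eq]

section
variable (F : Type*) [Field F] (N : ℕ)

/-- The form `bform` as a bilinear map. -/
def bilForm : (Fin N → F) →ₗ[F] (Fin N → F) →ₗ[F] F :=
  LinearMap.mk₂ F (bform F N)
    (fun x y z => by simp [bform, add_mul, Finset.sum_add_distrib])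
    (fun a x y => by simp [bform, Finset.mul_sum, mul_assoc])
    (fun x y z => by simp [bform, mul_add, Finset.sum_add_distrib])
    (fun a x y => by simp [bform, Finset.mul_sum, mul_left_comm])

theorem bilForm_apply (x y : Fin N → F) : bilForm F N x y = ∑ i, x i * y i.rev := rfl

theorem bilForm_single (x : Fin N → F) (i : Fin N) :
    bilForm F N x (Pi.single i.rev 1) = x i := by
  rw [bilForm_apply, Finset.sum_eq_single i]
  · simp
  · intro j _ hj
    rw [Pi.single_eq_of_ne, mul_zero]
    simpa using hj
  · simp

theorem symForm_bilForm : SymForm (bilForm F N) where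
  symm x y := by
    rw [bilForm_apply, bilForm_apply, ← Equiv.sum_comp Fin.revPerm]
    refine Finset.sum_congr rfl fun i _ => ?_
    simp [mul_comm]
  rep g := by
    refine ⟨fun i => g (Pi.single i.rev 1), fun x => ?_⟩
    rw [bilForm_apply, ← Equiv.sum_comp Fin.revPerm]
    conv_rhs => rw [← Finset.univ_sum_single x, map_sum]
    refine Finset.sum_congr rfl fun i _ => ?_
    have : (Pi.single i (x i) : Fin N → F) = x i • Pi.single i 1 := by
      rw [← Pi.single_smul, smul_eq_mul, mul_one]
    simp [this, mul_comm]

end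

section
variable {F : Type*} [Field F] {n : ℕ}

theorem finrank_le_of_isotropic {S : Submodule F (Fin (2 * n + 1) → F)}
    (hS : S ≤ perp (bilForm F (2 * n + 1)) S) : finrank F S ≤ n := by
  have h1 := finrank_perp (symForm_bilForm F (2 * n + 1)) S
  have h2 := Submodule.finrank_mono hS
  rw [finrank_fin_fun] at h1
  omega

/-- The span of the first half of the standard basis. -/
def stdIsotropic (F : Type*) [Field F] (n : ℕ) : Submodule F (Fin (2 * n + 1) → F) where
  carrier := {x | ∀ i : Fin (2 * n + 1), n ≤ i → x i = 0}
  zero_mem' _ _ := rfl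
  add_mem' hx hy i hi := by simp [hx i hi, hy i hi]
  smul_mem' a x hx i hi := by simp [hx i hi]

theorem stdIsotropic_le : stdIsotropic F n ≤ perp (bilForm F (2 * n + 1)) (stdIsotropic F n) := by
  intro x hx y hy
  rw [bilForm_apply]
  refine Finset.sum_eq_zero fun i _ => ?_
  rcases le_total n i with hi | hi
  · rw [hx i hi, zero_mul]
  · rw [hy i.rev (by rw [Fin.val_rev]; omega), mul_zero]

theorem eq_zero_of_mem_perp_std {x : Fin (2 * n + 1) → F}
    (hx : x ∈ perp (bilForm F (2 * n + 1)) (stdIsotropic F n)) (i : Fin (2 * n + 1))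
    (hi : n < i) : x i = 0 := by
  rw [← bilForm_single F _ x i]
  refine hx _ fun j hj => ?_
  rw [Pi.single_eq_of_ne]
  rintro rfl
  rw [Fin.val_rev] at hj
  omega

theorem self_eq_of_mem_perp_std {x : Fin (2 * n + 1) → F}
    (hx : x ∈ perp (bilForm F (2 * n + 1)) (stdIsotropic F n)) :
    bilForm F (2 * n + 1) x x = x ⟨n, by omega⟩ * x ⟨n, by omega⟩ := by
  rw [bilForm_apply, Finset.sum_eq_single ⟨n, by omega⟩]
  · congr 2
    ext
    simp only [Fin.val_rev]
    omega
  · intro i _ hi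
    have hi' : (i : ℕ) ≠ n := fun h => hi (Fin.ext h)
    rcases lt_or_gt_of_ne hi' with h | h
    · rw [eq_zero_of_mem_perp_std hx i.rev (by rw [Fin.val_rev]; omega), mul_zero]
    · rw [eq_zero_of_mem_perp_std hx i h, zero_mul]
  · simp

theorem mem_of_isotropic {U : Submodule F (Fin (2 * n + 1) → F)}
    (hU : U ≤ perp (bilForm F (2 * n + 1)) U) (hn : finrank F U = n) {x : Fin (2 * n + 1) → F}
    (hx : x ∈ perp (bilForm F (2 * n + 1)) U) (h0 : bilForm F (2 * n + 1) x x = 0) : x ∈ U := by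
  by_contra hxU
  have hlt : U < U ⊔ F ∙ x := by
    refine lt_of_le_of_ne le_sup_left fun h => hxU ?_
    rw [h]
    exact Submodule.mem_sup_right (Submodule.mem_span_singleton_self _)
  have hiso : U ⊔ F ∙ x ≤ perp (bilForm F (2 * n + 1)) (U ⊔ F ∙ x) := by
    intro y hy z hz
    obtain ⟨u, hu, _, h1, rfl⟩ := Submodule.mem_sup.1 hy
    obtain ⟨v, hv, _, h2, rfl⟩ := Submodule.mem_sup.1 hz
    obtain ⟨a, rfl⟩ := Submodule.mem_span_singleton.1 h1
    obtain ⟨b, rfl⟩ := Submodule.mem_span_singleton.1 h2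
    have h3 := (symForm_bilForm F (2 * n + 1)).symm u x
    simp [hU hu v hv, hx v hv, h0, h3, hx u hu]
  have := Submodule.finrank_lt_finrank_of_lt hlt
  have := finrank_le_of_isotropic hiso
  omega

theorem exists_unit {U : Submodule F (Fin (2 * n + 1) → F)}
    (hU : U ≤ perp (bilForm F (2 * n + 1)) U) (hn : finrank F U = n) :
    ∃ e ∈ perp (bilForm F (2 * n + 1)) U, bilForm F (2 * n + 1) e e = 1 := by
  have hB := symForm_bilForm F (2 * n + 1)
  have h1 := finrank_perp hB (U ⊔ stdIsotropic F n)
  have h2 := Submodule.finrank_sup_add_finrank_inf_eq U (stdIsotropic F n)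
  have h3 := finrank_le_of_isotropic (stdIsotropic_le (F := F) (n := n))
  rw [finrank_fin_fun] at h1
  obtain ⟨f, hf, hfU⟩ : ∃ f ∈ perp (bilForm F (2 * n + 1)) (U ⊔ stdIsotropic F n), f ∉ U ⊓ stdIsotropic F n := by
    by_contra! hcon
    have : finrank F (perp (bilForm F (2 * n + 1)) (U ⊔ stdIsotropic F n)) ≤ finrank F ↥(U ⊓ stdIsotropic F n) :=
      Submodule.finrank_mono hcon
    omega
  have hf1 : f ∈ perp (bilForm F (2 * n + 1)) U := fun u hu => hf u (Submodule.mem_sup_left hu)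
  have hf2 : f ∈ perp (bilForm F (2 * n + 1)) (stdIsotropic F n) := fun u hu => hf u (Submodule.mem_sup_right hu)
  have hff := self_eq_of_mem_perp_std hf2
  set a := f ⟨n, by omega⟩ with ha
  have ha0 : a ≠ 0 := fun h0 => by
    refine hfU ⟨mem_of_isotropic hU hn hf1 (by rw [hff, h0, zero_mul]), fun i hi => ?_⟩
    rcases eq_or_lt_of_le hi with h | h
    · have : i = ⟨n, by omega⟩ := Fin.ext h.symm
      rw [this, ← ha, h0]
    · exact eq_zero_of_mem_perp_std hf2 i h
  refine ⟨a⁻¹ • f, Submodule.smul_mem _ _ hf1, ?_⟩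
  rw [map_smul, map_smul, LinearMap.smul_apply, hff, smul_eq_mul, smul_eq_mul]
  field_simp

theorem exists_config {U W V V₁ : Submodule F (Fin (2 * n + 1) → F)}
    (hU : U ≤ perp (bilForm F (2 * n + 1)) U) (hW : W ≤ perp (bilForm F (2 * n + 1)) W)
    (hV : V ≤ perp (bilForm F (2 * n + 1)) V) (hV₁ : V₁ ≤ V) (hn : finrank F U = n) :
    ∃ K : Config (bilForm F (2 * n + 1)), K.U = U ∧ K.W = W ∧ K.V = V ∧ K.V₁ = V₁ := by
  obtain ⟨e, he, hee⟩ := exists_unit hU hn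
  refine ⟨⟨U, W, V, V₁, e, hV₁, hU, hW, hV, he, hee, fun x hx => ?_⟩, rfl, rfl, rfl, rfl⟩
  have heU : e ∉ U := fun h => by
    have := he e h
    rw [hee] at this
    exact one_ne_zero this
  have hlt : U < U ⊔ F ∙ e := by
    refine lt_of_le_of_ne le_sup_left fun h => heU ?_
    rw [h]
    exact Submodule.mem_sup_right (Submodule.mem_span_singleton_self _)
  have h1 := finrank_perp (symForm_bilForm F (2 * n + 1)) U
  rw [finrank_fin_fun] at h1
  have h2 : U ⊔ F ∙ e = perp (bilForm F (2 * n + 1)) U := by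
    refine Submodule.eq_of_le_of_finrank_le
      (sup_le hU ((Submodule.span_singleton_le_iff_mem _ _).2 he)) ?_
    have := Submodule.finrank_lt_finrank_of_lt hlt
    omega
  rw [← h2] at hx
  obtain ⟨u, hu, _, h3, rfl⟩ := Submodule.mem_sup.1 hx
  obtain ⟨a, rfl⟩ := Submodule.mem_span_singleton.1 h3
  have h4 := he u hu
  rw [(symForm_bilForm F (2 * n + 1)).symm] at h4
  simpa [h4, hee] using hu

/-- The orbit relation for configurations on `F^{2n+1}` is controlled by finitely many codes. -/
theorem exists_code (h2 : (2 : F) ≠ 0) (m : ℕ) :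
    ∃ c : {K : Config (bilForm F (2 * n + 1)) // finrank F K.V = m} →
        VD.Code F m × Fin (2 * n + 2),
      ∀ K K', c K = c K' → finrank F K.1.U = finrank F K'.1.U →
        finrank F K.1.W = finrank F K'.1.W →
        ∃ g : (Fin (2 * n + 1) → F) ≃ₗ[F] (Fin (2 * n + 1) → F), IsOrthMap F (2 * n + 1) g ∧
          K.1.U.map g.toLinearMap = K'.1.U ∧ K.1.W.map g.toLinearMap = K'.1.W ∧
          K.1.V.map g.toLinearMap = K'.1.V ∧ K.1.V₁.map g.toLinearMap = K'.1.V₁ := by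
  have hB := symForm_bilForm F (2 * n + 1)
  have hk : ∀ K : {K : Config (bilForm F (2 * n + 1)) // finrank F K.V = m},
      ∃ b : Basis (Fin m) F K.1.V, K.1.data.Good b := fun K =>
    (VD.Ax.kr h2 m (K.1.data_ax hB) K.2).exists_fin K.2
  choose b hb using hk
  refine ⟨fun K => (K.1.data.code (b K), ⟨finrank F ↥(K.1.W ⊓ (K.1.V ⊔ perp (bilForm F (2 * n + 1)) K.1.U)), ?_⟩),
    fun K K' hc hU hW => ?_⟩
  · have := Submodule.finrank_le (K.1.W ⊓ (K.1.V ⊔ perp (bilForm F (2 * n + 1)) K.1.U))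
    rw [finrank_fin_fun] at this
    omega
  · simp only [Prod.mk.injEq, Fin.mk.injEq] at hc
    have h3 := finrank_perp hB K.1.U
    have h4 := finrank_perp hB K'.1.U
    obtain ⟨g, hg, h⟩ := Config.exists_isometry_of_iso h2 hB
      (VD.iso_of_code (hb K) (hb K') hc.1) hU (by omega) hW hc.2
    exact ⟨g, hg, h⟩

end

/-- for positive integers `α_1, α_2, β` with `α_1 + α_2 ≤ n` and
`β ≤ n`, the triple flag variety `M_{(α_1,α_2)} × M_{(β)} × M_{(n)}` has finitely
many `O_{2n+1}(F)`-orbits. -/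
theorem statement17 (F : Type*) [Field F] (hchar : (2 : F) ≠ 0)
    (n : ℕ) (hn : 1 ≤ n) (α₁ α₂ β : ℕ)
    (hα₁ : 0 < α₁) (hα₂ : 0 < α₂) (hβ : 0 < β)
    (hαn : α₁ + α₂ ≤ n) (hβn : β ≤ n) :
    Finite (Quot (TripleRel F n 2 1 1 ![α₁, α₂] ![β] ![n])) := by
  have hK : ∀ x : FlagVar F n 2 ![α₁, α₂] × FlagVar F n 1 ![β] × FlagVar F n 1 ![n],
      ∃ K : Config (bilForm F (2 * n + 1)), K.U = x.2.2.1 0 ∧ K.W = x.2.1.1 0 ∧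
        K.V = x.1.1 1 ∧ K.V₁ = x.1.1 0 := fun x =>
    exists_config (x.2.2.2.2.2 0) (x.2.1.2.2.2 0) (x.1.2.2.2 1) (x.1.2.1 (by decide))
      ((x.2.2.2.2.1 0).trans (by rw [show Finset.Iic (0 : Fin 1) = {0} from rfl]; simp))
  choose K hU hW hV hV₁ using hK
  have hm : ∀ x, finrank F (K x).V = ∑ j ∈ Finset.Iic (1 : Fin 2), ![α₁, α₂] j := fun x => by
    rw [hV, x.1.2.2.1]
  obtain ⟨c, hc⟩ := exists_code (n := n) hchar (∑ j ∈ Finset.Iic (1 : Fin 2), ![α₁, α₂] j)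
  refine Finite.of_injective (fun q => c ⟨K q.out, hm q.out⟩) fun q q' hqq => ?_
  obtain ⟨g, hg, h1, h2, h3, h4⟩ := hc _ _ hqq
    (by simp only; rw [hU, hU, (Quot.out q).2.2.2.2.1, (Quot.out q').2.2.2.2.1])
    (by simp only; rw [hW, hW, (Quot.out q).2.1.2.2.1, (Quot.out q').2.1.2.2.1])
  simp only [hU, hW, hV, hV₁] at h1 h2 h3 h4
  rw [← q.out_eq, ← q'.out_eq]
  refine Quot.sound ⟨g, hg, fun i => ?_, fun i => ?_, fun i => ?_⟩
  · fin_cases i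
    · exact h4
    · exact h3
  · fin_cases i
    exact h2
  · fin_cases i
    exact h1
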